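/- arXiv:1207.6141 — 2 statements merged into one kernel-verified Lean document; each statement's English description precedes it below -/
import Mathlib

section
/- The complete graph K_4 is rooted-contractible, i.e., every graph G that contains a K_4-scheme contains K_4 as a rooted minor. -/
open SimpleGraph

/-- An `H`-scheme in `G`, where the embedding `f` identifies the vertices of `H`
with vertices of `G`.  It is a collection of paths `P_{uv}` in `G`, one for each
edge `uv` of `H`, such that `P_{uv}` is a `u,v`-path meeting `V(H)` exactly in
`{u, v}`, and any collection of edges of `H` whose paths share a common vertex
of `G` must have a common endpoint in `H`. -/
structure HScheme {α β : Type} (H : SimpleGraph α) (G : SimpleGraph β) (f : α ↪ β) where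
  path : ∀ u v, H.Adj u v → G.Walk (f u) (f v)
  path_symm : ∀ u v (h : H.Adj u v), path v u h.symm = (path u v h).reverse
  path_isPath : ∀ u v (h : H.Adj u v), (path u v h).IsPath
  root_mem : ∀ u v (h : H.Adj u v) (w : α), f w ∈ (path u v h).support → w = u ∨ w = v
  common_endpoint : ∀ x : β,
    (∃ u v, ∃ h : H.Adj u v, x ∈ (path u v h).support) →
    ∃ z : α, ∀ u v (h : H.Adj u v), x ∈ (path u v h).support → z = u ∨ z = v

/-- `G` contains `H` as a rooted minor: pairwise disjoint connected branch sets
`C v ⊆ V(G)`, one for each vertex `v` of `H`, with `f v ∈ C v`, such that for every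
edge `uv` of `H` there is an edge of `G` between `C u` and `C v`. -/
def RootedMinor {α β : Type} (H : SimpleGraph α) (G : SimpleGraph β) (f : α ↪ β) : Prop :=
  ∃ C : α → Set β,
    (∀ v, f v ∈ C v) ∧
    (∀ v, (G.induce (C v)).Connected) ∧
    (Pairwise fun u v => Disjoint (C u) (C v)) ∧
    (∀ u v, H.Adj u v → ∃ x ∈ C u, ∃ y ∈ C v, G.Adj x y)

/-- `G` contains `H` as a minor: pairwise disjoint connected branch sets, one for each
vertex of `H`, such that for every edge `uv` of `H` there is an edge of `G` between the
corresponding branch sets. -/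
def HasMinor {β α : Type} (G : SimpleGraph β) (H : SimpleGraph α) : Prop :=
  ∃ C : α → Set β,
    (∀ v, (G.induce (C v)).Connected) ∧
    (Pairwise fun u v => Disjoint (C u) (C v)) ∧
    (∀ u v, H.Adj u v → ∃ x ∈ C u, ∃ y ∈ C v, G.Adj x y)

/-- `H` is rooted-contractible: every (finite) graph `G` containing an `H`-scheme
contains `H` as a rooted minor. -/
def IsRootedContractible {α : Type} (H : SimpleGraph α) : Prop :=
  ∀ (β : Type) [Fintype β] (G : SimpleGraph β) (f : α ↪ β),
    Nonempty (HScheme H G f) → RootedMinor H G f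

/-- `H` is weakly rooted-contractible: every (finite) graph `G` containing an
`H`-scheme contains `H` as a minor. -/
def IsWeaklyRootedContractible {α : Type} (H : SimpleGraph α) : Prop :=
  ∀ (β : Type) [Fintype β] (G : SimpleGraph β) (f : α ↪ β),
    Nonempty (HScheme H G f) → HasMinor G H

section Linkage

variable {V : Type} (G : SimpleGraph V)

/-- `x` and `y` are joined by a walk of `G` all of whose vertices lie in `S` (or `x = y`). -/
def LinkedIn (S : Set V) (x y : V) : Prop :=
  Relation.ReflTransGen (fun u v => G.Adj u v ∧ u ∈ S ∧ v ∈ S) x y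

/-- Any two vertices of `S` are joined by a walk inside `S`. -/
def IsConn (S : Set V) : Prop := ∀ x ∈ S, ∀ y ∈ S, LinkedIn G S x y

/-- Some edge of `G` joins `A` to `B`. -/
def Touch (A B : Set V) : Prop := ∃ x ∈ A, ∃ y ∈ B, G.Adj x y

/-- The vertices that can be reached from `a` inside `S`. -/
def compIn (S : Set V) (a : V) : Set V := {x | LinkedIn G S a x}

variable {G}

namespace LinkedIn

variable {S T : Set V} {x y z : V}

lemma refl : LinkedIn G S x x := Relation.ReflTransGen.refl

lemma trans (h : LinkedIn G S x y) (h' : LinkedIn G S y z) : LinkedIn G S x z :=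
  Relation.ReflTransGen.trans h h'

lemma mono (hST : S ⊆ T) (h : LinkedIn G S x y) : LinkedIn G T x y :=
  Relation.ReflTransGen.mono (fun _ _ h => ⟨h.1, hST h.2.1, hST h.2.2⟩) _ _ h

lemma single (h : G.Adj x y) (hx : x ∈ S) (hy : y ∈ S) : LinkedIn G S x y :=
  Relation.ReflTransGen.single ⟨h, hx, hy⟩

lemma symm (h : LinkedIn G S x y) : LinkedIn G S y x := by
  induction h with
  | refl => exact refl
  | tail _ hbc ih => exact (single hbc.1.symm hbc.2.2 hbc.2.1).trans ih

lemma mem (h : LinkedIn G S x y) (hx : x ∈ S) : y ∈ S := by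
  induction h with
  | refl => exact hx
  | tail _ hbc _ => exact hbc.2.2

/-- A walk leaving `P` has a first edge out of `P`. -/
lemma exists_exit {P : Set V} (h : LinkedIn G S x y) (hx : x ∈ P) (hy : y ∉ P) :
    ∃ u v, u ∈ P ∧ v ∉ P ∧ G.Adj u v ∧ u ∈ S ∧ v ∈ S ∧ LinkedIn G (S ∩ P) x u := by
  have key : (y ∈ P ∧ LinkedIn G (S ∩ P) x y) ∨
      ∃ u v, u ∈ P ∧ v ∉ P ∧ G.Adj u v ∧ u ∈ S ∧ v ∈ S ∧ LinkedIn G (S ∩ P) x u := by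
    clear hy
    induction h with
    | refl => exact Or.inl ⟨hx, refl⟩
    | @tail b c _ hbc ih =>
      rcases ih with ⟨hb, hl⟩ | h
      · by_cases hc : c ∈ P
        · exact Or.inl ⟨hc, hl.trans (single hbc.1 ⟨hbc.2.1, hb⟩ ⟨hbc.2.2, hc⟩)⟩
        · exact Or.inr ⟨b, c, hb, hc, hbc.1, hbc.2.1, hbc.2.2, hl⟩
      · exact Or.inr h
  rcases key with h | h
  · exact absurd h.1 hy
  · exact h

/-- A walk leaving `P` has a last edge out of `P`. -/
lemma exists_last_exit {P : Set V} (h : LinkedIn G S x y) (hx : x ∈ P) (hy : y ∉ P) :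
    ∃ u v, u ∈ P ∧ v ∉ P ∧ G.Adj u v ∧ u ∈ S ∧ v ∈ S ∧ LinkedIn G (S \ P) v y := by
  obtain ⟨u, v, hu, hv, huv, huS, hvS, hl⟩ :=
    h.symm.exists_exit (P := Pᶜ) hy (by simpa using hx)
  exact ⟨v, u, by simpa using hv, hu, huv.symm, hvS, huS, hl.symm⟩

end LinkedIn

section Comp

variable {S T A B X : Set V} {a b v x y : V}

lemma mem_compIn_self : a ∈ compIn G S a := LinkedIn.refl

lemma compIn_subset (ha : a ∈ S) : compIn G S a ⊆ S := fun _ h => LinkedIn.mem h ha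

lemma LinkedIn.in_compIn (h : LinkedIn G S a x) : LinkedIn G (compIn G S a) a x := by
  induction h with
  | refl => exact LinkedIn.refl
  | tail hab hbc ih =>
    exact ih.trans (LinkedIn.single hbc.1 hab (hab.trans (LinkedIn.single hbc.1 hbc.2.1 hbc.2.2)))

lemma isConn_compIn : IsConn G (compIn G S a) := fun _ hx _ hy =>
  (LinkedIn.in_compIn hx).symm.trans (LinkedIn.in_compIn hy)

lemma compIn_closed (ha : a ∈ S) (hx : x ∈ compIn G S a) (hxy : G.Adj x y) (hy : y ∈ S) :
    y ∈ compIn G S a :=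
  LinkedIn.trans hx (LinkedIn.single hxy (compIn_subset ha hx) hy)

lemma IsConn.subset_compIn (hT : IsConn G T) (ha : a ∈ T) (hTS : T ⊆ S) : T ⊆ compIn G S a :=
  fun x hx => (hT a ha x hx).mono hTS

lemma Touch.symm (h : Touch G A B) : Touch G B A := by
  obtain ⟨x, hx, y, hy, h⟩ := h
  exact ⟨y, hy, x, hx, h.symm⟩

lemma Touch.mono {A' B' : Set V} (h : Touch G A B) (hA : A ⊆ A') (hB : B ⊆ B') :
    Touch G A' B' := by
  obtain ⟨x, hx, y, hy, h⟩ := h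
  exact ⟨x, hA hx, y, hB hy, h⟩

lemma IsConn.union (hA : IsConn G A) (hB : IsConn G B) (h : Touch G A B) :
    IsConn G (A ∪ B) := by
  obtain ⟨u, hu, v, hv, huv⟩ := h
  have key : ∀ x ∈ A ∪ B, LinkedIn G (A ∪ B) x u := by
    rintro x (hx | hx)
    · exact (hA x hx u hu).mono Set.subset_union_left
    · exact ((hB x hx v hv).mono Set.subset_union_right).trans
        (LinkedIn.single huv.symm (Or.inr hv) (Or.inl hu))
  exact fun x hx y hy => (key x hx).trans (key y hy).symm

lemma isConn_singleton : IsConn G ({a} : Set V) := by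
  rintro x rfl y rfl
  exact LinkedIn.refl

/-- Removing from a connected set one component of the complement of a connected subset leaves a
connected set. -/
lemma IsConn.diff_compIn (hA : IsConn G A) (hX : IsConn G X) (hXA : X ⊆ A) (hx : x ∈ X)
    (ha : a ∈ A) (haX : a ∉ X) : IsConn G (A \ compIn G (A \ X) a) := by
  have hXd : X ⊆ A \ compIn G (A \ X) a := fun y hy =>
    ⟨hXA hy, fun h => (compIn_subset (S := A \ X) ⟨ha, haX⟩ h).2 hy⟩
  have key : ∀ w ∈ A \ compIn G (A \ X) a, LinkedIn G (A \ compIn G (A \ X) a) w x := by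
    intro w hw
    by_cases hwX : w ∈ X
    · exact (hX w hwX x hx).mono hXd
    · obtain ⟨u, v, hu, hv, huv, huA, hvA, hl⟩ :=
        (hA w hw.1 x (hXA hx)).exists_exit (P := Xᶜ) hwX (by simpa using hx)
      have hvX : v ∈ X := by simpa using hv
      have hsub : compIn G (A \ X) w ⊆ A \ compIn G (A \ X) a := fun z hz =>
        ⟨(compIn_subset (S := A \ X) ⟨hw.1, hwX⟩ hz).1, fun h =>
          hw.2 (LinkedIn.trans h (LinkedIn.symm hz))⟩
      have hl' : LinkedIn G (A \ compIn G (A \ X) a) w u := (LinkedIn.in_compIn hl).mono hsub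
      exact (hl'.trans (LinkedIn.single huv (hl'.mem hw) (hXd hvX))).trans
        ((hX v hvX x hx).mono hXd)
  exact fun y hy z hz => (key y hy).trans (key z hz).symm

lemma touch_compIn_diff (hA : IsConn G A) (hXA : X ⊆ A) (hx : x ∈ X)
    (ha : a ∈ A) (haX : a ∉ X) : Touch G (compIn G (A \ X) a) X := by
  obtain ⟨u, v, hu, hv, huv, -, hvA, -⟩ := (hA a ha x (hXA hx)).exists_exit
    (P := compIn G (A \ X) a) mem_compIn_self
    (fun h => (compIn_subset (S := A \ X) ⟨ha, haX⟩ h).2 hx)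
  refine ⟨u, hu, v, ?_, huv⟩
  by_contra hvX
  exact hv (compIn_closed ⟨ha, haX⟩ hu huv ⟨hvA, hvX⟩)

end Comp

section Lists

variable {l l₁ l₂ : List V} {S : Set V} {x y : V}

lemma isConn_list (h : l.IsChain G.Adj) : IsConn G {x | x ∈ l} := by
  induction l with
  | nil => intro x hx; simp at hx
  | cons a l ih =>
    rw [List.isChain_cons] at h
    cases l with
    | nil =>
      have : {x | x ∈ [a]} = {a} := by ext; simp
      rw [this]; exact isConn_singleton
    | cons b l =>
      have : {x | x ∈ a :: b :: l} = {a} ∪ {x | x ∈ b :: l} := by ext; simp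
      rw [this]
      exact isConn_singleton.union (ih h.2) ⟨a, rfl, b, by simp, h.1 b (by simp)⟩

lemma touch_of_isChain_append (h : (l₁ ++ l₂).IsChain G.Adj) (h₁ : l₁ ≠ []) (h₂ : l₂ ≠ []) :
    Touch G {x | x ∈ l₁} {x | x ∈ l₂} := by
  rw [List.isChain_append] at h
  exact ⟨l₁.getLast h₁, List.getLast_mem h₁, l₂.head h₂, List.head_mem h₂,
    h.2.2 _ (List.getLast_mem_getLast? h₁) _ (List.head_mem_head? h₂)⟩

/-- A walk inside `S` can be shortened to a path inside `S`. -/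
lemma LinkedIn.exists_list (h : LinkedIn G S x y) (hx : x ∈ S) :
    ∃ l : List V, l.IsChain G.Adj ∧ l.Nodup ∧ l.head? = some x ∧ l.getLast? = some y ∧
      ∀ z ∈ l, z ∈ S := by
  classical
  have key : ∃ w : G.Walk x y, ∀ z ∈ w.support, z ∈ S := by
    induction h with
    | refl => exact ⟨Walk.nil, by simpa using hx⟩
    | tail _ hbc ih =>
      obtain ⟨w, hw⟩ := ih
      refine ⟨w.concat hbc.1, fun z hz => ?_⟩
      rw [Walk.support_concat] at hz
      simp only [List.mem_append, List.mem_singleton] at hz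
      rcases hz with hz | rfl
      · exact hw z hz
      · exact hbc.2.2
  obtain ⟨w, hw⟩ := key
  refine ⟨w.bypass.support, w.bypass.isChain_adj_support, w.bypass_isPath.support_nodup, ?_, ?_,
    fun z hz => hw z (w.support_bypass_subset_support hz)⟩
  · rw [List.head?_eq_some_head w.bypass.support_ne_nil, Walk.head_support]
  · rw [List.getLast?_eq_some_getLast w.bypass.support_ne_nil, Walk.getLast_support]

lemma exists_append_of_mem_of_ne {p q : V} (hp : p ∈ l) (hq : q ∈ l) (hpq : p ≠ q) :
    ∃ l₁ l₂, l = l₁ ++ l₂ ∧ ((p ∈ l₁ ∧ q ∈ l₂) ∨ (q ∈ l₁ ∧ p ∈ l₂)) := by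
  obtain ⟨s, t, rfl⟩ := List.append_of_mem hp
  simp only [List.mem_append, List.mem_cons] at hq
  rcases hq with hq | hq | hq
  · exact ⟨s, p :: t, rfl, Or.inr ⟨hq, by simp⟩⟩
  · exact absurd hq.symm hpq
  · exact ⟨s ++ [p], t, by simp, Or.inl ⟨by simp, hq⟩⟩

variable (G) in
/-- The list `l` is a walk whose first vertex has a neighbour in `L` and whose last vertex has a
neighbour in `R`. -/
structure Bridge (L : Set V) (l : List V) (R : Set V) : Prop where
  chain : l.IsChain G.Adj
  head : ∀ x ∈ l.head?, ∃ s ∈ L, G.Adj s x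
  last : ∀ x ∈ l.getLast?, ∃ t ∈ R, G.Adj x t

variable {L R : Set V}

lemma Bridge.touch_left (h : Bridge G L (l₁ ++ l₂) R) (h₁ : l₁ ≠ []) :
    Touch G L {x | x ∈ l₁} := by
  obtain ⟨s, hs, h⟩ := h.head (l₁.head h₁) (by
    rw [List.head?_append_of_ne_nil _ h₁]; exact List.head_mem_head? h₁)
  exact ⟨s, hs, _, List.head_mem h₁, h⟩

lemma Bridge.touch_right (h : Bridge G L (l₁ ++ l₂) R) (h₂ : l₂ ≠ []) :
    Touch G {x | x ∈ l₂} R := by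
  obtain ⟨t, ht, h⟩ := h.last (l₂.getLast h₂) (by
    rw [List.getLast?_append_of_ne_nil _ h₂]; exact List.getLast_mem_getLast? h₂)
  exact ⟨_, List.getLast_mem h₂, t, ht, h⟩

lemma Bridge.reverse (h : Bridge G L l R) : Bridge G R l.reverse L := by
  refine ⟨?_, ?_, ?_⟩
  · rw [List.isChain_reverse]
    exact h.chain.imp fun _ _ h => h.symm
  · intro x hx
    rw [List.head?_reverse] at hx
    obtain ⟨t, ht, h⟩ := h.last x hx
    exact ⟨t, ht, h.symm⟩
  · intro x hx
    rw [List.getLast?_reverse] at hx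
    obtain ⟨t, ht, h⟩ := h.head x hx
    exact ⟨t, ht, h.symm⟩

end Lists

end Linkage

section Diamonds

variable {V : Type} {G : SimpleGraph V}

variable (G) in
/-- Deleting any two vertices leaves all the other vertices linked to each other. -/
def SurvivesPairs : Prop :=
  ∀ u v x y : V, x ≠ u → x ≠ v → y ≠ u → y ≠ v → LinkedIn G {u, v}ᶜ x y

variable (G) in
/-- Four disjoint connected sets rooted at `a`, `b`, `c`, `d`, touching pairwise except possibly
for the second and the third. -/
structure IsDiamond (a b c d : V) (A B C D : Set V) : Prop where
  connA : IsConn G A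
  connB : IsConn G B
  connC : IsConn G C
  connD : IsConn G D
  memA : a ∈ A
  memB : b ∈ B
  memC : c ∈ C
  memD : d ∈ D
  disj : ∀ x, (x ∈ A → x ∉ B ∧ x ∉ C ∧ x ∉ D) ∧ (x ∈ B → x ∉ C ∧ x ∉ D) ∧ (x ∈ C → x ∉ D)
  touchAB : Touch G A B
  touchAC : Touch G A C
  touchAD : Touch G A D
  touchBD : Touch G B D
  touchCD : Touch G C D

variable (G) in
/-- `G` has a `K₄` minor rooted at `a`, `b`, `c`, `d`. -/
def HasK4 (a b c d : V) : Prop :=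
  ∃ A B C D, IsDiamond G a b c d A B C D ∧ Touch G B C

variable {a b c d : V} {A B C D : Set V}

lemma IsDiamond.swap_mid (h : IsDiamond G a b c d A B C D) : IsDiamond G a c b d A C B D where
  connA := h.connA
  connB := h.connC
  connC := h.connB
  connD := h.connD
  memA := h.memA
  memB := h.memC
  memC := h.memB
  memD := h.memD
  disj x := by have := h.disj x; grind
  touchAB := h.touchAC
  touchAC := h.touchAB
  touchAD := h.touchAD
  touchBD := h.touchCD
  touchCD := h.touchBD

lemma IsDiamond.swap_ends (h : IsDiamond G a b c d A B C D) : IsDiamond G d b c a D B C A where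
  connA := h.connD
  connB := h.connB
  connC := h.connC
  connD := h.connA
  memA := h.memD
  memB := h.memB
  memC := h.memC
  memD := h.memA
  disj x := by have := h.disj x; grind
  touchAB := h.touchBD.symm
  touchAC := h.touchCD.symm
  touchAD := h.touchAD.symm
  touchBD := h.touchAB.symm
  touchCD := h.touchAC.symm

lemma IsDiamond.mono {A' B' C' D' : Set V} (h : IsDiamond G a b c d A B C D)
    (hA : IsConn G A') (hB : IsConn G B') (hC : IsConn G C') (hD : IsConn G D')
    (hAA : A ⊆ A') (hBB : B ⊆ B') (hCC : C ⊆ C') (hDD : D ⊆ D')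
    (hd : ∀ x, (x ∈ A' → x ∉ B' ∧ x ∉ C' ∧ x ∉ D') ∧ (x ∈ B' → x ∉ C' ∧ x ∉ D') ∧
      (x ∈ C' → x ∉ D')) : IsDiamond G a b c d A' B' C' D' where
  connA := hA
  connB := hB
  connC := hC
  connD := hD
  memA := hAA h.memA
  memB := hBB h.memB
  memC := hCC h.memC
  memD := hDD h.memD
  disj := hd
  touchAB := h.touchAB.mono hAA hBB
  touchAC := h.touchAC.mono hAA hCC
  touchAD := h.touchAD.mono hAA hDD
  touchBD := h.touchBD.mono hBB hDD
  touchCD := h.touchCD.mono hCC hDD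

lemma HasK4.swap_mid (h : HasK4 G a b c d) : HasK4 G a c b d := by
  obtain ⟨A, B, C, D, h, t⟩ := h
  exact ⟨A, C, B, D, h.swap_mid, t.symm⟩

lemma HasK4.swap_ends (h : HasK4 G a b c d) : HasK4 G d b c a := by
  obtain ⟨A, B, C, D, h, t⟩ := h
  exact ⟨D, B, C, A, h.swap_ends, t⟩

lemma HasK4.swap_left (h : HasK4 G a b c d) : HasK4 G b a c d := by
  obtain ⟨A, B, C, D, h, t⟩ := h
  refine ⟨B, A, C, D, ⟨h.connB, h.connA, h.connC, h.connD, h.memB, h.memA, h.memC, h.memD,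
    fun x => ?_, h.touchAB.symm, t, h.touchBD, h.touchAD, h.touchCD⟩, h.touchAC⟩
  have := h.disj x
  grind

lemma exists_touch_sup {S : Set V} (hG : ∀ x y, LinkedIn G Set.univ x y) {x y : V} (hx : x ∈ S)
    (hy : y ∉ S) : ∃ w, w ∉ S ∧ Touch G S {w} := by
  obtain ⟨u, v, hu, hv, huv, -⟩ := (hG x y).exists_exit hx hy
  exact ⟨v, hv, u, hu, v, rfl, huv⟩

lemma Touch.of_union_left {S : Set V} (h : Touch G (A ∪ B) S) : Touch G A S ∨ Touch G B S := by
  obtain ⟨x, hx | hx, y, hy, hxy⟩ := h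
  · exact Or.inl ⟨x, hx, y, hy, hxy⟩
  · exact Or.inr ⟨x, hx, y, hy, hxy⟩

lemma Touch.of_union_right {S : Set V} (h : Touch G S (A ∪ B)) : Touch G S A ∨ Touch G S B := by
  rcases h.symm.of_union_left with h | h
  · exact Or.inl h.symm
  · exact Or.inr h.symm

/-- In a connected finite graph every diamond extends to a spanning one. -/
lemma IsDiamond.exists_spanning [Finite V] (hG : ∀ x y, LinkedIn G Set.univ x y)
    (h : IsDiamond G a b c d A B C D) :
    ∃ A' B' C' D', IsDiamond G a b c d A' B' C' D' ∧ B ⊆ B' ∧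
      ∀ v, v ∈ A' ∨ v ∈ B' ∨ v ∈ C' ∨ v ∈ D' := by
  induction hn : ((A ∪ B ∪ C ∪ D)ᶜ).ncard using Nat.strong_induction_on generalizing A B C D with
  | _ n ih =>
  by_cases hcov : ∀ v, v ∈ A ∨ v ∈ B ∨ v ∈ C ∨ v ∈ D
  · exact ⟨A, B, C, D, h, subset_rfl, hcov⟩
  push Not at hcov
  obtain ⟨v, hv⟩ := hcov
  obtain ⟨w, hw, hT⟩ := exists_touch_sup (S := A ∪ B ∪ C ∪ D) hG
    (Or.inl (Or.inl (Or.inl h.memA))) (y := v) (by simp [hv])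
  have hlt : ∀ A' B' C' D' : Set V, A' ∪ B' ∪ C' ∪ D' = A ∪ B ∪ C ∪ D ∪ {w} →
      ((A' ∪ B' ∪ C' ∪ D')ᶜ).ncard < n := by
    intro A' B' C' D' he
    rw [he, ← hn]
    refine Set.ncard_lt_ncard ⟨Set.compl_subset_compl.2 Set.subset_union_left, fun hs => ?_⟩
      (Set.toFinite _)
    exact hs hw (Or.inr rfl)
  have hw' : w ∉ A ∧ w ∉ B ∧ w ∉ C ∧ w ∉ D := by
    simpa [not_or, and_assoc] using hw
  have hdis := h.disj
  rcases hT.of_union_left with hT | hT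
  · rcases hT.of_union_left with hT | hT
    · rcases hT.of_union_left with hT | hT
      · refine ih _ (hlt (A ∪ {w}) B C D ?_) (h.mono (h.connA.union isConn_singleton hT)
          h.connB h.connC h.connD Set.subset_union_left subset_rfl subset_rfl subset_rfl ?_) rfl
        · ext; simp only [Set.mem_union]; tauto
        · intro x; have := hdis x; simp only [Set.mem_union, Set.mem_singleton_iff]; grind
      · have he : A ∪ (B ∪ {w}) ∪ C ∪ D = A ∪ B ∪ C ∪ D ∪ {w} := by
          ext; simp only [Set.mem_union]; tauto
        obtain ⟨A', B', C', D', h1, h2, h3⟩ := ih _ (hlt _ _ _ _ he) (h.mono h.connA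
          (h.connB.union isConn_singleton hT)
          h.connC h.connD subset_rfl Set.subset_union_left subset_rfl subset_rfl (fun x => by
            have := hdis x; simp only [Set.mem_union, Set.mem_singleton_iff]; grind)) rfl
        exact ⟨A', B', C', D', h1, Set.subset_union_left.trans h2, h3⟩
    · refine ih _ (hlt A B (C ∪ {w}) D ?_) (h.mono h.connA h.connB
        (h.connC.union isConn_singleton hT)
        h.connD subset_rfl subset_rfl Set.subset_union_left subset_rfl ?_) rfl
      · ext; simp only [Set.mem_union]; tauto
      · intro x; have := hdis x; simp only [Set.mem_union, Set.mem_singleton_iff]; grind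
  · refine ih _ (hlt A B C (D ∪ {w}) ?_) (h.mono h.connA h.connB h.connC
      (h.connD.union isConn_singleton hT)
      subset_rfl subset_rfl subset_rfl Set.subset_union_left ?_) rfl
    · ext; simp only [Set.mem_union]; tauto
    · intro x; have := hdis x; simp only [Set.mem_union, Set.mem_singleton_iff]; grind

lemma SurvivesPairs.linked (hS : SurvivesPairs G) (hab : a ≠ b) (hac : a ≠ c) (hbc : b ≠ c)
    (x y : V) : LinkedIn G Set.univ x y := by
  have : ∃ r, x ≠ r ∧ y ≠ r := by
    by_contra! h
    have h1 := h a
    have h2 := h b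
    have h3 := h c
    by_cases hxa : x = a <;> by_cases hxb : x = b <;> grind
  obtain ⟨r, hx, hy⟩ := this
  exact (hS r r x y hx hx hy hy).mono (Set.subset_univ _)

/-- The set of vertices leaving `E` cannot be separated off by two vertices. -/
lemma SurvivesPairs.exists_exit (hS : SurvivesPairs G) {E : Set V} {x y p q : V} (hx : x ∈ E)
    (hy : y ∉ E) (hxp : x ≠ p) (hxq : x ≠ q) (hyp : y ≠ p) (hyq : y ≠ q) :
    ∃ u v, u ∈ E ∧ v ∉ E ∧ G.Adj u v ∧ u ≠ p ∧ u ≠ q ∧ v ≠ p ∧ v ≠ q := by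
  obtain ⟨u, v, hu, hv, huv, huS, hvS, -⟩ := (hS p q x y hxp hxq hyp hyq).exists_exit hx hy
  simp only [Set.mem_compl_iff, Set.mem_insert_iff, Set.mem_singleton_iff, not_or] at huS hvS
  exact ⟨u, v, hu, hv, huv, huS.1, huS.2, hvS.1, hvS.2⟩

section BridgeSplit

variable {L R E : Set V} {l₁ l₂ l : List V} {p q : V}

lemma Bridge.touch_fst (h : Bridge G L l R) (hl : l ≠ []) : Touch G L {v | v ∈ l} :=
  Bridge.touch_left (l₂ := []) (by simpa using h) hl

lemma Bridge.touch_snd (h : Bridge G L l R) (hl : l ≠ []) : Touch G {v | v ∈ l} R :=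
  Bridge.touch_right (l₁ := []) h hl

lemma Bridge.conn_left (h : Bridge G L (l₁ ++ l₂) R) (hL : IsConn G L) :
    IsConn G (L ∪ {v | v ∈ l₁}) := by
  rcases eq_or_ne l₁ [] with rfl | h₁
  · simpa using hL
  · exact hL.union (isConn_list (List.isChain_append.1 h.chain).1) (h.touch_left h₁)

lemma Bridge.conn_right (h : Bridge G L (l₁ ++ l₂) R) (hR : IsConn G R) :
    IsConn G ({v | v ∈ l₂} ∪ R) := by
  rcases eq_or_ne l₂ [] with rfl | h₂
  · simpa using hR
  · exact (isConn_list (List.isChain_append.1 h.chain).2.1).union hR (h.touch_right h₂)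

lemma Bridge.touch_split (h : Bridge G L (l₁ ++ l₂) R) (hne : l₁ ++ l₂ ≠ []) :
    Touch G (L ∪ {v | v ∈ l₁}) ({v | v ∈ l₂} ∪ R) := by
  rcases eq_or_ne l₁ [] with rfl | h₁
  · exact (h.touch_fst hne).mono Set.subset_union_left Set.subset_union_left
  · rcases eq_or_ne l₂ [] with rfl | h₂
    · exact (h.touch_snd hne).mono (by simp) (by simp)
    · exact (touch_of_isChain_append h.chain h₁ h₂).mono
        Set.subset_union_right Set.subset_union_left

/-- A set touching a bridge at one of its vertices, and the bridge or its ends at another vertex,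
touches both parts of some splitting of the bridge. -/
lemma exists_split_touch (hp : p ∈ l) (hq : q ∈ L ∨ q ∈ l ∨ q ∈ R) (hpq : p ≠ q)
    (hEp : Touch G E {p}) (hEq : Touch G E {q}) :
    ∃ l₁ l₂, l = l₁ ++ l₂ ∧ Touch G E (L ∪ {v | v ∈ l₁}) ∧ Touch G E ({v | v ∈ l₂} ∪ R) := by
  rcases hq with hq | hq | hq
  · exact ⟨[], l, rfl, hEq.mono subset_rfl (by simpa using hq),
      hEp.mono subset_rfl (by simp [hp])⟩
  · obtain ⟨l₁, l₂, rfl, h | h⟩ := exists_append_of_mem_of_ne hp hq hpq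
    · exact ⟨l₁, l₂, rfl, hEp.mono subset_rfl (by simp [h]), hEq.mono subset_rfl (by simp [h])⟩
    · exact ⟨l₁, l₂, rfl, hEq.mono subset_rfl (by simp [h]), hEp.mono subset_rfl (by simp [h])⟩
  · exact ⟨l, [], by simp, hEp.mono subset_rfl (by simp [hp]),
      hEq.mono subset_rfl (by simpa using hq)⟩

end BridgeSplit

/-- Two disjoint bridges between `L` and `R`, one inside `B` and the other outside `B` and `C`,
yield a rooted `K₄` minor. -/
lemma hasK4_of_bridges (hS : SurvivesPairs G) {L R : Set V} {M X : List V}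
    (hL : IsConn G L) (hR : IsConn G R) (hB : IsConn G B) (hC : IsConn G C)
    (ha : a ∈ L) (hd : d ∈ R) (hb : b ∈ B) (hc : c ∈ C)
    (hdis : ∀ v, (v ∈ L → v ∉ M ∧ v ∉ R ∧ v ∉ B ∧ v ∉ C) ∧ (v ∈ M → v ∉ R ∧ v ∉ B ∧ v ∉ C) ∧
      (v ∈ R → v ∉ B ∧ v ∉ C) ∧ (v ∈ B → v ∉ C))
    (hcov : ∀ v, v ∈ L ∨ v ∈ M ∨ v ∈ R ∨ v ∈ B ∨ v ∈ C)
    (hBC : ¬ Touch G B C) (hMn : M.Nodup) (hXn : X.Nodup) (hM : Bridge G L M R)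
    (hX : Bridge G L X R) (hX0 : X ≠ []) (hXB : ∀ v ∈ X, v ∈ B) (hbX : b ∉ X)
    (hBM : Touch G (compIn G (B \ {v | v ∈ X}) b) {v | v ∈ M})
    (hCM : Touch G C {v | v ∈ M}) : HasK4 G a b c d := by
  have hbX' : b ∈ B \ {v | v ∈ X} := ⟨hb, hbX⟩
  set E := compIn G (B \ {v | v ∈ X}) b with hE
  have hEB : E ⊆ B \ {v | v ∈ X} := compIn_subset hbX'
  have hEB1 : ∀ v ∈ E, v ∈ B ∧ v ∉ X := fun v hv => hEB hv
  have hbE : b ∈ E := mem_compIn_self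
  have hEc : IsConn G E := isConn_compIn
  obtain ⟨x₀, hx₀⟩ := List.exists_mem_of_ne_nil X hX0
  have hXc : IsConn G {v | v ∈ X} := isConn_list hX.chain
  obtain ⟨u₁, hu₁, p, hp, hup⟩ := touch_compIn_diff hB (X := {v | v ∈ X}) hXB hx₀ hb hbX
  obtain ⟨u₂, hu₂, m, hm, hum⟩ := hBM
  have hp : p ∈ X := hp
  have hm : m ∈ M := hm
  have hEp : Touch G E {p} := ⟨u₁, hu₁, p, rfl, hup⟩
  have hEm : Touch G E {m} := ⟨u₂, hu₂, m, rfl, hum⟩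
  have hM0 : M ≠ [] := List.ne_nil_of_mem hm
  have hcE : c ∉ E := fun h => (hdis c).2.2.2 (hEB1 c h).1 hc
  obtain ⟨u, q, hu, hq, huq, -, -, hqp, hqm⟩ := hS.exists_exit (p := p) (q := m) hbE hcE
    (by rintro rfl; exact hbX hp) (by rintro rfl; exact ((hdis b).2.1 hm).2.1 hb)
    (by rintro rfl; exact (hdis c).2.2.2 (hXB c hp) hc)
    (by rintro rfl; exact ((hdis c).2.1 hm).2.2 hc)
  have hEq : Touch G E {q} := ⟨u, hu, q, rfl, huq⟩
  have hq' : (q ∈ L ∨ q ∈ X ∨ q ∈ R) ∨ q ∈ M := by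
    rcases hcov q with h | h | h | h | h
    · simp [h]
    · simp [h]
    · simp [h]
    · by_cases hqX : q ∈ X
      · simp [hqX]
      · exact absurd (compIn_closed hbX' hu huq ⟨h, hqX⟩) hq
    · exact absurd ⟨u, (hEB1 u hu).1, q, h, huq⟩ hBC
  rcases hq' with hq' | hqM
  · obtain ⟨X₁, X₂, rfl, h₁, h₂⟩ := exists_split_touch hp hq' hqp.symm hEp hEq
    refine ⟨L ∪ {v | v ∈ X₁}, E, C ∪ {v | v ∈ M}, {v | v ∈ X₂} ∪ R,
      ⟨hX.conn_left hL, hEc, hC.union (isConn_list hM.chain) hCM, hX.conn_right hR,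
        Or.inl ha, hbE, Or.inl hc, Or.inr hd, fun v => ?_, h₁.symm,
        (hM.touch_fst hM0).mono Set.subset_union_left Set.subset_union_right,
        hX.touch_split hX0, h₂,
        (hM.touch_snd hM0).mono Set.subset_union_right Set.subset_union_right⟩,
      hEm.mono subset_rfl (by simp [hm])⟩
    have h1 := hdis v
    have h2 := hEB1 v
    have h3 := hXB v
    simp only [List.mem_append, Set.mem_union, Set.mem_ofPred_eq] at h2 h3 ⊢
    rw [List.nodup_append] at hXn
    have h4 := fun h h' => hXn.2.2 v h v h' rfl
    clear * - h1 h2 h3 h4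
    grind (splits := 50)
  · obtain ⟨M₁, M₂, rfl, hM12⟩ := exists_append_of_mem_of_ne hm hqM hqm.symm
    have hM1 : Touch G E {v | v ∈ M₁} := by
      rcases hM12 with h | h
      · exact hEm.mono subset_rfl (by simp [h])
      · exact hEq.mono subset_rfl (by simp [h])
    have hM2 : Touch G E {v | v ∈ M₂} := by
      rcases hM12 with h | h
      · exact hEq.mono subset_rfl (by simp [h])
      · exact hEm.mono subset_rfl (by simp [h])
    have hM10 : M₁ ≠ [] := by
      obtain ⟨-, -, y, hy, -⟩ := hM1
      exact List.ne_nil_of_mem hy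
    have hM20 : M₂ ≠ [] := by
      obtain ⟨-, -, y, hy, -⟩ := hM2
      exact List.ne_nil_of_mem hy
    have hM1c : IsConn G {v | v ∈ M₁} := isConn_list (List.isChain_append.1 hM.chain).1
    have hM2c : IsConn G {v | v ∈ M₂} := isConn_list (List.isChain_append.1 hM.chain).2.1
    have hMM := touch_of_isChain_append hM.chain hM10 hM20
    have hCM' : Touch G C ({v | v ∈ M₁} ∪ {v | v ∈ M₂}) := hCM.mono subset_rfl (by intro v; simp)
    have hEX : Touch G E {v | v ∈ X} := hEp.mono subset_rfl (by simp [hp])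
    rw [List.nodup_append] at hMn
    have hnd := fun v h h' => hMn.2.2 v h v h' rfl
    rcases hCM'.of_union_right with hC1 | hC2
    · refine ⟨L ∪ {v | v ∈ X}, E, C ∪ {v | v ∈ M₁}, {v | v ∈ M₂} ∪ R,
        ⟨hL.union hXc (hX.touch_fst hX0), hEc, hC.union hM1c hC1, hM.conn_right hR,
          Or.inl ha, hbE, Or.inl hc, Or.inr hd, fun v => ?_,
          hEX.symm.mono Set.subset_union_right subset_rfl,
          (hM.touch_left hM10).mono Set.subset_union_left Set.subset_union_right,
          (hX.touch_snd hX0).mono Set.subset_union_right Set.subset_union_right,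
          hM2.mono subset_rfl Set.subset_union_left,
          hMM.mono Set.subset_union_right Set.subset_union_left⟩,
        hM1.mono subset_rfl Set.subset_union_right⟩
      have h1 := hdis v
      have h2 := hEB1 v
      have h3 := hXB v
      have h4 := hnd v
      simp only [List.mem_append, Set.mem_union, Set.mem_ofPred_eq] at h1 h2 h3 ⊢
      clear * - h1 h2 h3 h4
      grind (splits := 50)
    · refine ⟨L ∪ {v | v ∈ M₁}, E, C ∪ {v | v ∈ M₂}, {v | v ∈ X} ∪ R,
        ⟨hM.conn_left hL, hEc, hC.union hM2c hC2, hXc.union hR (hX.touch_snd hX0),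
          Or.inl ha, hbE, Or.inl hc, Or.inr hd, fun v => ?_,
          hM1.symm.mono Set.subset_union_right subset_rfl,
          hMM.mono Set.subset_union_right Set.subset_union_right,
          (hX.touch_fst hX0).mono Set.subset_union_left Set.subset_union_left,
          hEX.mono subset_rfl Set.subset_union_left,
          (hM.touch_right hM20).mono Set.subset_union_right Set.subset_union_right⟩,
        hM2.mono subset_rfl Set.subset_union_right⟩
      have h1 := hdis v
      have h2 := hEB1 v
      have h3 := hXB v
      have h4 := hnd v
      simp only [List.mem_append, Set.mem_union, Set.mem_ofPred_eq] at h1 h2 h3 ⊢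
      clear * - h1 h2 h3 h4
      grind (splits := 50)

end Diamonds

section Cuts

variable {V : Type} {G : SimpleGraph V} {a b c d : V} {A B C D E U : Set V}

lemma eq_of_contact_of_touch_compIn (hA : IsConn G A) (ha : a ∈ A)
    (hAC : Touch G A C)
    (hB : ∀ v ∈ A, v ≠ a → Touch G {v} B →
      ¬ (Touch G (compIn G (A \ {v}) a) C ∧ Touch G (compIn G (A \ {v}) a) D))
    (hC : ∀ v ∈ A, v ≠ a → Touch G {v} C →
      ¬ (Touch G (compIn G (A \ {v}) a) B ∧ Touch G (compIn G (A \ {v}) a) D))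
    {v : V} (hv : v ∈ A) (hva : v ≠ a) (hvB : Touch G {v} B)
    (hvD : Touch G (compIn G (A \ {v}) a) D) :
    ∀ w ∈ A, (Touch G {w} B ∨ Touch G {w} C) → w = v := by
  have key : ∀ w ∈ A, w ≠ v → w ∉ compIn G (A \ {v}) a →
      w ≠ a ∧ compIn G (A \ {v}) a ⊆ compIn G (A \ {w}) a ∧ v ∈ compIn G (A \ {w}) a := by
    intro w hw hwv hwn
    have hwa : w ≠ a := by rintro rfl; exact hwn mem_compIn_self
    have hsub : compIn G (A \ {v}) a ⊆ compIn G (A \ {w}) a := by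
      refine isConn_compIn.subset_compIn mem_compIn_self fun z hz => ⟨?_, ?_⟩
      · exact (compIn_subset (S := A \ {v}) ⟨ha, hva.symm⟩ hz).1
      · rintro rfl; exact hwn hz
    refine ⟨hwa, hsub, ?_⟩
    obtain ⟨u, hu, v', rfl, huv⟩ := touch_compIn_diff hA (X := {v}) (by simpa using hv) rfl ha
      (by simpa using hva.symm)
    exact compIn_closed ⟨ha, hwa.symm⟩ (hsub hu) huv ⟨hv, hwv.symm⟩
  have hnC := fun h => hB v hv hva hvB ⟨h, hvD⟩
  have hCv : ∀ w ∈ A, Touch G {w} C → w = v := by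
    intro w hw hwC
    by_contra hwv
    obtain ⟨h1, h2, h3⟩ := key w hw hwv fun h => hnC (hwC.mono (by simpa using h) subset_rfl)
    exact hC w hw h1 hwC ⟨hvB.mono (by simpa using h3) subset_rfl, hvD.mono h2 subset_rfl⟩
  have hvC : Touch G {v} C := by
    obtain ⟨w, hw, y, hy, hwy⟩ := hAC
    have hwC : Touch G {w} C := ⟨w, rfl, y, hy, hwy⟩
    exact hCv w hw hwC ▸ hwC
  have hnB := fun h => hC v hv hva hvC ⟨h, hvD⟩
  rintro w hw (hwB | hwC)
  · by_contra hwv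
    obtain ⟨h1, h2, h3⟩ := key w hw hwv fun h => hnB (hwB.mono (by simpa using h) subset_rfl)
    exact hB w hw h1 hwB ⟨hvC.mono (by simpa using h3) subset_rfl, hvD.mono h2 subset_rfl⟩
  · exact hCv w hw hwC

/-- If no vertex of `A` touching `B` (or `C`) can be cut off from `a` together with what lies
beyond it without destroying the other contacts, then either each contact of `A` with `B ∪ C`
separates `a` from `D`, or `A` has only one contact. -/
lemma contacts_separate_or_unique (hA : IsConn G A) (ha : a ∈ A) (hAB : Touch G A B)
    (hAC : Touch G A C)
    (hB : ∀ v ∈ A, v ≠ a → Touch G {v} B →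
      ¬ (Touch G (compIn G (A \ {v}) a) C ∧ Touch G (compIn G (A \ {v}) a) D))
    (hC : ∀ v ∈ A, v ≠ a → Touch G {v} C →
      ¬ (Touch G (compIn G (A \ {v}) a) B ∧ Touch G (compIn G (A \ {v}) a) D)) :
    (∀ v ∈ A, v ≠ a → (Touch G {v} B ∨ Touch G {v} C) → ¬ Touch G (compIn G (A \ {v}) a) D) ∨
      ∃ v ∈ A, v ≠ a ∧ ∀ w ∈ A, (Touch G {w} B ∨ Touch G {w} C) → w = v := by
  by_contra! h
  obtain ⟨⟨v, hv, hva, hvBC, hvD⟩, h2⟩ := h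
  obtain ⟨w, hw, hwBC, hwv⟩ := h2 v hv hva
  rcases hvBC with h | h
  · exact hwv (eq_of_contact_of_touch_compIn hA ha hAC hB hC hv hva h hvD w hw hwBC)
  · exact hwv (eq_of_contact_of_touch_compIn hA ha hAB hC hB hv hva h hvD w hw hwBC.symm)

/-- If every vertex of `U` separates `a` from `E`, at most one vertex of `U` reaches `E` avoiding
the rest of `U`. -/
lemma reach_unique (hA : IsConn G A) (ha : a ∈ A) (hUA : U ⊆ A)
    (hU : ∀ u ∈ U, u ≠ a → ¬ Touch G (compIn G (A \ {u}) a) E) {u₁ u₂ : V} (h₁ : u₁ ∈ U)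
    (h₂ : u₂ ∈ U) (hE₁ : Touch G (compIn G (A \ U ∪ {u₁}) u₁) E)
    (hE₂ : Touch G (compIn G (A \ U ∪ {u₂}) u₂) E) : u₁ = u₂ := by
  by_contra hne
  have key : ∀ v ∈ U, ∀ w ∈ U, v ≠ w → w ≠ a → Touch G (compIn G (A \ U ∪ {v}) v) E →
      v ∉ compIn G (A \ {w}) a := by
    intro v hv w hw hvw hwa hE hmem
    refine hU w hw hwa (hE.mono (fun z hz => ?_) subset_rfl)
    refine LinkedIn.trans hmem (LinkedIn.mono ?_ hz)
    rintro y (hy | rfl)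
    · exact ⟨hy.1, fun h => hy.2 (by rwa [Set.mem_singleton_iff.1 h])⟩
    · exact ⟨hUA hv, hvw⟩
  have ne_a : ∀ v ∈ U, ∀ w ∈ U, v ≠ w → Touch G (compIn G (A \ U ∪ {v}) v) E → v ≠ a := by
    intro v hv w hw hvw hE hva
    exact key v hv w hw hvw (hva ▸ hvw.symm) hE (hva ▸ mem_compIn_self)
  have h1a := ne_a u₁ h₁ u₂ h₂ hne hE₁
  have h2a := ne_a u₂ h₂ u₁ h₁ (Ne.symm hne) hE₂
  obtain ⟨u, v, hu, hv, huv, huA, hvA, hl⟩ := (hA a ha u₁ (hUA h₁)).exists_exit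
    (P := {u₁, u₂}ᶜ) (by simp [h1a.symm, h2a.symm]) (by simp)
  simp only [Set.mem_compl_iff, Set.mem_insert_iff, Set.mem_singleton_iff, not_or] at hu hv
  rcases (by tauto : v = u₁ ∨ v = u₂) with rfl | rfl
  · refine key v h₁ u₂ h₂ hne h2a hE₁ (LinkedIn.trans (hl.mono fun z hz => ?_)
      (LinkedIn.single huv ⟨huA, hu.2⟩ ⟨hvA, hne⟩))
    have := hz.2
    simp only [Set.mem_compl_iff, Set.mem_insert_iff, Set.mem_singleton_iff, not_or] at this
    exact ⟨hz.1, this.2⟩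
  · refine key v h₂ u₁ h₁ (Ne.symm hne) h1a hE₂ (LinkedIn.trans (hl.mono fun z hz => ?_)
      (LinkedIn.single huv ⟨huA, hu.1⟩ ⟨hvA, Ne.symm hne⟩))
    have := hz.2
    simp only [Set.mem_compl_iff, Set.mem_insert_iff, Set.mem_singleton_iff, not_or] at this
    exact ⟨hz.1, this.1⟩

/-- A configuration contradicting the absence of separating pairs. -/
lemma SurvivesPairs.false_of_separating (hS : SurvivesPairs G) (hA : IsConn G A) (ha : a ∈ A)
    (hUA : U ⊆ A) (hU : ∀ u ∈ U, u ≠ a → ¬ Touch G (compIn G (A \ {u}) a) E) {h e y : V}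
    (hAE : ∀ x ∈ A, x ∉ E)
    (hedge : ∀ x y, (x ∈ E ∨ x ∈ A ∧ x ∉ U) → G.Adj x y → y ∈ A ∨ y ∈ E ∨ y = h)
    (he : e ∈ E) (heh : e ≠ h) (hyA : y ∉ A) (hyE : y ∉ E) (hyh : y ≠ h) : False := by
  obtain ⟨p, hpy, hpe, hp⟩ : ∃ p, y ≠ p ∧ e ≠ p ∧
      ∀ u ∈ U, Touch G (compIn G (A \ U ∪ {u}) u) E → u = p := by
    by_cases hex : ∃ u ∈ U, Touch G (compIn G (A \ U ∪ {u}) u) E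
    · obtain ⟨u, hu, huE⟩ := hex
      exact ⟨u, fun h => hyA (h ▸ hUA hu), fun h => hAE u (hUA hu) (h ▸ he),
        fun w hw hwE => reach_unique hA ha hUA hU hw hu hwE huE⟩
    · exact ⟨h, hyh, heh, fun u hu huE => absurd ⟨u, hu, huE⟩ hex⟩
  obtain ⟨u, v, hu, hv, huv, -, -, hvp, hvh⟩ := hS.exists_exit
    (E := E ∪ {w | w ∈ A \ U ∧ Touch G (compIn G (A \ U) w) E}) (x := e) (y := y) (p := p) (q := h)
    (Or.inl he) (fun h => h.elim hyE fun h => hyA h.1.1) hpe heh hpy hyh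
  have hv' : v ∉ E ∧ ¬ (v ∈ A \ U ∧ Touch G (compIn G (A \ U) v) E) :=
    ⟨fun h => hv (Or.inl h), fun h => hv (Or.inr h)⟩
  rcases hu with hu | ⟨huA, huE⟩
  · rcases hedge u v (Or.inl hu) huv with h | h | h
    · by_cases hvU : v ∈ U
      · exact hvp (hp v hvU ⟨v, mem_compIn_self, u, hu, huv.symm⟩)
      · exact hv'.2 ⟨⟨h, hvU⟩, v, mem_compIn_self, u, hu, huv.symm⟩
    · exact hv'.1 h
    · exact hvh h
  · have huA' : u ∈ A ∧ u ∉ U := huA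
    rcases hedge u v (Or.inr huA') huv with h | h | h
    · by_cases hvU : v ∈ U
      · refine hvp (hp v hvU (huE.mono (fun z hz => ?_) subset_rfl))
        exact (LinkedIn.single huv.symm (Or.inr rfl) (Or.inl huA)).trans
          (LinkedIn.mono Set.subset_union_left hz)
      · have hvu : LinkedIn G (A \ U) v u := LinkedIn.single huv.symm ⟨h, hvU⟩ huA
        exact hv'.2 ⟨⟨h, hvU⟩, huE.mono (fun z hz => hvu.trans hz) subset_rfl⟩
    · exact hv'.1 h
    · exact hvh h

/-- In a spanning diamond without an edge from `B` to `C` in which the ends satisfy the dichotomy of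
`contacts_separate_or_unique`, the contacts of `A` separate `a` from `D`. -/
lemma IsDiamond.contacts_separate (hS : SurvivesPairs G) (h : IsDiamond G a b c d A B C D)
    (hcov : ∀ v, v ∈ A ∨ v ∈ B ∨ v ∈ C ∨ v ∈ D)
    (hA : (∀ v ∈ A, v ≠ a → (Touch G {v} B ∨ Touch G {v} C) →
        ¬ Touch G (compIn G (A \ {v}) a) D) ∨
      ∃ v ∈ A, v ≠ a ∧ ∀ w ∈ A, (Touch G {w} B ∨ Touch G {w} C) → w = v)
    (hD : (∀ v ∈ D, v ≠ d → (Touch G {v} B ∨ Touch G {v} C) →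
        ¬ Touch G (compIn G (D \ {v}) d) A) ∨
      ∃ v ∈ D, v ≠ d ∧ ∀ w ∈ D, (Touch G {w} B ∨ Touch G {w} C) → w = v) :
    ∀ v ∈ A, v ≠ a → (Touch G {v} B ∨ Touch G {v} C) →
        ¬ Touch G (compIn G (A \ {v}) a) D := by
  rcases hA with hA | ⟨v, hv, hva, hvu⟩
  · exact hA
  exfalso
  have hb := h.disj b
  have hbB := h.memB
  have hmemD := h.disj d
  have hdD := h.memD
  have hmema := h.disj a
  have haA := h.memA
  have hmemv := h.disj v
  rcases hD with hD | ⟨u, hu, hud, huu⟩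
  · refine hS.false_of_separating h.connD h.memD (U := {w | w ∈ D ∧ (Touch G {w} B ∨ Touch G {w} C)})
      (E := A \ {v}) (h := v) (e := a) (y := b) (fun w hw => hw.1) ?_ ?_ ?_ ⟨h.memA, hva.symm⟩
      hva.symm (by grind) (by grind) (by grind)
    · intro u hu hud hT
      exact hD u hu.1 hud hu.2 (hT.mono subset_rfl Set.sdiff_subset)
    · intro x hx hxA
      exact (h.disj x).1 hxA.1 |>.2.2 hx
    · intro x y hx hxy
      by_cases hyv : y = v
      · exact Or.inr (Or.inr hyv)
      rcases hcov y with hy | hy | hy | hy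
      · exact Or.inr (Or.inl ⟨hy, hyv⟩)
      · exfalso
        have hxB : Touch G {x} B := ⟨x, rfl, y, hy, hxy⟩
        rcases hx with hx | hx
        · exact hx.2 (hvu x hx.1 (Or.inl hxB))
        · exact hx.2 ⟨hx.1, Or.inl hxB⟩
      · exfalso
        have hxB : Touch G {x} C := ⟨x, rfl, y, hy, hxy⟩
        rcases hx with hx | hx
        · exact hx.2 (hvu x hx.1 (Or.inr hxB))
        · exact hx.2 ⟨hx.1, Or.inr hxB⟩
      · exact Or.inl hy
  · have hmemu := h.disj u
    obtain ⟨x, y, hx, hy, hxy, hxv, hxu, -, -⟩ := hS.exists_exit (E := A ∪ D) (x := a) (y := b)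
      (p := v) (q := u) (Or.inl h.memA) (by rintro (h | h) <;> grind) hva.symm (by grind)
      (by grind) (by grind)
    have hyBC : y ∈ B ∨ y ∈ C := by
      rcases hcov y with h | h | h | h
      · exact absurd (Or.inl h) hy
      · exact Or.inl h
      · exact Or.inr h
      · exact absurd (Or.inr h) hy
    have hxT : Touch G {x} B ∨ Touch G {x} C :=
      hyBC.imp (fun h => ⟨x, rfl, y, h, hxy⟩) (fun h => ⟨x, rfl, y, h, hxy⟩)
    rcases hx with hx | hx
    · exact hxv (hvu x hx hxT)
    · exact hxu (huu x hx hxT)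

/-- If `v` separates `a` from `D` inside `A`, it separates `a` from `d` inside `A ∪ D`. -/
lemma not_linkedIn_union_diff {v : V} (ha : a ∈ A) (hd : d ∈ D) (hAD : ∀ x ∈ A, x ∉ D)
    (hva : v ≠ a) (h : ¬ Touch G (compIn G (A \ {v}) a) D) :
    ¬ LinkedIn G ((A ∪ D) \ {v}) a d := by
  intro hl
  obtain ⟨x, y, hx, hy, hxy, -, hyJ, -⟩ := hl.exists_exit (P := compIn G (A \ {v}) a)
    mem_compIn_self (fun h => hAD d (compIn_subset (S := A \ {v}) ⟨ha, hva.symm⟩ h).1 hd)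
  rcases hyJ.1 with hyA | hyD
  · exact hy (compIn_closed ⟨ha, hva.symm⟩ hx hxy ⟨hyA, hyJ.2⟩)
  · exact h ⟨x, hx, y, hyD, hxy⟩

lemma exists_middle_of_three {l : List V} {p q r : V} {W : Set V} (hp : p ∈ l) (hq : q ∈ l)
    (hr : r ∈ l) (hpW : p ∈ W) (hqW : q ∈ W) (hrW : r ∈ W)
    (hpq : p ≠ q) (hpr : p ≠ r) (hqr : q ≠ r) :
    ∃ l₁ l₂ x y z, l = l₁ ++ y :: l₂ ∧ x ∈ l₁ ∧ z ∈ l₂ ∧ x ∈ W ∧ y ∈ W ∧ z ∈ W := by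
  have two : ∀ (l : List V) (p q : V), p ∈ W → q ∈ W → p ∈ l → q ∈ l → p ≠ q →
      ∃ l₁ l₂ x y, l = l₁ ++ l₂ ∧ x ∈ l₁ ∧ y ∈ l₂ ∧ x ∈ W ∧ y ∈ W := by
    intro l p q hpW hqW hp hq hpq
    obtain ⟨s, t, rfl, ⟨h1, h2⟩ | ⟨h1, h2⟩⟩ := exists_append_of_mem_of_ne hp hq hpq
    · exact ⟨s, t, p, q, rfl, h1, h2, hpW, hqW⟩
    · exact ⟨s, t, q, p, rfl, h1, h2, hqW, hpW⟩
  have three : ∀ (s t : List V) (p q : V), p ∈ W → q ∈ W → p ∈ s → q ∈ t → p ≠ r → q ≠ r →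
      r ∈ s ++ t →
      ∃ l₁ l₂ x y z, s ++ t = l₁ ++ y :: l₂ ∧ x ∈ l₁ ∧ z ∈ l₂ ∧ x ∈ W ∧ y ∈ W ∧ z ∈ W := by
    intro s t p q hpW hqW hp hq hpr hqr hr
    rcases List.mem_append.1 hr with hr | hr
    · obtain ⟨s₁, s₂, x, y, rfl, hx, hy, hxW, hyW⟩ := two s p r hpW hrW hp hr hpr
      obtain ⟨t₁, t₂, rfl⟩ := List.append_of_mem hy
      exact ⟨s₁ ++ t₁, t₂ ++ t, x, y, q, by simp, by simp [hx], by simp [hq], hxW, hyW, hqW⟩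
    · obtain ⟨s₁, s₂, x, y, rfl, hx, hy, hxW, hyW⟩ := two t q r hqW hrW hq hr hqr
      obtain ⟨t₁, t₂, rfl⟩ := List.append_of_mem hx
      exact ⟨s ++ t₁, t₂ ++ s₂, p, x, y, by simp, by simp [hp], by simp [hy], hpW, hxW, hyW⟩
  obtain ⟨s, t, rfl, ⟨h1, h2⟩ | ⟨h1, h2⟩⟩ := exists_append_of_mem_of_ne hp hq hpq
  · exact three s t p q hpW hqW h1 h2 hpr hqr hr
  · exact three s t q p hqW hpW h1 h2 hqr hpr hr

/-- If each contact of `J` with the outside, except `a` and `d`, separates `a` from `d` in `J`,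
then so does every vertex of `J`. -/
lemma SurvivesPairs.mem_contacts (hS : SurvivesPairs G) {J N : Set V} (hJ : IsConn G J)
    (ha : a ∈ J) (hd : d ∈ J)
    (hN : ∀ v ∈ J, v ∈ N → v ≠ a → v ≠ d → ¬ LinkedIn G (J \ {v}) a d)
    (hout : ∀ v ∈ J, v ∉ N → ∀ w, G.Adj v w → w ∈ J) {y v : V} (hy : y ∉ J) (hv : v ∈ J)
    (hva : v ≠ a) (hvd : v ≠ d) : v ∈ N := by
  by_contra hvN
  set P : Set V := {w | w ∈ J ∧ w ∈ N} ∪ {a, d} with hP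
  have hPJ : ∀ w ∈ P, w ∈ J := by
    rintro w (hw | rfl | rfl)
    exacts [hw.1, ha, hd]
  have hvP : v ∉ P := by simp [hP, hvN, hva, hvd]
  have hvJP : v ∈ J \ P := ⟨hv, hvP⟩
  set W := compIn G (J \ P) v with hW
  have hWJ : ∀ w ∈ W, w ∈ J ∧ w ∉ P := fun w hw => compIn_subset hvJP hw
  have hWc : IsConn G W := isConn_compIn
  have hvW : v ∈ W := mem_compIn_self
  have hyW : y ∉ W := fun h => hy (hWJ y h).1
  have hyv : y ≠ v := by rintro rfl; exact hy hv
  -- every vertex outside `W` adjacent to `W` lies in `P`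
  have exits : ∀ u w, u ∈ W → w ∉ W → G.Adj u w → w ∈ P := by
    intro u w hu hw huw
    by_contra hwP
    refine hw (compIn_closed hvJP hu huw ⟨hout u (hWJ u hu).1 (fun h => ?_) w huw, hwP⟩)
    exact (hWJ u hu).2 (Or.inl ⟨(hWJ u hu).1, h⟩)
  have next : ∀ p q, p ∈ P → q ∈ P → ∃ r ∈ P, r ≠ p ∧ r ≠ q ∧ Touch G W {r} := by
    intro p q hp hq
    obtain ⟨u, w, hu, hw, huw, -, -, hwp, hwq⟩ := hS.exists_exit (p := p) (q := q) hvW hyW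
      (by rintro rfl; exact hvP hp) (by rintro rfl; exact hvP hq)
      (by rintro rfl; exact hy (hPJ _ hp)) (by rintro rfl; exact hy (hPJ _ hq))
    exact ⟨w, exits u w hu hw huw, hwp, hwq, u, hu, w, rfl, huw⟩
  have haP : a ∈ P := by simp [hP]
  obtain ⟨p, hp, -, -, hWp⟩ := next a a haP haP
  obtain ⟨q, hq, hqp, -, hWq⟩ := next p p hp hp
  obtain ⟨r, hr, hrp, hrq, hWr⟩ := next p q hp hq
  obtain ⟨l, hlc, hln, hla, hld, hlJ⟩ := (hJ a ha d hd).exists_list ha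
  have hlconn := isConn_list hlc
  have hal : a ∈ l := List.mem_of_mem_head? hla
  have hdl : d ∈ l := List.mem_of_mem_getLast? hld
  have hPl : ∀ w ∈ P, w ∈ l := by
    rintro w (hw | rfl | rfl)
    · by_contra hwl
      have hwa : w ≠ a := by rintro rfl; exact hwl hal
      have hwd : w ≠ d := by rintro rfl; exact hwl hdl
      refine hN w hw.1 hw.2 hwa hwd ((hlconn a hal d hdl).mono fun z hz => ⟨hlJ z hz, ?_⟩)
      rintro rfl
      exact hwl hz
    · exact hal
    · exact hdl
  obtain ⟨l₁, l₂, x, m, z, rfl, hx, hz, ⟨hxP, hxW⟩, ⟨hmP, -⟩, ⟨hzP, hzW⟩⟩ :=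
    exists_middle_of_three (W := {w | w ∈ P ∧ Touch G W {w}}) (hPl p hp) (hPl q hq) (hPl r hr)
      ⟨hp, hWp⟩ ⟨hq, hWq⟩ ⟨hr, hWr⟩ hqp.symm hrp.symm hrq.symm
  have hal₁ : a ∈ l₁ := by
    rw [List.head?_append_of_ne_nil _ (List.ne_nil_of_mem hx)] at hla
    exact List.mem_of_mem_head? hla
  have hdl₂ : d ∈ l₂ := by
    rw [List.getLast?_append_of_ne_nil _ (by simp), List.getLast?_cons_of_ne_nil
      (List.ne_nil_of_mem hz)] at hld
    exact List.mem_of_mem_getLast? hld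
  rw [List.nodup_append, List.nodup_cons] at hln
  have hm₁ : m ∉ l₁ := fun h => hln.2.2 m h m (by simp) rfl
  have hm₂ : m ∉ l₂ := hln.2.1.1
  have hma : m ≠ a := by rintro rfl; exact hm₁ hal₁
  have hmd : m ≠ d := by rintro rfl; exact hm₂ hdl₂
  have hmN : m ∈ N := by
    rcases hmP with h | h | h
    exacts [h.2, absurd h hma, absurd h hmd]
  have hc := List.isChain_append.1 hlc
  have hc₂ := List.isChain_cons.1 hc.2.1
  have hU : IsConn G ({v | v ∈ l₁} ∪ W ∪ {v | v ∈ l₂}) :=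
    ((isConn_list hc.1).union hWc (hxW.symm.mono (by simpa using hx) subset_rfl)).union
      (isConn_list hc₂.2) (hzW.mono Set.subset_union_right (by simpa using hz))
  refine hN m (hPJ m hmP) hmN hma hmd ((hU a (Or.inl (Or.inl hal₁)) d (Or.inr hdl₂)).mono ?_)
  rintro w ((hw | hw) | hw)
  · have hw : w ∈ l₁ := hw
    exact ⟨hlJ w (by simp [hw]), by rintro rfl; exact hm₁ hw⟩
  · exact ⟨(hWJ w hw).1, by rintro rfl; exact (hWJ _ hw).2 hmP⟩
  · have hw : w ∈ l₂ := hw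
    exact ⟨hlJ w (by simp [hw]), by rintro rfl; exact hm₂ hw⟩

end Cuts

section PathDiamond

variable {V : Type} {G : SimpleGraph V} {a b c d : V}

lemma isChain_append_bridge {L M R : List V} (h : (L ++ (M ++ R)).IsChain G.Adj) (hL : L ≠ [])
    (hR : R ≠ []) : Bridge G {v | v ∈ L} M {v | v ∈ R} := by
  obtain ⟨-, h₂, h₃⟩ := List.isChain_append.1 h
  obtain ⟨hM, -, h₄⟩ := List.isChain_append.1 h₂
  refine ⟨hM, fun x hx => ?_, fun x hx => ?_⟩
  · exact ⟨L.getLast hL, List.getLast_mem hL, h₃ _ (List.getLast_mem_getLast? hL) x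
      (by rw [List.head?_append_of_ne_nil _ (by rintro rfl; simp at hx)]; exact hx)⟩
  · exact ⟨R.head hR, List.head_mem hR, h₄ x hx _ (List.head_mem_head? hR)⟩

lemma Bridge.mono {L L' R R' : Set V} {l : List V} (h : Bridge G L l R) (hL : L ⊆ L')
    (hR : R ⊆ R') : Bridge G L' l R' where
  chain := h.chain
  head x hx := by
    obtain ⟨s, hs, h⟩ := h.head x hx
    exact ⟨s, hL hs, h⟩
  last x hx := by
    obtain ⟨s, hs, h⟩ := h.last x hx
    exact ⟨s, hR hs, h⟩

lemma nodup_append_three {L M R : List V} (h : (L ++ (M ++ R)).Nodup) :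
    M.Nodup ∧ ∀ v, (v ∈ L → v ∉ M ∧ v ∉ R) ∧ (v ∈ M → v ∉ R) := by
  rw [List.nodup_append, List.nodup_append] at h
  refine ⟨h.2.1.1, fun v => ⟨fun hv => ⟨fun h' => ?_, fun h' => ?_⟩, fun hv h' => ?_⟩⟩
  · exact h.2.2 v hv v (by simp [h']) rfl
  · exact h.2.2 v hv v (by simp [h']) rfl
  · exact h.2.1.2.2 v hv v h' rfl

variable {B C B₀ : Set V} {QA QD L M R X : List V} {s t x : V}

/-- The bridge `X` runs inside `B`, and `C` has no contact on the left of the right end of the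
bridge. -/
lemma hasK4_of_no_left_contact (hS : SurvivesPairs G)
    (h : IsDiamond G a b c d {v | v ∈ QA} B C {v | v ∈ QD})
    (hcov : ∀ v, v ∈ QA ∨ v ∈ B ∨ v ∈ C ∨ v ∈ QD) (hBC : ¬ Touch G B C)
    (hB₀ : IsConn G B₀) (hb₀ : b ∈ B₀) (hB₀B : B₀ ⊆ B) (hx : Touch G B₀ {x})
    (hmax : ∀ A' B' C' D', IsDiamond G a b c d A' B' C' D' → B₀ ⊆ B' → x ∉ B')
    (hlast : QD.getLast? = some d) (hQ : QA ++ QD = L ++ (M ++ R)) (hQc : (QA ++ QD).IsChain G.Adj) (hQn : (QA ++ QD).Nodup)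
    (hxM : x ∈ M) (haL : a ∈ L) (hdR : d ∈ R) (hs : s ∈ L) (ht : R.head? = some t)
    (hX : Bridge G {s} X {t}) (hX0 : X ≠ []) (hXB : ∀ v ∈ X, v ∈ B)
    (hXB₀ : ∀ v ∈ X, v ∉ B₀) (hCL : ¬ Touch G C {v | v ∈ L}) (hCM : ¬ Touch G C {v | v ∈ M}) :
    HasK4 G a b c d := by
  have hL0 : L ≠ [] := List.ne_nil_of_mem haL
  have hM0 : M ≠ [] := List.ne_nil_of_mem hxM
  have hmem : ∀ v, (v ∈ QA ∨ v ∈ QD) ↔ (v ∈ L ∨ v ∈ M ∨ v ∈ R) := fun v => by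
    rw [← List.mem_append, hQ, List.mem_append, List.mem_append]
  rw [hQ] at hQn hQc
  obtain ⟨hMn, hnd⟩ := nodup_append_three hQn
  have hdis := h.disj
  simp only [Set.mem_ofPred_eq] at hdis
  -- the contact of `C` with the first part of the path lies beyond the bridge
  obtain ⟨f, hf, y, hy, hfy⟩ := h.touchAC
  have hf : f ∈ QA := hf
  have hfL : f ∉ L := fun h => hCL ⟨y, hy, f, h, hfy.symm⟩
  have hfM : f ∉ M := fun h => hCM ⟨y, hy, f, h, hfy.symm⟩
  have hfR : f ∈ R := by have := hmem f; tauto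
  obtain ⟨R₁, rfl, hRR, hfR₁⟩ : ∃ R₁, QA = L ++ M ++ R₁ ∧ R = R₁ ++ QD ∧ f ∈ R₁ := by
    rw [← List.append_assoc, List.append_eq_append_iff] at hQ
    rcases hQ with ⟨as, h1, h2⟩ | ⟨bs, h1, h2⟩
    · exfalso
      have : f ∈ L ++ M := by rw [h1]; simp [hf]
      simp [hfL, hfM] at this
    · exact ⟨bs, h1, h2, by simpa [h1, hfL, hfM] using hf⟩
  subst hRR
  have hR₁0 : R₁ ≠ [] := List.ne_nil_of_mem hfR₁
  have htR₁ : t ∈ R₁ := by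
    rw [List.head?_append_of_ne_nil _ hR₁0] at ht
    exact List.mem_of_mem_head? ht
  have hbX : b ∉ X := fun h => hXB₀ b h hb₀
  have hbX' : b ∈ B \ {v | v ∈ X} := ⟨h.memB, hbX⟩
  set E := compIn G (B \ {v | v ∈ X}) b with hE
  have hEc : IsConn G E := isConn_compIn
  have hEB : ∀ v ∈ E, v ∈ B ∧ v ∉ X := fun v hv => compIn_subset hbX' hv
  have hB₀E : B₀ ⊆ E := hB₀.subset_compIn hb₀ fun v hv => ⟨hB₀B hv, fun h => hXB₀ v h hv⟩
  have hEx : Touch G E {x} := hx.mono hB₀E subset_rfl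
  have hQDc : IsConn G {v | v ∈ QD} := h.connD
  have hdQ : d ∈ QD := h.memD
  have hQD0 : QD ≠ [] := List.ne_nil_of_mem hdQ
  have hXc : IsConn G {v | v ∈ X} := isConn_list hX.chain
  have hLc : IsConn G {v | v ∈ L} := isConn_list (List.isChain_append.1 hQc).1
  have hMRc := (List.isChain_append.1 hQc).2.1
  have hMc : IsConn G {v | v ∈ M} := isConn_list (List.isChain_append.1 hMRc).1
  have hRc := (List.isChain_append.1 hMRc).2.1
  have hR₁c : IsConn G {v | v ∈ R₁} := isConn_list (List.isChain_append.1 hRc).1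
  have hLX : Touch G {v | v ∈ L} {v | v ∈ X} :=
    (hX.touch_fst hX0).mono (by simpa using hs) subset_rfl
  have hXR : Touch G {v | v ∈ X} {v | v ∈ R₁} :=
    (hX.touch_snd hX0).mono subset_rfl (by simpa using htR₁)
  have hLM : Touch G {v | v ∈ L} {v | v ∈ M} :=
    (isChain_append_bridge hQc hL0 (by simp [hR₁0])).touch_fst hM0
  by_cases hEQ : Touch G E {v | v ∈ QD}
  · refine absurd (Or.inr hxM) (hmax ({v | v ∈ L} ∪ {v | v ∈ X} ∪ {v | v ∈ R₁})
      (E ∪ {v | v ∈ M}) C {v | v ∈ QD} ⟨(hLc.union hXc hLX).union hR₁c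
        (hXR.mono Set.subset_union_right subset_rfl),
        hEc.union hMc (hEx.mono subset_rfl (by simpa using hxM)), h.connC, h.connD,
        Or.inl (Or.inl haL), Or.inl mem_compIn_self, h.memC, h.memD, fun v => ?_,
        hLM.mono (fun v hv => Or.inl (Or.inl hv)) Set.subset_union_right,
        ⟨f, Or.inr hfR₁, y, hy, hfy⟩,
        (touch_of_isChain_append hRc hR₁0 hQD0).mono Set.subset_union_right subset_rfl,
        hEQ.mono Set.subset_union_left subset_rfl, h.touchCD⟩
        (hB₀E.trans Set.subset_union_left))
    have h1 := hdis v
    have h2 := hEB v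
    have h3 := hXB v
    have h4 := hnd v
    simp only [List.mem_append, Set.mem_union, Set.mem_ofPred_eq] at h1 h2 h3 h4 ⊢
    clear * - h1 h2 h3 h4
    grind (splits := 50)
  · obtain ⟨u, hu, e, he, hue⟩ := h.touchBD
    have he : e ∈ QD := he
    have huE : u ∉ E := fun h => hEQ ⟨u, h, e, he, hue⟩
    have hBE : IsConn G (B \ E) := by
      obtain ⟨x₀, hx₀⟩ := List.exists_mem_of_ne_nil X hX0
      exact h.connB.diff_compIn hXc hXB hx₀ h.memB hbX
    have hXBE : ∀ v ∈ X, v ∈ B \ E := fun v hv => ⟨hXB v hv, fun h => (hEB v h).2 hv⟩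
    have hx₀ := hXBE _ (List.head_mem hX0)
    obtain ⟨X', hXc', hXn', hXh', hXl', hXBE'⟩ :=
      (hBE (X.head hX0) hx₀ u ⟨hu, huE⟩).exists_list hx₀
    obtain ⟨D₁, D₂, rfl⟩ := List.append_of_mem he
    have hQc' : (L ++ ((M ++ R₁ ++ D₁) ++ e :: D₂)).IsChain G.Adj := by simpa using hQc
    have hQn' : (L ++ ((M ++ R₁ ++ D₁) ++ e :: D₂)).Nodup := by simpa using hQn
    have hbr := isChain_append_bridge hQc' hL0 (by simp)
    obtain ⟨hMn', hnd'⟩ := nodup_append_three hQn'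
    have hE' : E ⊆ compIn G (B \ {v | v ∈ X'}) b := hEc.subset_compIn mem_compIn_self
      fun v hv => ⟨(hEB v hv).1, fun h => (hXBE' v h).2 hv⟩
    have hd' : d ∈ e :: D₂ := by
      rw [List.getLast?_append_of_ne_nil _ (by simp)] at hlast
      exact List.mem_of_getLast? hlast
    refine hasK4_of_bridges hS (L := {v | v ∈ L}) (R := {v | v ∈ e :: D₂}) (M := M ++ R₁ ++ D₁)
      (X := X') hLc (isConn_list ?_) h.connB h.connC haL hd' h.memB h.memC ?_ ?_ hBC hMn' hXn'
      hbr ⟨hXc', ?_, ?_⟩ ?_ (fun v hv => (hXBE' v hv).1)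
      (fun hb => (hXBE' b hb).2 mem_compIn_self) ?_ ?_
    · exact (List.isChain_append.1 (List.isChain_append.1 hQc').2.1).2.1
    · intro v
      have h1 := hdis v
      have h4 := hnd' v
      simp only [List.mem_append, Set.mem_ofPred_eq] at h1 h4 ⊢
      clear * - h1 h4
      grind (splits := 50)
    · intro v
      have := hcov v
      simp only [List.mem_append, Set.mem_ofPred_eq] at this ⊢
      clear * - this
      tauto
    · intro w hw
      obtain ⟨s', rfl, h'⟩ := hX.head (X.head hX0) (List.head_mem_head? hX0)
      rw [hXh'] at hw
      cases hw
      exact ⟨s', hs, h'⟩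
    · intro w hw
      rw [hXl'] at hw
      cases hw
      exact ⟨e, by simp, hue⟩
    · rintro rfl
      simp at hXh'
    · exact hEx.mono hE' (by simp [hxM])
    · exact ⟨y, hy, f, by simp [hfR₁], hfy.symm⟩

end PathDiamond

section BridgedPath

variable {V : Type} {G : SimpleGraph V} {a b c d : V} {B C B₀ : Set V} {QA QD L M R X : List V}
  {s t x : V}

lemma setOf_mem_reverse (l : List V) : {v | v ∈ l.reverse} = {v | v ∈ l} := by
  simp

/-- A bridge of the path `QA ++ QD` inside `B`. -/
lemma hasK4_of_bridge_same_side (hS : SurvivesPairs G)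
    (h : IsDiamond G a b c d {v | v ∈ QA} B C {v | v ∈ QD})
    (hcov : ∀ v, v ∈ QA ∨ v ∈ B ∨ v ∈ C ∨ v ∈ QD) (hBC : ¬ Touch G B C)
    (hB₀ : IsConn G B₀) (hb₀ : b ∈ B₀) (hB₀B : B₀ ⊆ B) (hx : Touch G B₀ {x})
    (hmax : ∀ A' B' C' D', IsDiamond G a b c d A' B' C' D' → B₀ ⊆ B' → x ∉ B')
    (hfirst : QA.head? = some a) (hlast : QD.getLast? = some d)
    (hQ : QA ++ QD = L ++ (M ++ R)) (hQc : (QA ++ QD).IsChain G.Adj) (hQn : (QA ++ QD).Nodup)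
    (hxM : x ∈ M) (haL : a ∈ L) (hdR : d ∈ R) (hs : L.getLast? = some s) (ht : R.head? = some t)
    (hX : Bridge G {s} X {t}) (hX0 : X ≠ []) (hXn : X.Nodup) (hXB : ∀ v ∈ X, v ∈ B)
    (hXB₀ : ∀ v ∈ X, v ∉ B₀) : HasK4 G a b c d := by
  have hL0 : L ≠ [] := List.ne_nil_of_mem haL
  have hR0 : R ≠ [] := List.ne_nil_of_mem hdR
  have hM0 : M ≠ [] := List.ne_nil_of_mem hxM
  have hsL : s ∈ L := List.mem_of_getLast? hs
  have htR : t ∈ R := List.mem_of_mem_head? ht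
  have hmem : ∀ v, (v ∈ QA ∨ v ∈ QD) ↔ (v ∈ L ∨ v ∈ M ∨ v ∈ R) := fun v => by
    rw [← List.mem_append, hQ, List.mem_append, List.mem_append]
  have hQc' := hQc
  have hQn' := hQn
  rw [hQ] at hQn' hQc'
  obtain ⟨hMn, hnd⟩ := nodup_append_three hQn'
  have hdis := h.disj
  simp only [Set.mem_ofPred_eq] at hdis
  have hLX : Bridge G {v | v ∈ L} X {v | v ∈ R} :=
    hX.mono (by simpa using hsL) (by simpa using htR)
  have hLM := isChain_append_bridge hQc' hL0 hR0
  have hbX : b ∉ X := fun h => hXB₀ b h hb₀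
  have hLc : IsConn G {v | v ∈ L} := isConn_list (List.isChain_append.1 hQc').1
  have hMRc := (List.isChain_append.1 hQc').2.1
  have hMc : IsConn G {v | v ∈ M} := isConn_list (List.isChain_append.1 hMRc).1
  have hRc : IsConn G {v | v ∈ R} := isConn_list (List.isChain_append.1 hMRc).2.1
  have hB₀E : B₀ ⊆ compIn G (B \ {v | v ∈ X}) b :=
    hB₀.subset_compIn hb₀ fun v hv => ⟨hB₀B hv, fun h => hXB₀ v h hv⟩
  have hEx : Touch G (compIn G (B \ {v | v ∈ X}) b) {x} := hx.mono hB₀E subset_rfl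
  have hbB : b ∈ B \ {v | v ∈ X} := ⟨h.memB, hbX⟩
  have hEB : ∀ v ∈ compIn G (B \ {v | v ∈ X}) b, v ∈ B ∧ v ∉ X :=
    fun v hv => compIn_subset hbB hv
  by_cases hCM : Touch G C {v | v ∈ M}
  · refine hasK4_of_bridges hS (L := {v | v ∈ L}) (R := {v | v ∈ R}) hLc hRc h.connB h.connC haL
      hdR h.memB h.memC (fun v => ?_) (fun v => ?_) hBC hMn hXn hLM hLX hX0 hXB hbX
      (hEx.mono subset_rfl (by simpa using hxM)) hCM
    · have h1 := hdis v
      have h4 := hnd v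
      have h5 := hmem v
      simp only [Set.mem_ofPred_eq]
      clear * - h1 h4 h5
      grind (splits := 50)
    · have h1 := hcov v
      have h5 := hmem v
      simp only [Set.mem_ofPred_eq]
      clear * - h1 h5
      tauto
  by_cases hCL : Touch G C {v | v ∈ L}
  · by_cases hCR : Touch G C {v | v ∈ R}
    · refine absurd (Or.inr hxM) (hmax {v | v ∈ L}
        (compIn G (B \ {v | v ∈ X}) b ∪ {v | v ∈ M}) C ({v | v ∈ X} ∪ {v | v ∈ R})
        ⟨hLc, isConn_compIn.union hMc (hEx.mono subset_rfl (by simpa using hxM)), h.connC,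
          hLX.conn_right (l₁ := []) hRc,
          haL, Or.inl mem_compIn_self, h.memC, Or.inr hdR, fun v => ?_,
          (hLM.touch_fst hM0).mono subset_rfl Set.subset_union_right, hCL.symm,
          (hLX.touch_fst hX0).mono subset_rfl Set.subset_union_left,
          (hLM.touch_snd hM0).mono Set.subset_union_right Set.subset_union_right,
          hCR.mono subset_rfl Set.subset_union_right⟩
        (hB₀E.trans Set.subset_union_left))
      have h1 := hdis v
      have h2 := hEB v
      have h3 := hXB v
      have h4 := hnd v
      have h5 := hmem v
      simp only [Set.mem_union, Set.mem_ofPred_eq] at h1 h2 h3 h4 ⊢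
      clear * - h1 h2 h3 h4 h5
      grind (splits := 50)
    · refine (hasK4_of_no_left_contact (QA := QD.reverse) (QD := QA.reverse) (L := R.reverse)
        (M := M.reverse) (R := L.reverse) (X := X.reverse) (s := t) (t := s) (B₀ := B₀) (x := x)
        (a := d) (d := a) (B := B) (C := C) (b := b) (c := c) hS ?_
        (fun v => ?_) hBC hB₀ hb₀ hB₀B hx (fun A' B' C' D' h' => hmax D' B' C' A' h'.swap_ends)
        (by simpa using hfirst) ?_ ?_ ?_ (by simpa using hxM) (by simpa using hdR)
        (by simpa using haL) (by simpa using htR) (by simpa using hs) hX.reverse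
        (by simpa using hX0) (by simpa using hXB)
        (by simpa using hXB₀) ?_ ?_).swap_ends
      · simpa only [setOf_mem_reverse] using h.swap_ends
      · have := hcov v
        simp only [List.mem_reverse]
        tauto
      · rw [← List.reverse_append, hQ]
        simp
      · rw [← List.reverse_append, List.isChain_reverse]
        simpa only [G.adj_comm] using hQc
      · rw [← List.reverse_append]
        exact List.nodup_reverse.2 hQn
      · simpa only [setOf_mem_reverse] using hCR
      · simpa only [setOf_mem_reverse] using hCM
  · exact hasK4_of_no_left_contact hS h hcov hBC hB₀ hb₀ hB₀B hx hmax hlast hQ hQc hQn hxM haL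
      hdR hsL ht hX hX0 hXB hXB₀ hCL hCM

/-- A bridge of the path `QA ++ QD` inside `C`. -/
lemma hasK4_of_bridge_other_side (hS : SurvivesPairs G)
    (h : IsDiamond G a b c d {v | v ∈ QA} B C {v | v ∈ QD})
    (hcov : ∀ v, v ∈ QA ∨ v ∈ B ∨ v ∈ C ∨ v ∈ QD) (hBC : ¬ Touch G B C)
    (hB₀B : B₀ ⊆ B) (hx : Touch G B₀ {x})
    (hmax : ∀ A' B' C' D', IsDiamond G a b c d A' B' C' D' → B₀ ⊆ B' → x ∉ B')
    (hQ : QA ++ QD = L ++ (M ++ R)) (hQc : (QA ++ QD).IsChain G.Adj) (hQn : (QA ++ QD).Nodup)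
    (hxM : x ∈ M) (haL : a ∈ L) (hdR : d ∈ R) (hsL : s ∈ L) (htR : t ∈ R)
    (hX : Bridge G {s} X {t}) (hX0 : X ≠ []) (hXn : X.Nodup) (hXC : ∀ v ∈ X, v ∈ C)
    (hcX : c ∉ X) : HasK4 G a b c d := by
  have hL0 : L ≠ [] := List.ne_nil_of_mem haL
  have hR0 : R ≠ [] := List.ne_nil_of_mem hdR
  have hM0 : M ≠ [] := List.ne_nil_of_mem hxM
  have hmem : ∀ v, (v ∈ QA ∨ v ∈ QD) ↔ (v ∈ L ∨ v ∈ M ∨ v ∈ R) := fun v => by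
    rw [← List.mem_append, hQ, List.mem_append, List.mem_append]
  have hQc' := hQc
  have hQn' := hQn
  rw [hQ] at hQn' hQc'
  obtain ⟨hMn, hnd⟩ := nodup_append_three hQn'
  have hdis := h.disj
  simp only [Set.mem_ofPred_eq] at hdis
  have hLX : Bridge G {v | v ∈ L} X {v | v ∈ R} :=
    hX.mono (by simpa using hsL) (by simpa using htR)
  have hLM := isChain_append_bridge hQc' hL0 hR0
  have hLc : IsConn G {v | v ∈ L} := isConn_list (List.isChain_append.1 hQc').1
  have hMRc := (List.isChain_append.1 hQc').2.1
  have hMc : IsConn G {v | v ∈ M} := isConn_list (List.isChain_append.1 hMRc).1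
  have hRc : IsConn G {v | v ∈ R} := isConn_list (List.isChain_append.1 hMRc).2.1
  have hBM : Touch G B {v | v ∈ M} := hx.mono hB₀B (by simpa using hxM)
  have hcC : c ∈ C \ {v | v ∈ X} := ⟨h.memC, hcX⟩
  have hEC : ∀ v ∈ compIn G (C \ {v | v ∈ X}) c, v ∈ C ∧ v ∉ X :=
    fun v hv => compIn_subset hcC hv
  have hcov' : ∀ v, v ∈ L ∨ v ∈ M ∨ v ∈ R ∨ v ∈ C ∨ v ∈ B := fun v => by
    have h1 := hcov v
    have h5 := hmem v
    clear * - h1 h5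
    tauto
  by_cases hCM : Touch G (compIn G (C \ {v | v ∈ X}) c) {v | v ∈ M}
  · refine (hasK4_of_bridges hS (L := {v | v ∈ L}) (R := {v | v ∈ R}) hLc hRc h.connC h.connB haL
      hdR h.memC h.memB (fun v => ?_) hcov' (fun h => hBC h.symm) hMn hXn hLM hLX hX0 hXC hcX
      hCM hBM).swap_mid
    have h1 := hdis v
    have h4 := hnd v
    have h5 := hmem v
    simp only [Set.mem_ofPred_eq]
    clear * - h1 h4 h5
    grind (splits := 50)
  · exfalso
    obtain ⟨x₀, hx₀⟩ := List.exists_mem_of_ne_nil X hX0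
    obtain ⟨e, he, p, hp, hep⟩ := touch_compIn_diff h.connC hXC hx₀ h.memC hcX
    have hp : p ∈ X := hp
    obtain ⟨u, q, hu, hq, huq, -, -, hqp, -⟩ := hS.exists_exit (E := compIn G (C \ {v | v ∈ X}) c)
      (x := c) (y := b) (p := p) (q := p) mem_compIn_self
      (fun hb => ((hdis b).2.1 h.memB).1 (hEC b hb).1) (by rintro rfl; exact hcX hp)
      (by rintro rfl; exact hcX hp)
      (by rintro rfl; exact ((hdis b).2.1 h.memB).1 (hXC _ hp))
      (by rintro rfl; exact ((hdis b).2.1 h.memB).1 (hXC _ hp))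
    have hqm : q ∈ L ∨ q ∈ X ∨ q ∈ R := by
      by_contra! hcon
      rcases hcov' q with h' | h' | h' | h' | h'
      · exact hcon.1 h'
      · exact hCM ⟨u, hu, q, h', huq⟩
      · exact hcon.2.2 h'
      · exact hq (compIn_closed hcC hu huq ⟨h', hcon.2.1⟩)
      · exact hBC ⟨q, h', u, (hEC u hu).1, huq.symm⟩
    obtain ⟨X₁, X₂, rfl, hE₁, hE₂⟩ := exists_split_touch (L := {v | v ∈ L}) (R := {v | v ∈ R})
      hp hqm hqp.symm ⟨e, he, p, rfl, hep⟩ ⟨u, hu, q, rfl, huq⟩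
    refine absurd (Or.inr hxM) (hmax ({v | v ∈ L} ∪ {v | v ∈ X₁}) (B ∪ {v | v ∈ M})
      (compIn G (C \ {v | v ∈ X₁ ++ X₂}) c) ({v | v ∈ X₂} ∪ {v | v ∈ R})
      ⟨hLX.conn_left hLc, h.connB.union hMc hBM, isConn_compIn, hLX.conn_right hRc,
        Or.inl haL, Or.inl h.memB, mem_compIn_self, Or.inr hdR, fun v => ?_,
        (hLM.touch_fst hM0).mono Set.subset_union_left Set.subset_union_right, hE₁.symm,
        hLX.touch_split hX0,
        (hLM.touch_snd hM0).mono Set.subset_union_right Set.subset_union_right, hE₂⟩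
      (hB₀B.trans Set.subset_union_left))
    have h1 := hdis v
    have h2 := hEC v
    have h3 := hXC v
    have h4 := hnd v
    have h5 := hmem v
    have h6 : v ∈ X₁ → v ∉ X₂ := fun h h' => (List.nodup_append.1 hXn).2.2 v h v h' rfl
    simp only [List.mem_append, Set.mem_union, Set.mem_ofPred_eq] at h1 h2 h3 h4 ⊢
    clear * - h1 h2 h3 h4 h5 h6
    grind (splits := 50)

end BridgedPath

section Extremal

variable {V : Type} {G : SimpleGraph V} {a b c d : V} {A B C D T : Set V}

lemma exists_nat_min {p : ℕ → Prop} (h : ∃ n, p n) : ∃ n, p n ∧ ∀ m, p m → n ≤ m := by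
  classical
  exact ⟨Nat.find h, Nat.find_spec h, fun m hm => Nat.find_min' h hm⟩

/-- A spanning diamond maximising the component of `b` in `T ∩ B`, and then minimising `A ∪ D`. -/
lemma IsDiamond.exists_extremal [Finite V] (hG : ∀ x y, LinkedIn G Set.univ x y)
    (h : IsDiamond G a b c d A B C D) (hbT : b ∈ T) :
    ∃ A B C D, IsDiamond G a b c d A B C D ∧ (∀ v, v ∈ A ∨ v ∈ B ∨ v ∈ C ∨ v ∈ D) ∧
      (∀ A' B' C' D', IsDiamond G a b c d A' B' C' D' → compIn G (T ∩ B) b ⊆ B' →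
        compIn G (T ∩ B') b ⊆ compIn G (T ∩ B) b) ∧
      ∀ A' B' C' D', IsDiamond G a b c d A' B' C' D' → (∀ v, v ∈ A' ∨ v ∈ B' ∨ v ∈ C' ∨ v ∈ D') →
        compIn G (T ∩ B) b ⊆ B' → ¬ A' ∪ D' ⊂ A ∪ D := by
  have hle : ∀ S : Set V, S.ncard ≤ Nat.card V := fun S => by
    rw [← Set.ncard_univ]
    exact Set.ncard_le_ncard (Set.subset_univ S)
  obtain ⟨n, ⟨A₁, B₁, C₁, D₁, h₁, hn⟩, hmax⟩ := exists_nat_min (p := fun n => ∃ A B C D,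
    IsDiamond G a b c d A B C D ∧ Nat.card V - (compIn G (T ∩ B) b).ncard = n)
    ⟨_, A, B, C, D, h, rfl⟩
  have hsub : ∀ B B' : Set V, b ∈ B → compIn G (T ∩ B) b ⊆ B' →
      compIn G (T ∩ B) b ⊆ compIn G (T ∩ B') b := fun B B' hb hBB' =>
    isConn_compIn.subset_compIn mem_compIn_self fun v hv =>
      ⟨(compIn_subset (S := T ∩ B) ⟨hbT, hb⟩ hv).1, hBB' hv⟩
  have heq : ∀ A B C D A' B' C' D', IsDiamond G a b c d A B C D →
      IsDiamond G a b c d A' B' C' D' → Nat.card V - (compIn G (T ∩ B) b).ncard = n →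
      compIn G (T ∩ B) b ⊆ B' → compIn G (T ∩ B') b = compIn G (T ∩ B) b := by
    intro A B C D A' B' C' D' h h' hn hBB'
    refine (Set.eq_of_subset_of_ncard_le (hsub B B' h.memB hBB') ?_).symm
    have := hmax _ ⟨A', B', C', D', h', rfl⟩
    have := hle (compIn G (T ∩ B) b)
    have := hle (compIn G (T ∩ B') b)
    omega
  obtain ⟨A₂, B₂, C₂, D₂, h₂, hB₂, hcov₂⟩ := h₁.exists_spanning hG
  have hn₂ : Nat.card V - (compIn G (T ∩ B₂) b).ncard = n := by
    have hbB : b ∈ T ∩ B₁ := ⟨hbT, h₁.memB⟩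
    rw [heq _ _ _ _ _ _ _ _ h₁ h₂ hn ((compIn_subset hbB).trans
      (Set.inter_subset_right.trans hB₂)), hn]
  obtain ⟨m, ⟨A₃, B₃, C₃, D₃, h₃, hcov₃, hn₃, hm₃⟩, hmin⟩ := exists_nat_min
    (p := fun m => ∃ A B C D, IsDiamond G a b c d A B C D ∧
      (∀ v, v ∈ A ∨ v ∈ B ∨ v ∈ C ∨ v ∈ D) ∧
      Nat.card V - (compIn G (T ∩ B) b).ncard = n ∧ (A ∪ D).ncard = m)
    ⟨_, A₂, B₂, C₂, D₂, h₂, hcov₂, hn₂, rfl⟩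
  refine ⟨A₃, B₃, C₃, D₃, h₃, hcov₃, fun A' B' C' D' h' hB' =>
    (heq _ _ _ _ _ _ _ _ h₃ h' hn₃ hB').subset, fun A' B' C' D' h' hcov' hB' hlt => ?_⟩
  have := hmin _ ⟨A', B', C', D', h', hcov', by rw [heq _ _ _ _ _ _ _ _ h₃ h' hn₃ hB', hn₃], rfl⟩
  have := Set.ncard_lt_ncard hlt
  omega

lemma IsDiamond.shrink {v : V} (h : IsDiamond G a b c d A B C D) (hv : v ∈ A) (hva : v ≠ a)
    (hvB : Touch G {v} B) (hC : Touch G (compIn G (A \ {v}) a) C)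
    (hD : Touch G (compIn G (A \ {v}) a) D) :
    IsDiamond G a b c d (compIn G (A \ {v}) a) (B ∪ (A \ compIn G (A \ {v}) a)) C D := by
  have hvA : ({v} : Set V) ⊆ A := by simpa using hv
  have hav : a ∉ ({v} : Set V) := fun h => hva h.symm
  have hsub : ∀ w ∈ compIn G (A \ {v}) a, w ∈ A ∧ w ∉ ({v} : Set V) :=
    fun w hw => compIn_subset (S := A \ {v}) ⟨h.memA, hav⟩ hw
  refine ⟨isConn_compIn, h.connB.union (h.connA.diff_compIn isConn_singleton hvA rfl h.memA hav)
    (hvB.symm.mono subset_rfl ?_), h.connC, h.connD, mem_compIn_self, Or.inl h.memB, h.memC, h.memD,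
    fun w => ?_, (touch_compIn_diff h.connA hvA rfl h.memA hav).mono subset_rfl ?_, hC, hD,
    h.touchBD.mono Set.subset_union_left subset_rfl, h.touchCD⟩
  · rintro w rfl
    exact ⟨hv, fun hw => (hsub w hw).2 rfl⟩
  · have h1 := h.disj w
    have h2 := hsub w
    simp only [Set.mem_union, Set.mem_sdiff]
    clear * - h1 h2
    grind (splits := 50)
  · rintro w rfl
    exact Or.inr ⟨hv, fun hw => (hsub w hw).2 rfl⟩

lemma IsDiamond.contacts_of_minimal (h : IsDiamond G a b c d A B C D)
    (hcov : ∀ v, v ∈ A ∨ v ∈ B ∨ v ∈ C ∨ v ∈ D)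
    (hmin : ∀ A' B' C', IsDiamond G a b c d A' B' C' D →
      (∀ v, v ∈ A' ∨ v ∈ B' ∨ v ∈ C' ∨ v ∈ D) → B ⊆ B' → ¬ A' ⊂ A) :
    (∀ v ∈ A, v ≠ a → (Touch G {v} B ∨ Touch G {v} C) → ¬ Touch G (compIn G (A \ {v}) a) D) ∨
      ∃ v ∈ A, v ≠ a ∧ ∀ w ∈ A, (Touch G {w} B ∨ Touch G {w} C) → w = v := by
  have key : ∀ v ∈ A, v ≠ a → compIn G (A \ {v}) a ⊂ A := fun v hv hva => by
    have hsub : compIn G (A \ {v}) a ⊆ A \ {v} := compIn_subset ⟨h.memA, fun h => hva h.symm⟩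
    exact ⟨hsub.trans Set.sdiff_subset, fun h => (hsub (h hv)).2 rfl⟩
  refine contacts_separate_or_unique h.connA h.memA h.touchAB h.touchAC
    (fun v hv hva hvB hCD => ?_) (fun v hv hva hvC hBD => ?_)
  · refine hmin _ _ _ (h.shrink hv hva hvB hCD.1 hCD.2) (fun w => ?_) Set.subset_union_left
      (key v hv hva)
    have := hcov w
    simp only [Set.mem_union, Set.mem_sdiff]
    tauto
  · refine hmin _ _ _ (h.swap_mid.shrink hv hva hvC hBD.1 hBD.2).swap_mid (fun w => ?_) subset_rfl
      (key v hv hva)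
    have := hcov w
    simp only [Set.mem_union, Set.mem_sdiff]
    tauto

lemma exists_spanning_path (hA : IsConn G A) (hD : IsConn G D) (ha : a ∈ A) (hd : d ∈ D)
    (hdis : ∀ v ∈ A, v ∉ D) (htouch : Touch G A D)
    (hsep : ∀ v ∈ A ∪ D, v ≠ a → v ≠ d → ¬ LinkedIn G ((A ∪ D) \ {v}) a d) :
    ∃ QA QD : List V, QA.head? = some a ∧ QD.getLast? = some d ∧ (QA ++ QD).IsChain G.Adj ∧
      (QA ++ QD).Nodup ∧ A = {v | v ∈ QA} ∧ D = {v | v ∈ QD} := by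
  obtain ⟨x, hx, y, hy, hxy⟩ := htouch
  obtain ⟨QA, hAc, hAn, hAh, hAl, hAm⟩ := (hA a ha x hx).exists_list ha
  obtain ⟨QD, hDc, hDn, hDh, hDl, hDm⟩ := (hD y hy d hd).exists_list hy
  have hQ : (QA ++ QD).IsChain G.Adj := by
    refine List.isChain_append.2 ⟨hAc, hDc, fun x' hx' y' hy' => ?_⟩
    rw [hAl] at hx'
    rw [hDh] at hy'
    cases hx'
    cases hy'
    exact hxy
  have haQ : a ∈ QA := List.mem_of_mem_head? hAh
  have hdQ : d ∈ QD := List.mem_of_getLast? hDl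
  have hall : ∀ v ∈ A ∪ D, v ∈ QA ++ QD := by
    intro v hv
    by_contra hvQ
    simp only [List.mem_append, not_or] at hvQ
    refine hsep v hv (by rintro rfl; exact hvQ.1 haQ) (by rintro rfl; exact hvQ.2 hdQ)
      ((isConn_list hQ a (by simp [haQ]) d (by simp [hdQ])).mono fun w hw => ?_)
    have hw : w ∈ QA ++ QD := hw
    refine ⟨?_, ?_⟩
    · rcases List.mem_append.1 hw with h | h
      · exact Or.inl (hAm w h)
      · exact Or.inr (hDm w h)
    · rintro rfl
      exact (List.mem_append.1 hw).elim hvQ.1 hvQ.2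
  refine ⟨QA, QD, hAh, hDl, hQ, List.nodup_append.2 ⟨hAn, hDn, fun v hv w hw hvw => ?_⟩, ?_, ?_⟩
  · subst hvw
    exact hdis v (hAm v hv) (hDm v hw)
  · refine Set.Subset.antisymm (fun v hv => ?_) hAm
    exact (List.mem_append.1 (hall v (Or.inl hv))).resolve_right fun h => hdis v hv (hDm v h)
  · refine Set.Subset.antisymm (fun v hv => ?_) hDm
    exact (List.mem_append.1 (hall v (Or.inr hv))).resolve_left fun h => hdis v (hAm v h) hv

end Extremal

section Core

variable {V : Type} {G : SimpleGraph V} {a b c d : V} {A B C D S T : Set V}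

lemma mem_contacts_of_diamond (hS : SurvivesPairs G) (h : IsDiamond G a b c d A B C D)
    (hcov : ∀ v, v ∈ A ∨ v ∈ B ∨ v ∈ C ∨ v ∈ D)
    (hmin : ∀ A' B' C' D', IsDiamond G a b c d A' B' C' D' →
      (∀ v, v ∈ A' ∨ v ∈ B' ∨ v ∈ C' ∨ v ∈ D') → B ⊆ B' → ¬ A' ∪ D' ⊂ A ∪ D) :
    ∀ v ∈ A ∪ D, v ≠ a → v ≠ d → ¬ LinkedIn G ((A ∪ D) \ {v}) a d := by
  have hcov' : ∀ v, v ∈ D ∨ v ∈ B ∨ v ∈ C ∨ v ∈ A := fun v => by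
    have := hcov v
    tauto
  have hcA := h.contacts_of_minimal hcov fun A' B' C' h' hcov' hB hlt => by
    refine hmin A' B' C' D h' hcov' hB ⟨Set.union_subset_union_left _ hlt.1, fun hsub => hlt.2 ?_⟩
    intro v hv
    have := h.disj v
    have := hsub (Or.inl hv)
    simp only [Set.mem_union] at this
    tauto
  have hcD := h.swap_ends.contacts_of_minimal hcov' fun D' B' C' h' hcov' hB hlt => by
    refine hmin A B' C' D' h'.swap_ends (fun v => by have := hcov' v; tauto) hB
      ⟨Set.union_subset_union_right _ hlt.1, fun hsub => hlt.2 ?_⟩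
    intro v hv
    have := h.disj v
    have := hsub (Or.inr hv)
    simp only [Set.mem_union] at this
    tauto
  have hsA := h.contacts_separate hS hcov hcA hcD
  have hsD := h.swap_ends.contacts_separate hS hcov' hcD hcA
  have hdis := h.disj
  have hsep : ∀ v ∈ A ∪ D, (Touch G {v} B ∨ Touch G {v} C) → v ≠ a → v ≠ d →
      ¬ LinkedIn G ((A ∪ D) \ {v}) a d := by
    rintro v (hv | hv) hvN hva hvd
    · exact not_linkedIn_union_diff h.memA h.memD (fun x hx => ((hdis x).1 hx).2.2) hva
        (hsA v hv hva hvN)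
    · intro hl
      refine not_linkedIn_union_diff h.memD h.memA (fun x hx hx' => ((hdis x).1 hx').2.2 hx) hvd
        (hsD v hv hvd hvN) ?_
      rw [Set.union_comm]
      exact hl.symm
  intro v hv hva hvd
  refine hsep v hv (hS.mem_contacts (J := A ∪ D) (N := {v | Touch G {v} B ∨ Touch G {v} C})
    (h.connA.union h.connD h.touchAD)
    (Or.inl h.memA) (Or.inr h.memD) hsep (fun w hw hwN u hwu => ?_) (y := b) ?_ hv hva hvd) hva hvd
  · simp only [Set.mem_ofPred_eq, not_or] at hwN
    rcases hcov u with hu | hu | hu | hu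
    · exact Or.inl hu
    · exact absurd ⟨w, rfl, u, hu, hwu⟩ hwN.1
    · exact absurd ⟨w, rfl, u, hu, hwu⟩ hwN.2
    · exact Or.inr hu
  · have := hdis b
    have := h.memB
    simp only [Set.mem_union]
    tauto

lemma mem_left_of_head? {l₁ l₂ : List V} {x y : V} (h : (l₁ ++ x :: l₂).head? = some y)
    (hxy : x ≠ y) : y ∈ l₁ := by
  cases l₁ with
  | nil => simp at h; exact absurd h hxy
  | cons z l => simp at h; simp [h]

lemma mem_right_of_getLast? {l₁ l₂ : List V} {x y : V} (h : (l₁ ++ x :: l₂).getLast? = some y)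
    (hxy : x ≠ y) : y ∈ l₂ := by
  refine List.mem_reverse.1 (mem_left_of_head? (l₂ := l₁.reverse) (x := x) ?_ hxy)
  rw [List.getLast?_eq_head?_reverse] at h
  simpa using h

/-- A walk leaving the first part of a path and returning to its second part runs through one of
the two middle parts. -/
lemma exists_bridge {Q₁ Q₂ : List V} {x : V} (hSl : LinkedIn G S a d) (hxS : x ∉ S)
    (ha : a ∈ Q₁) (hd : d ∉ Q₁) (hdB : d ∉ B) (hdC : d ∉ C)
    (hcov : ∀ v, v ∈ Q₁ ∨ v = x ∨ v ∈ Q₂ ∨ v ∈ B ∨ v ∈ C) (hBC : ¬ Touch G B C)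
    (hchord : ∀ s ∈ Q₁, ∀ t ∈ Q₂, ¬ G.Adj s t) :
    ∃ s ∈ Q₁, ∃ t ∈ Q₂, ∃ X : List V, Bridge G {s} X {t} ∧ X ≠ [] ∧ X.Nodup ∧
      (∀ v ∈ X, v ∈ S) ∧ ((∀ v ∈ X, v ∈ B) ∨ ∀ v ∈ X, v ∈ C) := by
  obtain ⟨s, w, hs, hw, hsw, -, hwS, hl⟩ := hSl.exists_last_exit (P := {v | v ∈ Q₁}) ha hd
  have hs : s ∈ Q₁ := hs
  have hw : w ∉ Q₁ := hw
  have main : ∀ Y Z : Set V, w ∈ Y → d ∉ Y → (∀ v, v ∈ Q₁ ∨ v = x ∨ v ∈ Q₂ ∨ v ∈ Y ∨ v ∈ Z) →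
      ¬ Touch G Y Z → ∃ t ∈ Q₂, ∃ X : List V, Bridge G {s} X {t} ∧ X ≠ [] ∧ X.Nodup ∧
        (∀ v ∈ X, v ∈ S) ∧ ∀ v ∈ X, v ∈ Y := by
    intro Y Z hwY hdY hcov hYZ
    obtain ⟨u, t, hu, ht, hut, huS, htS, hlw⟩ := hl.exists_exit hwY hdY
    obtain ⟨X, hXc, hXn, hXh, hXl, hXm⟩ := hlw.exists_list ⟨⟨hwS, hw⟩, hwY⟩
    refine ⟨t, ?_, X, ⟨hXc, fun z hz => ?_, fun z hz => ?_⟩, ?_, hXn, fun v hv => (hXm v hv).1.1,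
      fun v hv => (hXm v hv).2⟩
    · rcases hcov t with h | rfl | h | h | h
      · exact absurd h htS.2
      · exact absurd htS.1 hxS
      · exact h
      · exact absurd h ht
      · exact absurd ⟨u, hu, t, h, hut⟩ hYZ
    · rw [hXh] at hz
      cases hz
      exact ⟨s, rfl, hsw⟩
    · rw [hXl] at hz
      cases hz
      exact ⟨t, rfl, hut⟩
    · rintro rfl
      simp at hXh
  rcases hcov w with h | rfl | h | h | h
  · exact absurd h hw
  · exact absurd hwS hxS
  · exact absurd hsw (hchord s hs w h)
  · obtain ⟨t, ht, X, h1, h2, h3, h4, h5⟩ := main B C h hdB hcov hBC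
    exact ⟨s, hs, t, ht, X, h1, h2, h3, h4, Or.inl h5⟩
  · obtain ⟨t, ht, X, h1, h2, h3, h4, h5⟩ := main C B h hdC
      (fun v => by have := hcov v; tauto) (fun h => hBC h.symm)
    exact ⟨s, hs, t, ht, X, h1, h2, h3, h4, Or.inr h5⟩

/-- If moreover disjoint connected sets link `a` to `d` and `b` to `c`, a diamond can be improved
to a rooted `K₄`. -/
lemma IsDiamond.hasK4 [Finite V] (hS : SurvivesPairs G) (h : IsDiamond G a b c d A B C D)
    (hSl : LinkedIn G S a d) (hTl : LinkedIn G T b c) (hbT : b ∈ T)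
    (haS : a ∈ S) (hST : ∀ v ∈ S, v ∉ T) :
    HasK4 G a b c d := by
  by_contra hK
  have hBC : ∀ {A B C D}, IsDiamond G a b c d A B C D → ¬ Touch G B C :=
    fun h h' => hK ⟨_, _, _, _, h, h'⟩
  have hG : ∀ x y, LinkedIn G Set.univ x y := by
    have ha := h.disj a
    have hb := h.disj b
    refine hS.linked (a := a) (b := b) (c := c) ?_ ?_ ?_
    · rintro rfl
      exact (ha.1 h.memA).1 h.memB
    · rintro rfl
      exact (ha.1 h.memA).2.1 h.memC
    · rintro rfl
      exact (hb.2.1 h.memB).1 h.memC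
  obtain ⟨A, B, C, D, h, hcov, hmax, hmin⟩ := h.exists_extremal hG hbT
  have hdis := h.disj
  have hbB : b ∈ T ∩ B := ⟨hbT, h.memB⟩
  have hB₀sub : compIn G (T ∩ B) b ⊆ T ∩ B := compIn_subset hbB
  have hB₀B : compIn G (T ∩ B) b ⊆ B := fun v hv => (hB₀sub hv).2
  have hsep := mem_contacts_of_diamond hS h hcov
    fun A' B' C' D' h' hcov' hB => hmin A' B' C' D' h' hcov' (hB₀B.trans hB)
  obtain ⟨QA, QD, hfirst, hlast, hQc, hQn, rfl, rfl⟩ := exists_spanning_path h.connA h.connD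
    h.memA h.memD (fun x hx => ((hdis x).1 hx).2.2) h.touchAD hsep
  have haQ : a ∈ QA := h.memA
  have hdQ : d ∈ QD := h.memD
  simp only [Set.mem_ofPred_eq] at hdis hcov
  -- the first vertex of the link from `b` to `c` outside `B₀` lies on the path
  obtain ⟨u, x, hu, hx, hux, -, hxT, -⟩ := hTl.exists_exit (P := compIn G (T ∩ B) b)
    mem_compIn_self (fun hc => ((hdis c).2.1 (hB₀B hc)).1 h.memC)
  have hxB : x ∉ B := fun hxB => hx (compIn_closed hbB hu hux ⟨hxT, hxB⟩)
  have hxC : x ∉ C := fun hxC => hBC h ⟨u, hB₀B hu, x, hxC, hux⟩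
  have hxS : x ∉ S := fun h => hST x h hxT
  have hxa : x ≠ a := by
    rintro rfl
    exact hxS haS
  have hxd : x ≠ d := by
    rintro rfl
    exact hxS (hSl.mem haS)
  have hxQ : x ∈ QA ++ QD := by
    have := hcov x
    rw [List.mem_append]
    clear * - this hxB hxC
    tauto
  obtain ⟨Q₁, Q₂, hQ⟩ := List.append_of_mem hxQ
  have hQA0 : QA ≠ [] := List.ne_nil_of_mem haQ
  have hQD0 : QD ≠ [] := List.ne_nil_of_mem hdQ
  have hfirst' : (Q₁ ++ x :: Q₂).head? = some a := by
    rw [← hQ, List.head?_append_of_ne_nil _ hQA0, hfirst]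
  have hlast' : (Q₁ ++ x :: Q₂).getLast? = some d := by
    rw [← hQ, List.getLast?_append_of_ne_nil _ hQD0, hlast]
  have haQ₁ : a ∈ Q₁ := mem_left_of_head? hfirst' hxa
  have hdQ₂ : d ∈ Q₂ := mem_right_of_getLast? hlast' hxd
  have hmem : ∀ v, (v ∈ QA ∨ v ∈ QD) ↔ (v ∈ Q₁ ∨ v = x ∨ v ∈ Q₂) := fun v => by
    rw [← List.mem_append, hQ, List.mem_append, List.mem_cons]
  have hQn' := hQn
  have hQc' := hQc
  rw [hQ] at hQn' hQc'
  have hnd : ∀ v, (v ∈ Q₁ → v ≠ x ∧ v ∉ Q₂) ∧ (v ∈ Q₂ → v ≠ x) := by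
    rw [List.nodup_append, List.nodup_cons] at hQn'
    refine fun v => ⟨fun hv => ⟨fun h => ?_, fun h => ?_⟩, fun hv h => ?_⟩
    · exact hQn'.2.2 v hv v (by simp [h]) rfl
    · exact hQn'.2.2 v hv v (by simp [h]) rfl
    · exact hQn'.2.1.1 (h ▸ hv)
  have hchord : ∀ s ∈ Q₁, ∀ t ∈ Q₂, ¬ G.Adj s t := by
    intro s hs t ht hst
    have hc₁ : IsConn G {v | v ∈ Q₁} := isConn_list (List.isChain_append.1 hQc').1
    have hc₂ : IsConn G {v | v ∈ Q₂} :=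
      isConn_list (List.isChain_append.1 hQc').2.1.tail
    refine hsep x (List.mem_append.1 hxQ) hxa hxd
      ((hc₁.union hc₂ ⟨s, hs, t, ht, hst⟩ a (Or.inl haQ₁) d (Or.inr hdQ₂)).mono fun v hv => ?_)
    have h1 := hmem v
    have h2 := hnd v
    simp only [Set.mem_union, Set.mem_sdiff, Set.mem_ofPred_eq, Set.mem_singleton_iff] at hv ⊢
    clear * - h1 h2 hv
    tauto
  obtain ⟨s, hs, t, ht, X, hX, hX0, hXn, hXS, hXBC⟩ := exists_bridge (B := B) (C := C) hSl hxS
    haQ₁ (fun h => (hnd d).1 h |>.2 hdQ₂) (fun h => ((hdis d).2.1 h).2 hdQ)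
    (fun h => (hdis d).2.2 h hdQ)
    (fun v => by
      have h1 := hcov v
      have h2 := hmem v
      clear * - h1 h2
      tauto) (hBC h) hchord
  obtain ⟨L, M₁, rfl⟩ := List.append_of_mem hs
  obtain ⟨M₂, R, rfl⟩ := List.append_of_mem ht
  have hQ' : QA ++ QD = (L ++ [s]) ++ ((M₁ ++ x :: M₂) ++ t :: R) := by
    rw [hQ]
    simp
  have haL : a ∈ L ++ [s] := by
    have : (L ++ [s]).head? = some a := by
      rw [← hfirst']
      cases L <;> simp
    exact List.mem_of_mem_head? this
  have hdR : d ∈ t :: R := by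
    have : (t :: R).getLast? = some d := by
      rw [← hlast', List.getLast?_append_of_ne_nil _ (by simp), ← List.cons_append,
        List.getLast?_append_of_ne_nil _ (by simp)]
    exact List.mem_of_getLast? this
  have hxt : Touch G (compIn G (T ∩ B) b) {x} := ⟨u, hu, x, rfl, hux⟩
  have hmax' : ∀ A' B' C' D', IsDiamond G a b c d A' B' C' D' →
      compIn G (T ∩ B) b ⊆ B' → x ∉ B' := by
    intro A' B' C' D' h' hB' hxB'
    have hb' : b ∈ T ∩ B' := ⟨hbT, h'.memB⟩
    have hu' : u ∈ compIn G (T ∩ B') b := isConn_compIn.subset_compIn mem_compIn_self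
      (show compIn G (T ∩ B) b ⊆ T ∩ B' from fun v hv => ⟨(hB₀sub hv).1, hB' hv⟩) hu
    have hx' : x ∈ compIn G (T ∩ B') b := compIn_closed hb' hu' hux ⟨hxT, hxB'⟩
    exact hx (hmax A' B' C' D' h' hB' hx')
  have hcov' : ∀ v, v ∈ QA ∨ v ∈ B ∨ v ∈ C ∨ v ∈ QD := hcov
  rcases hXBC with hXB | hXC
  · exact hK (hasK4_of_bridge_same_side hS h hcov' (hBC h) isConn_compIn mem_compIn_self hB₀B hxt
      hmax' hfirst hlast hQ' hQc hQn (by simp) haL hdR (by simp) (by simp) hX hX0 hXn hXB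
      fun v hv hv' => hST v (hXS v hv) (hB₀sub hv').1)
  · exact hK (hasK4_of_bridge_other_side hS h hcov' (hBC h) hB₀B hxt hmax' hQ' hQc hQn (by simp)
      haL hdR (by simp) (by simp) hX hX0 hXn hXC
      fun hc => hST c (hXS c hc) (hTl.mem hbT))

end Core

section Triangle

variable {V : Type} {G : SimpleGraph V} {a b c d : V} {A B C : Set V}

variable (G) in
/-- Disjoint subgraphs join `a` to `d` and `b` to `c`. -/
def DisjointLinks (a d b c : V) : Prop :=
  ∃ S T : Set V, a ∈ S ∧ b ∈ T ∧ LinkedIn G S a d ∧ LinkedIn G T b c ∧ ∀ v ∈ S, v ∉ T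

lemma DisjointLinks.comm (h : DisjointLinks G a d b c) : DisjointLinks G b c a d := by
  obtain ⟨S, T, ha, hb, hS, hT, hST⟩ := h
  exact ⟨T, S, hb, ha, hT, hS, fun v hv hv' => hST v hv' hv⟩

lemma DisjointLinks.swap (h : DisjointLinks G a d b c) : DisjointLinks G d a b c := by
  obtain ⟨S, T, ha, hb, hS, hT, hST⟩ := h
  exact ⟨S, T, hS.mem ha, hb, hS.symm, hT, hST⟩

variable (G) in
/-- A `K₃`-model rooted at `a`, `b`, `c` that covers all vertices except `d`. -/
structure IsTriangle (a b c d : V) (A B C : Set V) : Prop where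
  connA : IsConn G A
  connB : IsConn G B
  connC : IsConn G C
  memA : a ∈ A
  memB : b ∈ B
  memC : c ∈ C
  disj : ∀ x, (x ∈ A → x ∉ B ∧ x ∉ C) ∧ (x ∈ B → x ∉ C)
  cover : ∀ x, (x ∈ A ∨ x ∈ B ∨ x ∈ C) ↔ x ≠ d
  touchAB : Touch G A B
  touchAC : Touch G A C
  touchBC : Touch G B C

lemma IsTriangle.swap_left (h : IsTriangle G a b c d A B C) : IsTriangle G b a c d B A C := by
  refine ⟨h.connB, h.connA, h.connC, h.memB, h.memA, h.memC, fun x => ?_, fun x => ?_,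
    h.touchAB.symm, h.touchBC, h.touchAC⟩
  · have := h.disj x
    tauto
  · rw [← h.cover x]
    tauto

lemma IsTriangle.swap_right (h : IsTriangle G a b c d A B C) : IsTriangle G a c b d A C B := by
  refine ⟨h.connA, h.connC, h.connB, h.memA, h.memC, h.memB, fun x => ?_, fun x => ?_,
    h.touchAC, h.touchAB, h.touchBC.symm⟩
  · have := h.disj x
    tauto
  · rw [← h.cover x]
    tauto

lemma exists_triangle_of_partition [Finite V] (hS : SurvivesPairs G) (hab : a ≠ b) (hac : a ≠ c)
    (had : a ≠ d) (hcd : c ≠ d) (hB : IsConn G B) (hC : IsConn G C) (hb : b ∈ B)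
    (hc : c ∈ C) (hdis : ∀ x ∈ B, x ∉ C) (hcov : ∀ x, (x ∈ B ∨ x ∈ C) ↔ x ≠ a ∧ x ≠ d)
    (hBC : Touch G B C) (haB : Touch G {a} B) : ∃ A B C, IsTriangle G a b c d A B C := by
  obtain ⟨n, ⟨B, C, hB, hC, hb, hc, hdis, hcov, hBC, haB, rfl⟩, hmin⟩ := exists_nat_min
    (p := fun n => ∃ B C, IsConn G B ∧ IsConn G C ∧ b ∈ B ∧ c ∈ C ∧ (∀ x ∈ B, x ∉ C) ∧
      (∀ x, (x ∈ B ∨ x ∈ C) ↔ x ≠ a ∧ x ≠ d) ∧ Touch G B C ∧ Touch G {a} B ∧ B.ncard = n)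
    ⟨_, B, C, hB, hC, hb, hc, hdis, hcov, hBC, haB, rfl⟩
  by_cases haC : Touch G {a} C
  · refine ⟨{a}, B, C, isConn_singleton, hB, hC, rfl, hb, hc, fun x => ⟨?_, hdis x⟩, fun x => ?_,
      haB, haC, hBC⟩
    · rintro rfl
      have := hcov x
      tauto
    · have := hcov x
      simp only [Set.mem_singleton_iff]
      by_cases hx : x = a
      · subst hx
        tauto
      · tauto
  · exfalso
    have haB' : a ∉ B := fun h => ((hcov a).1 (Or.inl h)).1 rfl
    refine hS.false_of_separating (A := B) (U := {u | u ∈ B ∧ Touch G {u} C}) (E := {a}) (h := d)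
      (e := a) (y := c) hB hb (fun u hu => hu.1) ?_ (by rintro x hx rfl; exact haB' hx) ?_ rfl had
      (fun h => hdis c h hc) (fun h => hac h.symm) hcd
    · rintro u ⟨hu, huC⟩ hub ha
      have hbu : b ∉ ({u} : Set V) := fun h => hub h.symm
      have huB : ({u} : Set V) ⊆ B := by simpa using hu
      have hsub : ∀ w ∈ compIn G (B \ {u}) b, w ∈ B ∧ w ∉ ({u} : Set V) :=
        fun w hw => compIn_subset (S := B \ {u}) ⟨hb, hbu⟩ hw
      have hlt : compIn G (B \ {u}) b ⊂ B :=
        ⟨fun w hw => (hsub w hw).1, fun h => (hsub u (h hu)).2 rfl⟩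
      have huu : ({u} : Set V) ⊆ B \ compIn G (B \ {u}) b := by
        rintro w rfl
        exact ⟨hu, fun h => (hsub w h).2 rfl⟩
      refine absurd (hmin _ ⟨compIn G (B \ {u}) b, C ∪ (B \ compIn G (B \ {u}) b), isConn_compIn,
        hC.union (hB.diff_compIn isConn_singleton huB rfl hb hbu) (huC.symm.mono subset_rfl huu),
        mem_compIn_self, Or.inl hc, fun x hx => ?_, fun x => ?_,
        (touch_compIn_diff hB huB rfl hb hbu).mono subset_rfl (huu.trans Set.subset_union_right),
        ha.symm, rfl⟩) (not_le.2 (Set.ncard_lt_ncard hlt))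
      · have := hsub x hx
        have := hdis x
        simp only [Set.mem_union, Set.mem_sdiff]
        tauto
      · have := hsub x
        rw [← hcov x]
        simp only [Set.mem_union, Set.mem_sdiff]
        tauto
    · rintro x y hx hxy
      by_contra! hcon
      have hyC : y ∈ C := ((hcov y).2 ⟨hcon.2.1, hcon.2.2⟩).resolve_left hcon.1
      rcases hx with rfl | ⟨hx, hxU⟩
      · exact haC ⟨x, rfl, y, hyC, hxy⟩
      · exact hxU ⟨hx, x, rfl, y, hyC, hxy⟩

lemma exists_triangle [Finite V] (hS : SurvivesPairs G) (hab : a ≠ b) (hac : a ≠ c)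
    (had : a ≠ d) (hbc : b ≠ c) (hbd : b ≠ d) (hcd : c ≠ d) :
    ∃ A B C, IsTriangle G a b c d A B C := by
  have hH : IsConn G ({a, d}ᶜ : Set V) := fun x hx y hy => by
    simp only [Set.mem_compl_iff, Set.mem_insert_iff, Set.mem_singleton_iff, not_or] at hx hy
    exact hS a d x y hx.1 hx.2 hy.1 hy.2
  have hb : ({b} : Set V) ⊆ {a, d}ᶜ := by
    rintro x rfl
    simp [hab.symm, hbd]
  have hc : c ∈ ({a, d}ᶜ : Set V) := by simp [hac.symm, hcd]
  have hcb : c ∉ ({b} : Set V) := hbc.symm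
  have hsub : ∀ x ∈ compIn G ({a, d}ᶜ \ {b}) c, x ∈ ({a, d}ᶜ : Set V) ∧ x ∉ ({b} : Set V) :=
    fun w hw => compIn_subset (S := {a, d}ᶜ \ {b}) ⟨hc, hcb⟩ hw
  have hB : IsConn G ({a, d}ᶜ \ compIn G ({a, d}ᶜ \ {b}) c) :=
    hH.diff_compIn isConn_singleton hb rfl hc hcb
  have hbB : ({b} : Set V) ⊆ {a, d}ᶜ \ compIn G ({a, d}ᶜ \ {b}) c := by
    rintro x rfl
    exact ⟨hb rfl, fun h => (hsub x h).2 rfl⟩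
  have hBC := (touch_compIn_diff hH hb rfl hc hcb).mono subset_rfl hbB
  have hcov : ∀ x, (x ∈ ({a, d}ᶜ \ compIn G ({a, d}ᶜ \ {b}) c : Set V) ∨
      x ∈ compIn G ({a, d}ᶜ \ {b}) c) ↔ x ≠ a ∧ x ≠ d := by
    intro x
    have := hsub x
    simp only [Set.mem_sdiff, Set.mem_compl_iff, Set.mem_insert_iff, Set.mem_singleton_iff,
      not_or] at this ⊢
    tauto
  obtain ⟨u, v, hu, hv, huv, -, -, hvd, -⟩ := hS.exists_exit (E := {a}) (x := a) (y := b) (p := d)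
    (q := d) rfl hab.symm had had hbd hbd
  have hu : u = a := hu
  subst hu
  rcases (hcov v).2 ⟨hv, hvd⟩ with h | h
  · exact exists_triangle_of_partition hS hab hac had hcd hB isConn_compIn (hbB rfl)
      mem_compIn_self (fun x hx => hx.2) hcov hBC.symm ⟨u, rfl, v, h, huv⟩
  · obtain ⟨A, B, C, h⟩ := exists_triangle_of_partition hS hac hab had hbd isConn_compIn hB
      mem_compIn_self (hbB rfl) (fun x hx hx' => hx'.2 hx)
      (fun x => by rw [← hcov x]; exact or_comm) hBC ⟨u, rfl, v, h, huv⟩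
    exact ⟨A, C, B, h.swap_right⟩

lemma IsTriangle.hasK4_of_touch_two [Finite V] (hS : SurvivesPairs G)
    (h : IsTriangle G a b c d A B C) (hA : Touch G A {d}) (hB : Touch G B {d})
    (hL : DisjointLinks G a b c d) : HasK4 G a b c d := by
  obtain ⟨S, T, ha, hc, hSl, hTl, hST⟩ := hL
  have hdia : IsDiamond G a c d b A C {d} B := by
    refine ⟨h.connA, h.connC, isConn_singleton, h.connB, h.memA, h.memC, rfl, h.memB, fun x => ?_,
      h.touchAC, hA, h.touchAB, h.touchBC.symm, hB.symm⟩
    have h1 := h.disj x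
    have h2 := h.cover x
    simp only [Set.mem_singleton_iff]
    clear * - h1 h2
    tauto
  obtain ⟨A', C', D', B', h', ht⟩ := hdia.hasK4 hS hSl hTl hc ha hST
  have : HasK4 G a c d b := ⟨A', C', D', B', h', ht⟩
  exact this.swap_mid.swap_ends.swap_left.swap_ends

lemma IsTriangle.shrink {v : V} (h : IsTriangle G a b c d A B C) (hv : v ∈ A) (hva : v ≠ a)
    (hvB : Touch G {v} B) (hC : Touch G (compIn G (A \ {v}) a) C) :
    IsTriangle G a b c d (compIn G (A \ {v}) a) (B ∪ (A \ compIn G (A \ {v}) a)) C := by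
  have hvA : ({v} : Set V) ⊆ A := by simpa using hv
  have hav : a ∉ ({v} : Set V) := fun h => hva h.symm
  have hsub : ∀ w ∈ compIn G (A \ {v}) a, w ∈ A ∧ w ∉ ({v} : Set V) :=
    fun w hw => compIn_subset (S := A \ {v}) ⟨h.memA, hav⟩ hw
  have hvv : ({v} : Set V) ⊆ A \ compIn G (A \ {v}) a := by
    rintro w rfl
    exact ⟨hv, fun hw => (hsub w hw).2 rfl⟩
  refine ⟨isConn_compIn, h.connB.union (h.connA.diff_compIn isConn_singleton hvA rfl h.memA hav)
    (hvB.symm.mono subset_rfl hvv), h.connC, mem_compIn_self, Or.inl h.memB, h.memC,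
    fun w => ?_, fun w => ?_, (touch_compIn_diff h.connA hvA rfl h.memA hav).mono subset_rfl
      (hvv.trans Set.subset_union_right), hC, h.touchBC.mono Set.subset_union_left subset_rfl⟩
  · have h1 := h.disj w
    have h2 := hsub w
    simp only [Set.mem_union, Set.mem_sdiff]
    clear * - h1 h2
    tauto
  · have h2 := hsub w
    rw [← h.cover w]
    simp only [Set.mem_union, Set.mem_sdiff]
    clear * - h2
    tauto

lemma IsTriangle.hasK4_of_touch [Finite V] (hS : SurvivesPairs G)
    (h : IsTriangle G a b c d A B C) (hA : Touch G A {d})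
    (hab : DisjointLinks G a b c d) (hac : DisjointLinks G a c b d) : HasK4 G a b c d := by
  by_contra hK
  obtain ⟨n, ⟨A, B, C, h, hA, rfl⟩, hmin⟩ := exists_nat_min
    (p := fun n => ∃ A B C, IsTriangle G a b c d A B C ∧ Touch G A {d} ∧ A.ncard = n)
    ⟨_, A, B, C, h, hA, rfl⟩
  have hB : ¬ Touch G B {d} := fun hB => hK (h.hasK4_of_touch_two hS hA hB hab)
  have hC : ¬ Touch G C {d} := fun hC => hK (h.swap_right.hasK4_of_touch_two hS hA hC hac).swap_mid
  have hdis := h.disj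
  have hcov := h.cover
  have hlt : ∀ v ∈ A, v ≠ a → compIn G (A \ {v}) a ⊂ A := fun v hv hva => by
    have hsub : compIn G (A \ {v}) a ⊆ A \ {v} := compIn_subset ⟨h.memA, fun h => hva h.symm⟩
    exact ⟨hsub.trans Set.sdiff_subset, fun h => (hsub (h hv)).2 rfl⟩
  have hbA : b ∉ A := fun hb => ((hdis b).1 hb).1 h.memB
  have hbd : b ≠ d := (hcov b).1 (Or.inr (Or.inl h.memB))
  rcases contacts_separate_or_unique (D := {d}) h.connA h.memA h.touchAB h.touchAC
    (fun v hv hva hvB hCD => not_le.2 (Set.ncard_lt_ncard (hlt v hv hva))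
      (hmin _ ⟨_, _, _, h.shrink hv hva hvB hCD.1, hCD.2, rfl⟩))
    (fun v hv hva hvC hBD => not_le.2 (Set.ncard_lt_ncard (hlt v hv hva))
      (hmin _ ⟨_, _, _, (h.swap_right.shrink hv hva hvC hBD.1).swap_right, hBD.2, rfl⟩))
    with hsep | ⟨v, hv, hva, huniq⟩
  · refine hS.false_of_separating (A := A) (U := {u | u ∈ A ∧ (Touch G {u} B ∨ Touch G {u} C)})
      (E := {d}) (h := c) (e := d) (y := b) h.connA h.memA (fun u hu => hu.1)
      (fun u hu hua => hsep u hu.1 hua hu.2) (fun x hx hxd => (hcov x).1 (Or.inl hx) hxd) ?_ rfl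
      ((hcov c).1 (Or.inr (Or.inr h.memC))).symm hbA hbd
      (by rintro rfl; exact (hdis b).2 h.memB h.memC)
    intro x y hx hxy
    by_contra! hcon
    rcases (hcov y).2 hcon.2.1 with hy | hy | hy
    · exact hcon.1 hy
    · rcases hx with rfl | ⟨hx, hxU⟩
      · exact hB ⟨y, hy, x, rfl, hxy.symm⟩
      · exact hxU ⟨hx, Or.inl ⟨x, rfl, y, hy, hxy⟩⟩
    · rcases hx with rfl | ⟨hx, hxU⟩
      · exact hC ⟨y, hy, x, rfl, hxy.symm⟩
      · exact hxU ⟨hx, Or.inr ⟨x, rfl, y, hy, hxy⟩⟩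
  · obtain ⟨u, w, hu, hw, huw, huv, -, -, hwd⟩ := hS.exists_exit (E := A) (x := a) (y := b) (p := v)
      (q := d) h.memA hbA hva.symm ((hcov a).1 (Or.inl h.memA)) (by rintro rfl; exact hbA hv) hbd
    rcases (hcov w).2 hwd with hw' | hw' | hw'
    · exact hw hw'
    · exact huv (huniq u hu (Or.inl ⟨u, rfl, w, hw', huw⟩))
    · exact huv (huniq u hu (Or.inr ⟨u, rfl, w, hw', huw⟩))

/-- A graph in which no two vertices separate any others has a `K₄`-model rooted at `a`, `b`, `c`,
`d` as soon as it has disjoint links for the three pairings. -/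
theorem SurvivesPairs.hasK4 [Finite V] (hS : SurvivesPairs G) (hab : a ≠ b) (hac : a ≠ c)
    (had : a ≠ d) (hbc : b ≠ c) (hbd : b ≠ d) (hcd : c ≠ d) (h₁ : DisjointLinks G a b c d)
    (h₂ : DisjointLinks G a c b d) (h₃ : DisjointLinks G a d b c) : HasK4 G a b c d := by
  obtain ⟨A, B, C, h⟩ := exists_triangle hS hab hac had hbc hbd hcd
  obtain ⟨u, v, hu, hv, huv, -⟩ := hS.exists_exit (E := {d}) (x := d) (y := a) (p := b) (q := c)
    rfl had hbd.symm hcd.symm hab hac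
  have hu : u = d := hu
  subst hu
  rcases (h.cover v).2 hv with hv | hv | hv
  · exact h.hasK4_of_touch hS ⟨v, hv, u, rfl, huv.symm⟩ h₁ h₂
  · exact (h.swap_left.hasK4_of_touch hS ⟨v, hv, u, rfl, huv.symm⟩ h₁.swap
      h₃.comm).swap_left
  · exact (h.swap_right.swap_left.hasK4_of_touch hS ⟨v, hv, u, rfl, huv.symm⟩ h₂.swap
      h₃.comm.swap).swap_left.swap_mid

end Triangle

section Colouring

variable {V W : Type} {G : SimpleGraph V} {G' : SimpleGraph W} {S X : Set V} {T : Set W}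

lemma LinkedIn.map {x y : V} (h : LinkedIn G S x y) (π : V → W)
    (hπ : ∀ p q, G.Adj p q → p ∈ S → q ∈ S → LinkedIn G' T (π p) (π q)) :
    LinkedIn G' T (π x) (π y) := by
  induction h with
  | refl => exact .refl
  | tail _ h ih => exact ih.trans (hπ _ _ h.1 h.2.1 h.2.2)

lemma LinkedIn.collapse {x y v : V} (h : LinkedIn G S x y)
    (hX : ∀ p ∈ X, ∀ q, q ∉ X → G.Adj p q → q ∈ S → q = v) (hy : y ∉ X) :
    (x ∉ X → LinkedIn G (S \ X) x y) ∧ (x ∈ X → LinkedIn G (S \ X) v y) := by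
  classical
  have := h.map (G' := G) (T := S \ X) (fun w => if w ∈ X then v else w) fun p q hpq hp hq => by
    by_cases hpX : p ∈ X <;> by_cases hqX : q ∈ X
    · simp only [if_pos hpX, if_pos hqX]
      exact .refl
    · simp only [if_pos hpX, if_neg hqX]
      rw [hX p hpX q hqX hpq hq]
      exact .refl
    · simp only [if_neg hpX, if_pos hqX]
      rw [hX q hqX p hpX hpq.symm hp]
      exact .refl
    · simp only [if_neg hpX, if_neg hqX]
      exact .single hpq ⟨hp, hpX⟩ ⟨hq, hqX⟩
  simp only [if_neg hy] at this
  exact ⟨fun hx => by simpa only [if_neg hx] using this,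
    fun hx => by simpa only [if_pos hx] using this⟩

variable (G) in
/-- A colouring of the vertices by the four roots such that any two roots are linked within the
union of their colour classes. -/
structure IsLinking (f : Fin 4 → V) (χ : V → Fin 4) : Prop where
  root : ∀ k, χ (f k) = k
  link : ∀ i j, LinkedIn G {w | χ w = i ∨ χ w = j} (f i) (f j)

variable {f : Fin 4 → V} {χ : V → Fin 4} {u v : V}

lemma IsLinking.exists_of_touch (h : IsLinking G f χ) (huX : u ∉ X)
    (hX : ∀ p ∈ X, ∀ q, q ∉ X → G.Adj p q → q = u ∨ q = v)
    (hroot : ∀ k, f k ∈ X → k = χ u) (htouch : Touch G X {u}) :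
    ∃ χ', IsLinking G f χ' ∧ ∃ p q, G.Adj p q ∧ χ' p = χ' q := by
  classical
  obtain ⟨p, hp, q, rfl, hpq⟩ := htouch
  refine ⟨fun w => if w ∈ X then χ q else χ w, ⟨fun k => ?_, fun k l => ?_⟩, p, q, hpq, by
    simp [hp, huX]⟩
  · split_ifs with hk
    · exact (hroot k hk).symm
    · exact h.root k
  · by_cases hkl : χ q = k ∨ χ q = l
    · refine (h.link k l).mono fun w hw => ?_
      by_cases hwX : w ∈ X
      · simpa [hwX] using hkl
      · simpa [hwX] using hw
    · push Not at hkl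
      refine (((h.link k l).collapse (v := v) (fun p hp q' hq' hpq' hqS => ?_)
        fun hl => hkl.2 (hroot l hl).symm).1 fun hk => hkl.1 (hroot k hk).symm).mono fun w hw => ?_
      · refine (hX p hp q' hq' hpq').resolve_left ?_
        rintro rfl
        exact hqS.elim hkl.1 hkl.2
      · have h1 := hw.1
        have h2 := hw.2
        simpa [h2] using h1

lemma exists_third (i j : Fin 4) : ∃ k, k ≠ i ∧ k ≠ j := by
  revert i j
  decide

lemma exists_other_two (i j : Fin 4) (hij : i ≠ j) : ∃ k l, k ≠ i ∧ k ≠ j ∧ l ≠ i ∧ l ≠ j ∧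
    k ≠ l ∧ ∀ m, m = i ∨ m = j ∨ m = k ∨ m = l := by
  revert i j
  decide

lemma IsLinking.exists_of_one_root (hG : ∀ x y, LinkedIn G Set.univ x y) (h : IsLinking G f χ)
    (huX : u ∉ X) (hvX : v ∉ X) (hX : ∀ p ∈ X, ∀ q, q ∉ X → G.Adj p q → q = u ∨ q = v)
    (hX0 : X.Nonempty) (hroot : ∀ k, f k ∈ X → k = χ u) :
    ∃ χ', IsLinking G f χ' ∧ ∃ p q, G.Adj p q ∧ χ' p = χ' q := by
  by_cases htu : Touch G X {u}
  · exact h.exists_of_touch huX hX hroot htu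
  obtain ⟨x, hx⟩ := hX0
  obtain ⟨p, q, hp, hq, hpq, -⟩ := (hG x u).exists_exit hx huX
  have hpv : Touch G X {v} := ⟨p, hp, q, (hX p hp q hq hpq).resolve_left
    (by rintro rfl; exact htu ⟨p, hp, q, rfl, hpq⟩), hpq⟩
  have hX' : ∀ p ∈ X, ∀ q, q ∉ X → G.Adj p q → q = v ∨ q = u :=
    fun p hp q hq hpq => (hX p hp q hq hpq).symm
  refine h.exists_of_touch hvX hX' (fun k hk => ?_) hpv
  obtain rfl := hroot k hk
  by_contra huv
  obtain ⟨l, hl, hlv⟩ := exists_third (χ u) (χ v)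
  obtain ⟨p, q, hp, hq, hpq, -, hqS, -⟩ := (h.link (χ u) l).exists_exit hk
    (fun h => hl (hroot l h))
  rcases hX p hp q hq hpq with rfl | rfl
  · exact htu ⟨p, hp, q, rfl, hpq⟩
  · exact hqS.elim (fun h => huv h.symm) fun h => hlv h.symm

lemma IsLinking.exists_of_two_roots (h : IsLinking G f χ)
    (huX : u ∉ X) (hvX : v ∉ X) (hX : ∀ p ∈ X, ∀ q, q ∉ X → G.Adj p q → q = u ∨ q = v)
    (huv : χ u ≠ χ v) (hfu : f (χ u) ∈ X) (hfv : f (χ v) ∈ X)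
    (hroot : ∀ k, f k ∈ X → k = χ u ∨ k = χ v) :
    ∃ χ', IsLinking G f χ' ∧ ∃ p q, G.Adj p q ∧ χ' p = χ' q := by
  classical
  generalize hi : χ u = i at *
  generalize hj : χ v = j at *
  obtain ⟨y, z, hyi, hyj, hzi, hzj, hyz, hall⟩ := exists_other_two i j huv
  have hyX : f y ∉ X := fun hy => (hroot y hy).elim hyi hyj
  have hzX : f z ∉ X := fun hz => (hroot z hz).elim hzi hzj
  have hgu : ∀ k, k ≠ j → ∀ p ∈ X, ∀ q, q ∉ X → G.Adj p q →
      q ∈ {w | χ w = i ∨ χ w = k} → q = u := fun k hk p hp q hq hpq hqS =>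
    (hX p hp q hq hpq).resolve_right (by
      rintro rfl
      exact hqS.elim (fun h => huv (h.symm.trans hj)) fun h => hk (h.symm.trans hj))
  have hgv : ∀ k, k ≠ i → ∀ p ∈ X, ∀ q, q ∉ X → G.Adj p q →
      q ∈ {w | χ w = j ∨ χ w = k} → q = v := fun k hk p hp q hq hpq hqS =>
    (hX p hp q hq hpq).resolve_left (by
      rintro rfl
      exact hqS.elim (fun h => huv (hi.symm.trans h)) fun h => hk (h.symm.trans hi))
  obtain ⟨p, q, hp, hq, hpq, hpS, hqS, hlp⟩ := (h.link i y).exists_exit hfu hyX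
  obtain rfl := hgu y hyj p hp q hq hpq hqS
  obtain ⟨p', q', hp', hq', hpq', hpS', hqS', hlp'⟩ := (h.link j z).exists_exit hfv hzX
  obtain rfl := hgv z hzi p' hp' q' hq' hpq' hqS'
  set χ' : V → Fin 4 := fun w => if w ∈ X then
    (if χ w = y then i else if χ w = z then j else χ w) else χ w with hχ'
  have hin : ∀ w ∈ X, (χ w = i → χ' w = i) ∧ (χ w = j → χ' w = j) ∧ (χ w = y → χ' w = i) ∧
      (χ w = z → χ' w = j) := by
    intro w hw
    simp only [hχ', if_pos hw]
    grind
  have hout : ∀ w, w ∉ X → χ' w = χ w := fun w hw => by simp only [hχ', if_neg hw]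
  have hlij : LinkedIn G {w | χ' w = i ∨ χ' w = j} (f i) (f j) :=
    (h.link i j).mono fun w hw => by
      simp only [Set.mem_ofPred_eq] at hw ⊢
      grind
  have hliy : LinkedIn G {w | χ' w = i ∨ χ' w = y} (f i) (f y) :=
    (h.link i y).mono fun w hw => by
      simp only [Set.mem_ofPred_eq] at hw ⊢
      grind
  have hljz : LinkedIn G {w | χ' w = j ∨ χ' w = z} (f j) (f z) :=
    (h.link j z).mono fun w hw => by
      simp only [Set.mem_ofPred_eq] at hw ⊢
      grind
  have hliz : LinkedIn G {w | χ' w = i ∨ χ' w = z} (f i) (f z) := by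
    have h1 := (((h.link i z).collapse (hgu z hzj) hzX).2 hfu)
    refine LinkedIn.trans (hlp.mono fun w hw => ?_) (LinkedIn.trans (.single hpq ?_ ?_)
      (h1.mono fun w hw => ?_))
    all_goals simp only [Set.mem_ofPred_eq, Set.mem_inter_iff, Set.mem_sdiff] at *
    all_goals grind
  have hljy : LinkedIn G {w | χ' w = j ∨ χ' w = y} (f j) (f y) := by
    have h1 := (((h.link j y).collapse (hgv y hyi) hyX).2 hfv)
    refine LinkedIn.trans (hlp'.mono fun w hw => ?_) (LinkedIn.trans (.single hpq' ?_ ?_)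
      (h1.mono fun w hw => ?_))
    all_goals simp only [Set.mem_ofPred_eq, Set.mem_inter_iff, Set.mem_sdiff] at *
    all_goals grind
  have hlyz : LinkedIn G {w | χ' w = y ∨ χ' w = z} (f y) (f z) := by
    refine (((h.link y z).collapse (v := q) (fun p hp r hr hpr hrS => ?_) hzX).1 hyX).mono
      fun w hw => ?_
    · have := hX p hp r hr hpr
      simp only [Set.mem_ofPred_eq] at hrS
      grind
    · simp only [Set.mem_ofPred_eq, Set.mem_sdiff] at *
      grind
  refine ⟨χ', ⟨fun k => ?_, fun k l => ?_⟩, p, q, hpq, ?_⟩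
  · by_cases hk : f k ∈ X
    · have h1 := hin (f k) hk
      have h2 := h.root k
      have h3 := hroot k hk
      clear * - h1 h2 h3
      grind
    · rw [hout _ hk, h.root]
  · have hsymm : ∀ k l, LinkedIn G {w | χ' w = k ∨ χ' w = l} (f k) (f l) →
        LinkedIn G {w | χ' w = l ∨ χ' w = k} (f l) (f k) := fun k l h =>
      h.symm.mono fun w hw => Or.symm hw
    rcases hall k with rfl | rfl | rfl | rfl <;> rcases hall l with rfl | rfl | rfl | rfl <;>
      first
      | exact .refl
      | assumption
      | exact hsymm _ _ (by assumption)
  · simp only [Set.mem_ofPred_eq] at *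
    grind

lemma IsLinking.exists_of_separation (hG : ∀ x y, LinkedIn G Set.univ x y) (h : IsLinking G f χ)
    (huX : u ∉ X) (hvX : v ∉ X) (hX : ∀ p ∈ X, ∀ q, q ∉ X → G.Adj p q → q = u ∨ q = v)
    (hX0 : X.Nonempty) (hroot : ∀ k, f k ∈ X → k = χ u ∨ k = χ v) :
    ∃ χ', IsLinking G f χ' ∧ ∃ p q, G.Adj p q ∧ χ' p = χ' q := by
  by_cases hv : f (χ v) ∈ X ∧ χ u ≠ χ v
  · by_cases hu : f (χ u) ∈ X
    · exact h.exists_of_two_roots huX hvX hX hv.2 hu hv.1 hroot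
    · refine h.exists_of_one_root hG hvX huX (fun p hp q hq hpq => (hX p hp q hq hpq).symm) hX0
        fun k hk => (hroot k hk).resolve_left ?_
      rintro rfl
      exact hu hk
  · refine h.exists_of_one_root hG huX hvX hX hX0 fun k hk => ?_
    rcases hroot k hk with h' | rfl
    · exact h'
    · by_contra hne
      exact hv ⟨hk, fun h => hne h.symm⟩

/-- If no linking colouring has a monochromatic edge, no two vertices separate the graph. -/
lemma IsLinking.survivesPairs (hG : ∀ x y, LinkedIn G Set.univ x y) (h : IsLinking G f χ)
    (hno : ∀ χ', IsLinking G f χ' → ∀ p q, G.Adj p q → χ' p ≠ χ' q) : SurvivesPairs G := by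
  intro u v x y hxu hxv hyu hyv
  by_contra hxy
  have hcomp : ∀ z, z ≠ u → z ≠ v → (u ∉ compIn G {u, v}ᶜ z ∧ v ∉ compIn G {u, v}ᶜ z ∧
      ∀ p ∈ compIn G {u, v}ᶜ z, ∀ q, q ∉ compIn G {u, v}ᶜ z → G.Adj p q → q = u ∨ q = v) := by
    intro z hzu hzv
    have hz : z ∈ ({u, v}ᶜ : Set V) := by simp [hzu, hzv]
    refine ⟨fun h => compIn_subset hz h (by simp), fun h => compIn_subset hz h (by simp),
      fun p hp q hq hpq => ?_⟩
    by_contra hcon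
    exact hq (compIn_closed hz hp hpq (by simpa using hcon))
  have key : ∀ z, z ≠ u → z ≠ v →
      ¬ ∀ k, f k ∈ compIn G {u, v}ᶜ z → k = χ u ∨ k = χ v := by
    intro z hzu hzv hroot
    obtain ⟨h1, h2, h3⟩ := hcomp z hzu hzv
    obtain ⟨χ', h', p, q, hpq, hχ⟩ := h.exists_of_separation hG h1 h2 h3 ⟨z, mem_compIn_self⟩ hroot
    exact hno χ' h' p q hpq hχ
  have hx := key x hxu hxv
  have hy := key y hyu hyv
  push Not at hx hy
  obtain ⟨k, hk, hku, hkv⟩ := hx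
  obtain ⟨l, hl, hlu, hlv⟩ := hy
  have hlX : f l ∉ compIn G {u, v}ᶜ x := fun h => hxy (h.trans hl.symm)
  obtain ⟨p, q, hp, hq, hpq, -, hqS, -⟩ := (h.link k l).exists_exit hk hlX
  rcases (hcomp x hxu hxv).2.2 p hp q hq hpq with rfl | rfl
  · exact hqS.elim (fun h => hku h.symm) fun h => hlu h.symm
  · exact hqS.elim (fun h => hkv h.symm) fun h => hlv h.symm

end Colouring

section Main

variable {V W : Type} {G : SimpleGraph V}

variable (G) in
/-- A `K₄`-model rooted at `f`. -/
def HasModel (f : Fin 4 → V) : Prop :=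
  ∃ C : Fin 4 → Set V, (∀ k, f k ∈ C k) ∧ (∀ k, IsConn G (C k)) ∧
    (∀ k l, k ≠ l → ∀ x ∈ C k, x ∉ C l) ∧ ∀ k l, k ≠ l → Touch G (C k) (C l)

lemma HasK4.hasModel {f : Fin 4 → V} (h : HasK4 G (f 0) (f 1) (f 2) (f 3)) : HasModel G f := by
  obtain ⟨A, B, C, D, h, hBC⟩ := h
  have hd := h.disj
  refine ⟨![A, B, C, D], fun k => ?_, fun k => ?_, fun k l hkl x => ?_, fun k l hkl => ?_⟩
  · fin_cases k
    exacts [h.memA, h.memB, h.memC, h.memD]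
  · fin_cases k
    exacts [h.connA, h.connB, h.connC, h.connD]
  · have := hd x
    fin_cases k <;> fin_cases l <;> first | exact absurd rfl hkl | (simp; tauto)
  · fin_cases k <;> fin_cases l <;> first
      | exact absurd rfl hkl
      | exact h.touchAB
      | exact h.touchAC
      | exact h.touchAD
      | exact hBC
      | exact h.touchBD
      | exact h.touchCD
      | exact h.touchAB.symm
      | exact h.touchAC.symm
      | exact h.touchAD.symm
      | exact hBC.symm
      | exact h.touchBD.symm
      | exact h.touchCD.symm

/-- A model in a minor lifts. -/
lemma HasModel.lift {G' : SimpleGraph W} {f : Fin 4 → V} {f' : Fin 4 → W} (φ : W → Set V)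
    (hφ : ∀ x, IsConn G (φ x)) (hdis : ∀ x y p, p ∈ φ x → p ∈ φ y → x = y)
    (hadj : ∀ x y, G'.Adj x y → Touch G (φ x) (φ y)) (hf : ∀ k, f k ∈ φ (f' k))
    (h : HasModel G' f') : HasModel G f := by
  obtain ⟨C, hfC, hC, hCd, hCt⟩ := h
  have hlift : ∀ (S : Set W) x y, LinkedIn G' S x y → x ∈ S → ∀ p ∈ φ x, ∀ q ∈ φ y,
      LinkedIn G {p | ∃ x ∈ S, p ∈ φ x} p q := by
    intro S x y hxy hx p hp
    induction hxy with
    | refl => exact fun q hq => (hφ x p hp q hq).mono fun w hw => ⟨x, hx, hw⟩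
    | tail _ h ih =>
      rename_i y z _
      intro q hq
      obtain ⟨r, hr, s, hs, hrs⟩ := hadj y z h.1
      exact ((ih r hr).trans (.single hrs ⟨y, h.2.1, hr⟩ ⟨z, h.2.2, hs⟩)).trans
        ((hφ z s hs q hq).mono fun w hw => ⟨z, h.2.2, hw⟩)
  refine ⟨fun k => {p | ∃ x ∈ C k, p ∈ φ x}, fun k => ⟨f' k, hfC k, hf k⟩, ?_, ?_, ?_⟩
  · rintro k p ⟨x, hx, hp⟩ q ⟨y, hy, hq⟩
    exact hlift (C k) x y (hC k x hx y hy) hx p hp q hq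
  · rintro k l hkl p ⟨x, hx, hp⟩ ⟨y, hy, hq⟩
    obtain rfl := hdis x y p hp hq
    exact hCd k l hkl x hx hy
  · intro k l hkl
    obtain ⟨x, hx, y, hy, hxy⟩ := hCt k l hkl
    exact (hadj x y hxy).mono (fun p hp => ⟨x, hx, hp⟩) fun p hp => ⟨y, hy, hp⟩

open Classical in
/-- The retraction identifying `v` with `u`. -/
noncomputable def contractTo {u v : V} (h : u ≠ v) (w : V) : {w // w ≠ v} :=
  if hw : w = v then ⟨u, h⟩ else ⟨w, hw⟩

lemma contractTo_self {u v : V} (h : u ≠ v) : contractTo h v = ⟨u, h⟩ := dif_pos rfl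

lemma contractTo_of_ne {u v w : V} (h : u ≠ v) (hw : w ≠ v) : contractTo h w = ⟨w, hw⟩ :=
  dif_neg hw

/-- The image of the graph `G` under the map `π`, without loops. -/
def imageGraph (G : SimpleGraph V) (π : V → W) : SimpleGraph W where
  Adj x y := x ≠ y ∧ ∃ p q, π p = x ∧ π q = y ∧ G.Adj p q
  symm := ⟨by
    rintro x y ⟨hxy, p, q, hp, hq, h⟩
    exact ⟨hxy.symm, q, p, hq, hp, h.symm⟩⟩
  loopless := ⟨fun x h => h.1 rfl⟩

lemma LinkedIn.imageGraph {S : Set V} {T : Set W} {x y : V} (h : LinkedIn G S x y) (π : V → W)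
    (hπ : ∀ p ∈ S, π p ∈ T) : LinkedIn (imageGraph G π) T (π x) (π y) :=
  h.map π fun p q hpq hp hq => by
    by_cases hne : π p = π q
    · rw [hne]
      exact .refl
    · exact .single ⟨hne, p, q, rfl, rfl, hpq⟩ (hπ p hp) (hπ q hq)

lemma IsLinking.hasModel_of_connected (n : ℕ) : ∀ (V : Type) [Finite V] (G : SimpleGraph V)
    (f : Fin 4 → V) (χ : V → Fin 4), Nat.card V = n → (∀ x y, LinkedIn G Set.univ x y) →
    IsLinking G f χ → HasModel G f := by
  induction n using Nat.strong_induction_on with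
  | _ n ih =>
    intro V _ G f χ hn hG h
    by_cases hno : ∀ χ', IsLinking G f χ' → ∀ p q, G.Adj p q → χ' p ≠ χ' q
    · have hne : ∀ k l, k ≠ l → f k ≠ f l := fun k l hkl he => hkl <| by
        rw [← h.root k, ← h.root l, he]
      have hl : ∀ i j k l : Fin 4, k ≠ i → k ≠ j → l ≠ i → l ≠ j →
          DisjointLinks G (f i) (f j) (f k) (f l) := fun i j k l hki hkj hli hlj =>
        ⟨_, _, Or.inl (h.root i), Or.inl (h.root k), h.link i j, h.link k l, fun v hv hv' => by
          simp only [Set.mem_ofPred_eq] at hv hv'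
          grind⟩
      exact ((h.survivesPairs hG hno).hasK4 (hne 0 1 (by decide)) (hne 0 2 (by decide))
        (hne 0 3 (by decide)) (hne 1 2 (by decide)) (hne 1 3 (by decide)) (hne 2 3 (by decide))
        (hl 0 1 2 3 (by decide) (by decide) (by decide) (by decide))
        (hl 0 2 1 3 (by decide) (by decide) (by decide) (by decide))
        (hl 0 3 1 2 (by decide) (by decide) (by decide) (by decide))).hasModel
    · push Not at hno
      obtain ⟨χ, h, u, v, huv, hχ⟩ := hno
      clear * - ih hn hG h huv hχ
      wlog hv : ∀ k, f k ≠ v generalizing u v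
      · push Not at hv
        obtain ⟨k, rfl⟩ := hv
        refine this (f k) u huv.symm hχ.symm fun l hl => huv.ne ?_
        subst hl
        rw [h.root, h.root] at hχ
        rw [hχ]
      have hcard : Nat.card {w // w ≠ v} < n := hn ▸ Finite.card_subtype_lt (x := v) (by simp)
      have hval : ∀ w, χ (contractTo huv.ne w).1 = χ w := fun w => by
        by_cases hw : w = v
        · rw [hw, contractTo_self, hχ]
        · rw [contractTo_of_ne _ hw]
      have hsurj : ∀ x : {w // w ≠ v}, contractTo huv.ne x.1 = x := fun x =>
        contractTo_of_ne _ x.2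
      have hfk : ∀ k, contractTo huv.ne (f k) = ⟨f k, hv k⟩ := fun k => contractTo_of_ne _ (hv k)
      refine (ih _ hcard _ (imageGraph G (contractTo huv.ne)) (fun k => ⟨f k, hv k⟩)
        (fun w => χ w.1) rfl (fun x y => ?_) ⟨fun k => h.root k, fun i j => ?_⟩).lift
        (fun x => {w | contractTo huv.ne w = x}) (fun x p hp q hq => ?_)
        (fun x y p hp hq => hp.symm.trans hq) ?_ hfk
      · rw [← hsurj x, ← hsurj y]
        exact (hG x.1 y.1).imageGraph _ fun p _ => Set.mem_univ _
      · rw [← hfk i, ← hfk j]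
        refine (h.link i j).imageGraph _ fun p hp => ?_
        simpa only [Set.mem_ofPred_eq, hval] using hp
      · have hfib : ∀ r, contractTo huv.ne r = x → r = x.1 ∨ (r = v ∧ x.1 = u) := by
          rintro r rfl
          by_cases hr : r = v
          · rw [hr, contractTo_self]
            exact Or.inr ⟨rfl, rfl⟩
          · rw [contractTo_of_ne _ hr]
            exact Or.inl rfl
        rcases hfib p hp with hp' | ⟨hp', hpu⟩ <;> rcases hfib q hq with hq' | ⟨hq', hqu⟩
        · rw [hp', hq']
          exact .refl
        · refine .single ?_ hp hq
          rw [hp', hq', hqu]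
          exact huv
        · refine .single ?_ hp hq
          rw [hp', hq', hpu]
          exact huv.symm
        · rw [hp', hq']
          exact .refl
      · rintro x y ⟨-, p, q, hp, hq, hpq⟩
        exact ⟨p, hp, q, hq, hpq⟩

lemma IsLinking.hasModel [Finite V] {f : Fin 4 → V} {χ : V → Fin 4} (h : IsLinking G f χ) :
    HasModel G f := by
  classical
  have hroot : ∀ k, f k ∈ compIn G Set.univ (f 0) := fun k =>
    (h.link 0 k).mono (Set.subset_univ _)
  let π : V → compIn G Set.univ (f 0) := fun w =>
    if hw : w ∈ compIn G Set.univ (f 0) then ⟨w, hw⟩ else ⟨f 0, hroot 0⟩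
  have hπ : ∀ w (hw : w ∈ compIn G Set.univ (f 0)), π w = ⟨w, hw⟩ := fun w hw => dif_pos hw
  have hπ' : ∀ w, w ∉ compIn G Set.univ (f 0) → π w = ⟨f 0, hroot 0⟩ := fun w hw => dif_neg hw
  have hmap : ∀ (S : Set V) x y, LinkedIn G S x y →
      LinkedIn (G.comap Subtype.val) {w : compIn G Set.univ (f 0) | w.1 ∈ S} (π x) (π y) := by
    intro S x y hxy
    refine hxy.map π fun p q hpq hp hq => ?_
    by_cases hpK : p ∈ compIn G Set.univ (f 0)
    · have hqK : q ∈ compIn G Set.univ (f 0) := compIn_closed (Set.mem_univ _) hpK hpq trivial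
      rw [hπ p hpK, hπ q hqK]
      exact .single hpq hp hq
    · have hqK : q ∉ compIn G Set.univ (f 0) := fun hqK =>
        hpK (compIn_closed (Set.mem_univ _) hqK hpq.symm trivial)
      rw [hπ' p hpK, hπ' q hqK]
      exact .refl
  refine (IsLinking.hasModel_of_connected _ _ (G.comap Subtype.val) (fun k => ⟨f k, hroot k⟩)
    (fun w => χ w.1) rfl (fun x y => ?_) ⟨fun k => h.root k, fun i j => ?_⟩).lift
    (fun x => {x.1}) (fun x => isConn_singleton) (fun x y p hp hq => Subtype.ext ?_)
    (fun x y hxy => ⟨x.1, rfl, y.1, rfl, hxy⟩) fun k => rfl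
  · have := hmap Set.univ x.1 y.1 ((LinkedIn.symm x.2).trans y.2)
    rw [hπ _ x.2, hπ _ y.2] at this
    exact this.mono (Set.subset_univ _)
  · have := hmap _ _ _ (h.link i j)
    rw [hπ _ (hroot i), hπ _ (hroot j)] at this
    exact this
  · rw [← show p = x.1 from hp, ← show p = y.1 from hq]

lemma linkedIn_support {x y : V} (p : G.Walk x y) : LinkedIn G {w | w ∈ p.support} x y := by
  induction p with
  | nil => exact .refl
  | cons h p ih =>
    refine (LinkedIn.single h (by simp) (by simp)).trans (ih.mono fun w hw => ?_)
    have hw : w ∈ p.support := hw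
    simp [hw]

lemma IsConn.induce_connected {S : Set V} (hS : IsConn G S) {x : V} (hx : x ∈ S) :
    (G.induce S).Connected := by
  have key : ∀ y, LinkedIn G S x y → ∀ hy : y ∈ S, (G.induce S).Reachable ⟨x, hx⟩ ⟨y, hy⟩ := by
    intro y hxy
    induction hxy with
    | refl => exact fun _ => .rfl
    | tail _ h ih =>
      intro hy
      refine (ih h.2.1).trans (SimpleGraph.Adj.reachable ?_)
      exact h.1
  exact (SimpleGraph.connected_iff_exists_forall_reachable _).2
    ⟨⟨x, hx⟩, fun y => key y (hS x hx y y.2) y.2⟩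

lemma HScheme.exists_isLinking {f : Fin 4 ↪ V} (P : HScheme (⊤ : SimpleGraph (Fin 4)) G f) :
    ∃ χ, IsLinking G f χ := by
  classical
  choose! χ hχ using P.common_endpoint
  refine ⟨χ, fun k => ?_, fun i j => ?_⟩
  · have hk : ∀ l, k ≠ l → χ (f k) = k ∨ χ (f k) = l := fun l hkl =>
      hχ (f k) ⟨k, l, hkl, SimpleGraph.Walk.start_mem_support _⟩ k l hkl
        (SimpleGraph.Walk.start_mem_support _)
    have hne : ∀ k : Fin 4, k ≠ k + 1 := by decide
    obtain ⟨l, m, hl, -, hm, -, hlm, -⟩ := exists_other_two k (k + 1) (hne k)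
    have h1 := hk l hl.symm
    have h2 := hk m hm.symm
    grind
  · by_cases hij : i = j
    · subst hij
      exact .refl
    · exact (linkedIn_support (P.path i j hij)).mono fun w hw =>
        (hχ w ⟨i, j, hij, hw⟩ i j hij hw).imp (fun h => h) fun h => h

end Main

/-- `K₄` is rooted-contractible. -/
theorem K4_rooted_contractible : IsRootedContractible (⊤ : SimpleGraph (Fin 4)) := by
  intro V _ G f ⟨P⟩
  obtain ⟨χ, hχ⟩ := P.exists_isLinking
  obtain ⟨C, hf, hC, hdis, htouch⟩ := hχ.hasModel
  exact ⟨C, hf, fun v => (hC v).induce_connected (hf v),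
    fun u v huv => Set.disjoint_left.2 (hdis u v huv), fun u v huv => htouch u v huv⟩
end

section
/- The complete bipartite graph K_{2,3} and the complete tripartite graph K_{1,1,3} are both rooted-contractible, i.e., every graph that contains a K_{2,3}-scheme contains K_{2,3} as a rooted minor, and every graph that contains a K_{1,1,3}-scheme contains K_{1,1,3} as a rooted minor. -/
open SimpleGraph

section

open Sum (inl inr)

/-- `ReachIn G S u v`: some walk of `G` from `u` to `v` has all its vertices in `S`. -/
def ReachIn {β : Type} (G : SimpleGraph β) (S : Set β) (u v : β) : Prop :=
  ∃ p : G.Walk u v, ∀ w ∈ p.support, w ∈ S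

namespace ReachIn

variable {β : Type} {G : SimpleGraph β} {S T : Set β} {u v w : β}

theorem refl (h : u ∈ S) : ReachIn G S u u := ⟨.nil, by simpa using h⟩

theorem left_mem (h : ReachIn G S u v) : u ∈ S := h.elim fun p hp => hp _ p.start_mem_support

theorem right_mem (h : ReachIn G S u v) : v ∈ S := h.elim fun p hp => hp _ p.end_mem_support

theorem symm (h : ReachIn G S u v) : ReachIn G S v u := by
  obtain ⟨p, hp⟩ := h
  exact ⟨p.reverse, fun w hw => hp w (by simpa using hw)⟩

theorem trans (h : ReachIn G S u v) (h' : ReachIn G S v w) : ReachIn G S u w := by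
  obtain ⟨p, hp⟩ := h
  obtain ⟨q, hq⟩ := h'
  exact ⟨p.append q, fun x hx => ((Walk.mem_support_append_iff _ _).1 hx).elim (hp x) (hq x)⟩

theorem mono (h : ReachIn G S u v) (hST : S ⊆ T) : ReachIn G T u v := by
  obtain ⟨p, hp⟩ := h
  exact ⟨p, fun w hw => hST (hp w hw)⟩

theorem of_adj (h : G.Adj u v) (hu : u ∈ S) (hv : v ∈ S) : ReachIn G S u v :=
  ⟨h.toWalk, by simp [hu, hv]⟩

theorem exists_boundary (h : ReachIn G S u v) (hu : u ∈ T) (hv : v ∉ T) :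
    ∃ x y, G.Adj x y ∧ x ∈ S ∧ y ∈ S ∧ x ∈ T ∧ y ∉ T := by
  obtain ⟨p, hp⟩ := h
  obtain ⟨d, hd, h1, h2⟩ := p.exists_boundary_dart T hu hv
  exact ⟨d.fst, d.snd, d.adj, hp _ (p.dart_fst_mem_support_of_mem_darts hd),
    hp _ (p.dart_snd_mem_support_of_mem_darts hd), h1, h2⟩

end ReachIn

/-- Any two vertices of `S` are joined by a walk inside `S`. -/
def ConnIn {β : Type} (G : SimpleGraph β) (S : Set β) : Prop :=
  ∀ u ∈ S, ∀ v ∈ S, ReachIn G S u v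

theorem ConnIn.of_root {β : Type} {G : SimpleGraph β} {S : Set β} (r : β)
    (h : ∀ v ∈ S, ReachIn G S r v) : ConnIn G S :=
  fun u hu v hv => (h u hu).symm.trans (h v hv)

theorem ConnIn.singleton {β : Type} (G : SimpleGraph β) (v : β) : ConnIn G {v} := by
  rintro u rfl w rfl
  exact .refl rfl

theorem ConnIn.union {β : Type} {G : SimpleGraph β} {S T : Set β} (hS : ConnIn G S)
    (hT : ConnIn G T) (h : ∃ x ∈ S, ∃ y ∈ T, G.Adj x y) : ConnIn G (S ∪ T) := by
  obtain ⟨x, hx, y, hy, hxy⟩ := h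
  refine .of_root x fun v hv => ?_
  rcases hv with hv | hv
  · exact (hS x hx v hv).mono Set.subset_union_left
  · exact (ReachIn.of_adj hxy (.inl hx) (.inr hy)).trans
      ((hT y hy v hv).mono Set.subset_union_right)

theorem ConnIn.induce_connected {β : Type} {G : SimpleGraph β} {S : Set β} (h : ConnIn G S)
    (hne : S.Nonempty) : (G.induce S).Connected := by
  obtain ⟨r, hr⟩ := hne
  refine G.induce_connected_of_patches r hr @fun v hv => ?_
  obtain ⟨p, hp⟩ := h r hr v hv
  exact ⟨S, subset_rfl, hr, hv, ⟨p.induce S hp⟩⟩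

theorem ConnIn.component {β : Type} (G : SimpleGraph β) (S : Set β) (r : β) :
    ConnIn G {v | ReachIn G S r v} := by
  classical
  refine .of_root r ?_
  rintro v ⟨p, hp⟩
  refine ⟨p, fun w hw => ?_⟩
  exact ⟨p.takeUntil w hw, fun z hz => hp z (p.support_takeUntil_subset_support hw hz)⟩

/-- A connected set with two distinct vertices splits into two adjacent connected parts
separating them. -/
theorem ConnIn.exists_split {β : Type} {G : SimpleGraph β} {Q : Set β} (hQ : ConnIn G Q)
    {x y : β} (hx : x ∈ Q) (hy : y ∈ Q) (hxy : x ≠ y) :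
    ∃ X Y : Set β, X ∪ Y = Q ∧ Disjoint X Y ∧ x ∈ X ∧ y ∈ Y ∧ ConnIn G X ∧ ConnIn G Y ∧
      ∃ u ∈ X, ∃ v ∈ Y, G.Adj u v := by
  set Y : Set β := {v | ReachIn G (Q \ {x}) y v} with hY
  have hYQ : Y ⊆ Q := fun v hv => hv.right_mem.1
  have hyY : y ∈ Y := .refl ⟨hy, fun h => hxy h.symm⟩
  have hxY : x ∉ Y := fun h => h.right_mem.2 rfl
  refine ⟨Q \ Y, Y, Set.sdiff_union_of_subset hYQ, Set.disjoint_sdiff_left,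
    And.intro hx hxY, hyY, ?_, ?_, ?_⟩
  · have key : ∀ u v (p : G.Walk u v), v = x → (∀ w ∈ p.support, w ∈ Q) → u ∉ Y →
        ReachIn G (Q \ Y) u v := by
      intro u v p
      induction p with
      | nil => exact fun _ hp hu => .refl ⟨hp _ (by simp), hu⟩
      | @cons u w v h p ih =>
        intro hv hp hu
        have huQ : u ∈ Q := hp u (by simp)
        have hpQ : ∀ w ∈ p.support, w ∈ Q := fun z hz => hp z (by simp [hz])
        by_cases hux : u = x
        · rw [hv, ← hux]; exact .refl ⟨huQ, hu⟩
        · have hw : w ∉ Y := fun hw => hu (hw.trans (.of_adj h.symm hw.right_mem ⟨huQ, hux⟩))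
          exact (ReachIn.of_adj (S := Q \ Y) h ⟨huQ, hu⟩ ⟨hpQ w (by simp), hw⟩).trans
            (ih hv hpQ hw)
    refine .of_root x fun v hv => ?_
    obtain ⟨p, hp⟩ := hQ v hv.1 x hx
    exact (key v x p rfl hp hv.2).symm
  · exact .component G _ y
  · obtain ⟨u, v, huv, hu, hv, huY, hvY⟩ := (hQ y hy x hx).exists_boundary hyY hxY
    exact ⟨v, ⟨hv, hvY⟩, u, huY, huv.symm⟩

/-- A colouring certifying a scheme between the roots `a i` and `b j`: every root has its own
colour, and `a i`, `b j` are joined by a walk using only their two colours. -/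
structure ColoredScheme {β J : Type} (G : SimpleGraph β) (a : Fin 2 → β) (b : J → β)
    (c : β → Fin 2 ⊕ J) : Prop where
  color_a : ∀ i, c (a i) = inl i
  color_b : ∀ j, c (b j) = inr j
  reach : ∀ i j, ReachIn G {v | c v = inl i ∨ c v = inr j} (a i) (b j)

/-- Branch sets of a complete bipartite minor rooted at the vertices `a i` and `b j`. -/
structure BipMinor {β J : Type} (G : SimpleGraph β) (a : Fin 2 → β) (b : J → β)
    (A : Fin 2 → Set β) (B : J → Set β) : Prop where
  mem_a : ∀ i, a i ∈ A i
  mem_b : ∀ j, b j ∈ B j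
  conn_a : ∀ i, ConnIn G (A i)
  conn_b : ∀ j, ConnIn G (B j)
  disj_aa : ∀ i i', i ≠ i' → Disjoint (A i) (A i')
  disj_ab : ∀ i j, Disjoint (A i) (B j)
  disj_bb : ∀ j j', j ≠ j' → Disjoint (B j) (B j')
  adj : ∀ i j, ∃ x ∈ A i, ∃ y ∈ B j, G.Adj x y

section Contraction

variable {β Q : Type} {G : SimpleGraph β} {G' : SimpleGraph Q} {π : β → Q}

theorem ReachIn.map {S : Set β} {S' : Set Q} {u v : β} (h : ReachIn G S u v)
    (hG : ∀ x y, G.Adj x y → π x = π y ∨ G'.Adj (π x) (π y)) (hS : ∀ x ∈ S, π x ∈ S') :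
    ReachIn G' S' (π u) (π v) := by
  obtain ⟨p, hp⟩ := h
  induction p with
  | nil => exact .refl (hS _ (hp _ (by simp)))
  | @cons u w v h p ih =>
    have hw := ih fun z hz => hp z (by simp [hz])
    rcases hG _ _ h with h | h
    · rwa [h]
    · exact (ReachIn.of_adj h (hS _ (hp _ (by simp))) hw.left_mem).trans hw

theorem ReachIn.lift {S' : Set Q} {q r : Q} (h : ReachIn G' S' q r)
    (hG : ∀ q r, G'.Adj q r → ∃ x y, π x = q ∧ π y = r ∧ G.Adj x y)
    (hπ : ∀ x y, π x = π y → ReachIn G (π ⁻¹' {π x}) x y) {x y : β} (hx : π x = q)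
    (hy : π y = r) : ReachIn G (π ⁻¹' S') x y := by
  have fib : ∀ x y, π x = π y → π x ∈ S' → ReachIn G (π ⁻¹' S') x y := fun x y h hS =>
    (hπ x y h).mono (by rintro z (hz : π z = π x); simpa [hz] using hS)
  obtain ⟨p, hp⟩ := h
  induction p generalizing x with
  | nil => exact fib x y (hx.trans hy.symm) (hx ▸ hp _ (by simp))
  | @cons q s r h p ih =>
    obtain ⟨u, v, rfl, rfl, huv⟩ := hG _ _ h
    have hv : π v ∈ S' := hp _ (by simp)
    have hu : π u ∈ S' := hp _ (by simp)
    exact ((fib x u hx (hx ▸ hu)).trans (.of_adj huv hu hv)).trans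
      (ih rfl hy fun z hz => hp z (by simp [hz]))

theorem BipMinor.lift {J : Type} {a : Fin 2 → β} {b : J → β} {A : Fin 2 → Set Q}
    {B : J → Set Q} (h : BipMinor G' (π ∘ a) (π ∘ b) A B)
    (hG : ∀ q r, G'.Adj q r → ∃ x y, π x = q ∧ π y = r ∧ G.Adj x y)
    (hπ : ∀ x y, π x = π y → ReachIn G (π ⁻¹' {π x}) x y) :
    BipMinor G a b (fun i => π ⁻¹' A i) (fun j => π ⁻¹' B j) where
  mem_a := h.mem_a
  mem_b := h.mem_b
  conn_a i u hu v hv := (h.conn_a i _ hu _ hv).lift hG hπ rfl rfl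
  conn_b j u hu v hv := (h.conn_b j _ hu _ hv).lift hG hπ rfl rfl
  disj_aa i i' hi := (h.disj_aa i i' hi).preimage π
  disj_ab i j := (h.disj_ab i j).preimage π
  disj_bb j j' hj := (h.disj_bb j j' hj).preimage π
  adj i j := by
    obtain ⟨q, hq, r, hr, hqr⟩ := h.adj i j
    obtain ⟨x, y, rfl, rfl, hxy⟩ := hG _ _ hqr
    exact ⟨x, hq, y, hr, hxy⟩

end Contraction

/-- The spanning subgraph of the edges whose endpoints have the same colour. -/
def monoGraph {β κ : Type} (G : SimpleGraph β) (c : β → κ) : SimpleGraph β where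
  Adj u v := G.Adj u v ∧ c u = c v
  symm := ⟨fun _ _ h => ⟨h.1.symm, h.2.symm⟩⟩
  loopless := ⟨fun _ h => G.loopless.irrefl _ h.1⟩

theorem monoGraph_walk {β κ : Type} {G : SimpleGraph β} {c : β → κ} {u v : β}
    (p : (monoGraph G c).Walk u v) :
    c u = c v ∧ ReachIn G {w | (monoGraph G c).connectedComponentMk w =
      (monoGraph G c).connectedComponentMk u} u v := by
  induction p with
  | nil => exact ⟨rfl, .refl rfl⟩
  | @cons u w v h p ih =>
    have e : (monoGraph G c).connectedComponentMk w = (monoGraph G c).connectedComponentMk u :=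
      (ConnectedComponent.sound h.reachable).symm
    exact ⟨h.2.trans ih.1,
      ReachIn.trans (v := w) (.of_adj h.1 (by simp) e) (by rw [← e]; exact ih.2)⟩

/-- Contracting the monochromatic components reduces the construction of a minor to a smaller
graph as soon as there is a monochromatic edge. -/
theorem exists_bipMinor_of_contract {β J : Type} [Finite β] {G : SimpleGraph β}
    {a : Fin 2 → β} {b : J → β} {c : β → Fin 2 ⊕ J} (hc : ColoredScheme G a b c)
    (IH : ∀ (Q : Type) [Finite Q], Nat.card Q < Nat.card β → ∀ (G : SimpleGraph Q)
      (a : Fin 2 → Q) (b : J → Q) (c : Q → Fin 2 ⊕ J), ColoredScheme G a b c →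
      ∃ A B, BipMinor G a b A B ∧ ∀ i v, ReachIn G {w | c w = inl i} (a i) v → v ∈ A i)
    {x y : β} (hxy : G.Adj x y) (hcxy : c x = c y) :
    ∃ A B, BipMinor G a b A B ∧ ∀ i v, ReachIn G {w | c w = inl i} (a i) v → v ∈ A i := by
  let M := monoGraph G c
  let π : β → M.ConnectedComponent := M.connectedComponentMk
  have hπc : ∀ u v, π u = π v → c u = c v := fun u v h =>
    (ConnectedComponent.exact h).elim fun p => (monoGraph_walk p).1
  have hπ : ∀ u v, π u = π v → ReachIn G (π ⁻¹' {π u}) u v := fun u v h =>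
    (ConnectedComponent.exact h).elim fun p => (monoGraph_walk p).2
  have hsurj : Function.Surjective π := fun q => q.ind fun v => ⟨v, rfl⟩
  have : Finite M.ConnectedComponent := Finite.of_surjective π hsurj
  have hπxy : ∀ x y, G.Adj x y → c x = c y → π x = π y := fun x y h h' =>
    ConnectedComponent.sound (Adj.reachable (G := M) ⟨h, h'⟩)
  have hcard : Nat.card M.ConnectedComponent < Nat.card β := by
    have := Fintype.ofFinite β
    have := Fintype.ofFinite M.ConnectedComponent
    simp only [Nat.card_eq_fintype_card]
    exact Fintype.card_lt_of_surjective_not_injective π hsurj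
      fun h => hxy.ne (h (hπxy x y hxy hcxy))
  let G' : SimpleGraph M.ConnectedComponent :=
    { Adj := fun q r => q ≠ r ∧ ∃ x y, π x = q ∧ π y = r ∧ G.Adj x y
      symm := ⟨fun _ _ ⟨h, x, y, hx, hy, hxy⟩ => ⟨h.symm, y, x, hy, hx, hxy.symm⟩⟩
      loopless := ⟨fun _ h => h.1 rfl⟩ }
  have hG : ∀ x y, G.Adj x y → π x = π y ∨ G'.Adj (π x) (π y) := fun x y h =>
    or_iff_not_imp_left.2 fun hne => ⟨hne, x, y, rfl, rfl, h⟩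
  have hG' : ∀ q r, G'.Adj q r → ∃ x y, π x = q ∧ π y = r ∧ G.Adj x y := fun q r h => h.2
  let c' : M.ConnectedComponent → Fin 2 ⊕ J := fun q => c (Function.surjInv hsurj q)
  have hc' : ∀ v, c' (π v) = c v := fun v => hπc _ _ (Function.surjInv_eq hsurj (π v))
  obtain ⟨A, B, hAB, hmono⟩ := IH _ hcard G' (π ∘ a) (π ∘ b) c'
    { color_a := fun i => (hc' _).trans (hc.color_a i)
      color_b := fun j => (hc' _).trans (hc.color_b j)
      reach := fun i j => (hc.reach i j).map hG fun v hv => by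
        simpa only [Set.mem_ofPred_eq, hc'] using hv }
  refine ⟨_, _, hAB.lift hG' hπ, fun i v hv => hmono i _ (hv.map hG fun w hw => ?_)⟩
  simpa only [Set.mem_ofPred_eq, hc'] using hw

/-- Two supermodular functions with a small total can be annihilated by disjoint sets. -/
theorem exists_disjoint_of_supermodular {ε : Type} [DecidableEq ε] (E : Finset ε) :
    ∀ k₁ k₂ : Finset ε → ℕ,
      (∀ F F', k₁ F + k₁ F' ≤ k₁ (F ∪ F') + k₁ (F ∩ F')) →
      (∀ F F', k₂ F + k₂ F' ≤ k₂ (F ∪ F') + k₂ (F ∩ F')) →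
      (∀ F ⊆ E, k₁ F + k₂ F ≤ (E \ F).card) →
      ∃ S₁ S₂, S₁ ⊆ E ∧ S₂ ⊆ E ∧ Disjoint S₁ S₂ ∧ k₁ S₁ = 0 ∧ k₂ S₂ = 0 := by
  induction E using Finset.induction_on with
  | empty =>
    intro k₁ k₂ _ _ h
    have := h ∅ subset_rfl
    simp only [Finset.sdiff_self, Finset.card_empty] at this
    exact ⟨∅, ∅, subset_rfl, subset_rfl, disjoint_bot_left, by omega, by omega⟩
  | insert e E he ih =>
    intro k₁ k₂ h₁ h₂ h
    have hsup : ∀ k : Finset ε → ℕ, (∀ F F', k F + k F' ≤ k (F ∪ F') + k (F ∩ F')) →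
        ∀ F F', k (insert e F) + k (insert e F') ≤
          k (insert e (F ∪ F')) + k (insert e (F ∩ F')) := fun k hk F F' => by
      simpa only [← Finset.insert_union_distrib, ← Finset.insert_inter_distrib] using
        hk (insert e F) (insert e F')
    by_cases c₁ : ∀ F ⊆ E, k₁ (insert e F) + k₂ F ≤ (E \ F).card
    · obtain ⟨S₁, S₂, hS₁, hS₂, hd, hz₁, hz₂⟩ :=
        ih (fun F => k₁ (insert e F)) k₂ (hsup k₁ h₁) h₂ c₁
      exact ⟨insert e S₁, S₂, Finset.insert_subset_insert e hS₁,
        hS₂.trans (Finset.subset_insert e E),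
        Finset.disjoint_insert_left.2 ⟨fun h => he (hS₂ h), hd⟩, hz₁, hz₂⟩
    by_cases c₂ : ∀ F ⊆ E, k₁ F + k₂ (insert e F) ≤ (E \ F).card
    · obtain ⟨S₁, S₂, hS₁, hS₂, hd, hz₁, hz₂⟩ :=
        ih k₁ (fun F => k₂ (insert e F)) h₁ (hsup k₂ h₂) c₂
      exact ⟨S₁, insert e S₂, hS₁.trans (Finset.subset_insert e E),
        Finset.insert_subset_insert e hS₂,
        Finset.disjoint_insert_right.2 ⟨fun h => he (hS₁ h), hd⟩, hz₁, hz₂⟩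
    push Not at c₁ c₂
    obtain ⟨F, hF, hlt⟩ := c₁
    obtain ⟨F', hF', hlt'⟩ := c₂
    have heF : e ∉ F := fun h => he (hF h)
    have heF' : e ∉ F' := fun h => he (hF' h)
    have s₁ := h₁ (insert e F) F'
    have s₂ := h₂ F (insert e F')
    rw [Finset.insert_union, Finset.insert_inter_of_notMem heF'] at s₁
    rw [Finset.union_insert, Finset.inter_insert_of_notMem heF] at s₂
    have t₁ := h (insert e (F ∪ F')) (Finset.insert_subset_insert e (Finset.union_subset hF hF'))
    have t₂ := h (F ∩ F') ((Finset.inter_subset_left.trans hF).trans (Finset.subset_insert e E))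
    have hU : F ∪ F' ⊆ E := Finset.union_subset hF hF'
    have hI : F ∩ F' ⊆ E := Finset.inter_subset_left.trans hF
    rw [Finset.card_sdiff_of_subset (Finset.insert_subset_insert e hU),
      Finset.card_insert_of_notMem he, Finset.card_insert_of_notMem (fun h => he (hU h))] at t₁
    rw [Finset.card_sdiff_of_subset (hI.trans (Finset.subset_insert e E)),
      Finset.card_insert_of_notMem he] at t₂
    rw [Finset.card_sdiff_of_subset hF] at hlt
    rw [Finset.card_sdiff_of_subset hF'] at hlt'
    have := Finset.card_union_add_card_inter F F'
    have := Finset.card_le_card hF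
    have := Finset.card_le_card hF'
    have := Finset.card_le_card hU
    have := Finset.card_le_card hI
    omega

/-- Functions supported on `A` that are constant on the part of `A ∪ {r}` adjacent to any given
vertex of `F`. -/
def gluedFunctions {β : Type} (G : SimpleGraph β) (A : Set β) (r : β) (F : Finset β) :
    Submodule ℚ (β → ℚ) where
  carrier := {φ | (∀ v ∉ A, φ v = 0) ∧ ∀ e ∈ F, ∀ u ∈ insert r A, ∀ v ∈ insert r A,
    G.Adj u e → G.Adj v e → φ u = φ v}
  add_mem' := by
    rintro φ ψ ⟨h1, h2⟩ ⟨h3, h4⟩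
    refine ⟨fun v hv => by simp [h1 v hv, h3 v hv], fun e he u hu v hv hue hve => ?_⟩
    simp [h2 e he u hu v hv hue hve, h4 e he u hu v hv hue hve]
  zero_mem' := by simp
  smul_mem' := by
    rintro x φ ⟨h1, h2⟩
    refine ⟨fun v hv => by simp [h1 v hv], fun e he u hu v hv hue hve => ?_⟩
    simp [h2 e he u hu v hv hue hve]

theorem gluedFunctions_anti {β : Type} {G : SimpleGraph β} {A : Set β} {r : β}
    {F F' : Finset β} (h : F ⊆ F') : gluedFunctions G A r F' ≤ gluedFunctions G A r F :=
  fun _ hφ => ⟨hφ.1, fun e he => hφ.2 e (h he)⟩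

theorem finrank_gluedFunctions_supermodular {β : Type} [Finite β] [DecidableEq β]
    (G : SimpleGraph β) (A : Set β) (r : β) (F F' : Finset β) :
    Module.finrank ℚ (gluedFunctions G A r F) + Module.finrank ℚ (gluedFunctions G A r F') ≤
      Module.finrank ℚ (gluedFunctions G A r (F ∪ F')) +
        Module.finrank ℚ (gluedFunctions G A r (F ∩ F')) := by
  have := Fintype.ofFinite β
  rw [← Submodule.finrank_sup_add_finrank_inf_eq, add_comm]
  refine add_le_add (Submodule.finrank_mono ?_) (Submodule.finrank_mono (sup_le ?_ ?_))
  · rintro φ ⟨h, h'⟩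
    exact ⟨h.1, fun e he => (Finset.mem_union.1 he).elim (h.2 e) (h'.2 e)⟩
  · exact gluedFunctions_anti Finset.inter_subset_left
  · exact gluedFunctions_anti Finset.inter_subset_right

/-- If only the zero function is glued along `S`, then `S` connects `A` to `r`. -/
theorem reachIn_of_gluedFunctions_eq_bot {β : Type} {G : SimpleGraph β} {A : Set β} {r : β}
    {S : Finset β} (h : gluedFunctions G A r S = ⊥) {v : β} (hv : v ∈ A) :
    ReachIn G (insert r A ∪ S) r v := by
  classical
  set C : Set β := {v | ReachIn G (insert r A ∪ S) r v} with hC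
  have hrC : r ∈ C := .refl (by simp)
  have hstep : ∀ e ∈ S, ∀ u ∈ insert r A, ∀ v ∈ insert r A, G.Adj u e → G.Adj v e →
      u ∈ C → v ∈ C := fun e he u hu v hv hue hve huC =>
    (huC.trans (.of_adj hue (.inl hu) (.inr he))).trans (.of_adj hve.symm (.inr he) (.inl hv))
  have hmem : (A \ C).indicator 1 ∈ gluedFunctions G A r S := by
    refine ⟨fun v hv => Set.indicator_of_notMem (fun h => hv h.1) _,
      fun e he u hu v hv hue hve => ?_⟩
    have hiff : u ∈ C ↔ v ∈ C :=
      ⟨hstep e he u hu v hv hue hve, hstep e he v hv u hu hve hue⟩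
    by_cases huC : u ∈ C
    · rw [Set.indicator_of_notMem (fun h => h.2 huC),
        Set.indicator_of_notMem (fun h => h.2 (hiff.1 huC))]
    · have hvC : v ∉ C := fun h => huC (hiff.2 h)
      have key : ∀ w ∈ insert r A, w ∉ C → w ∈ A \ C := fun w hw hwC =>
        ⟨hw.resolve_left fun h => hwC (h ▸ hrC), hwC⟩
      rw [Set.indicator_of_mem (key u hu huC), Set.indicator_of_mem (key v hv hvC)]
      rfl
  rw [h, Submodule.mem_bot] at hmem
  by_contra hvC
  have h0 := congrFun hmem v
  rw [Set.indicator_of_mem (show v ∈ A \ C from And.intro hv hvC)] at h0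
  simp at h0

/-- Paths from a common root `r` of colour `inl i` to the vertices `b j`, the `j`-th of which
alternates between the colours `inl i` and `inr j`. -/
structure AlternatingPaths {β κ J : Type} (G : SimpleGraph β) (c : β → κ ⊕ J) (i : κ) (r : β)
    (b : J → β) where
  path : ∀ j, G.Walk r (b j)
  isPath : ∀ j, (path j).IsPath
  color_even : ∀ j m, 2 * m ≤ (path j).length → c ((path j).getVert (2 * m)) = inl i
  color_odd : ∀ j m, 2 * m + 1 ≤ (path j).length → c ((path j).getVert (2 * m + 1)) = inr j

namespace AlternatingPaths

variable {β κ J : Type} {G : SimpleGraph β} {c : β → κ ⊕ J} {i : κ} {r : β} {b : J → β}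

/-- The vertices of colour `inl i`, other than the root, on the paths. -/
def core (P : AlternatingPaths G c i r b) : Set β :=
  {v | c v = inl i ∧ v ≠ r ∧ ∃ j, v ∈ (P.path j).support}

variable (P : AlternatingPaths G c i r b)

theorem getVert_even_mem {j : J} {m : ℕ} (hm : 2 * m ≤ (P.path j).length) :
    (P.path j).getVert (2 * m) ∈ insert r P.core := by
  by_cases h : (P.path j).getVert (2 * m) = r
  · exact .inl h
  · exact .inr ⟨P.color_even j m hm, h, j, Walk.getVert_mem_support _ _⟩

theorem exists_getVert_even {j : J} {v : β} (hv : v ∈ (P.path j).support) (hc : c v = inl i) :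
    ∃ m, 2 * m ≤ (P.path j).length ∧ (P.path j).getVert (2 * m) = v := by
  obtain ⟨n, hn, hle⟩ := Walk.mem_support_iff_exists_getVert.1 hv
  obtain ⟨m, rfl | rfl⟩ := Nat.even_or_odd' n
  · exact ⟨m, hle, hn⟩
  · have := P.color_odd j m hle
    rw [hn, hc] at this
    cases this

theorem getVert_odd_inj {j j' : J} {m m' : ℕ} (hm : 2 * m + 1 ≤ (P.path j).length)
    (hm' : 2 * m' + 1 ≤ (P.path j').length)
    (h : (P.path j).getVert (2 * m + 1) = (P.path j').getVert (2 * m' + 1)) :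
    j = j' ∧ m = m' := by
  have hj : j = j' := by
    have := P.color_odd j m hm
    rw [h, P.color_odd j' m' hm'] at this
    exact (Sum.inr.inj this).symm
  subst hj
  have := (P.isPath j).getVert_injOn hm hm' h
  exact ⟨rfl, by omega⟩

/-- If every vertex of the core lies on two of the paths, then the functions glued along `F`
have dimension at most half the number of remaining inner vertices of the other colours. -/
theorem two_mul_finrank_le [Finite β] [DecidableEq β]
    (htwo : ∀ v ∈ P.core, ∃ j j', j ≠ j' ∧ v ∈ (P.path j).support ∧ v ∈ (P.path j').support)
    {E : Finset β} (hE : ∀ e j, c e = inr j → e ≠ b j → e ∈ E) (F : Finset β) :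
    2 * Module.finrank ℚ (gluedFunctions G P.core r F) ≤ (E \ F).card := by
  let R : β → β → Prop := fun u v =>
    ∃ e ∈ F, u ∈ insert r P.core ∧ v ∈ insert r P.core ∧ G.Adj u e ∧ G.Adj v e
  let s : Setoid β := Relation.EqvGen.setoid R
  let cl : β → Quotient s := Quotient.mk s
  have hcl : ∀ {u v}, R u v → cl u = cl v := fun h => Quotient.sound (.rel _ _ h)
  have hrC : r ∉ P.core := fun h => h.2.1 rfl
  let Cl := {q : Quotient s // q ≠ cl r ∧ ∃ v ∈ P.core, cl v = q}
  have : Finite (Quotient s) := Quotient.finite s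
  have : Fintype Cl := Fintype.ofFinite Cl
  choose rep hrepA hrep using fun q : Cl => q.2.2
  have hconst : ∀ φ ∈ gluedFunctions G P.core r F, ∀ u v, cl u = cl v → φ u = φ v := by
    intro φ hφ u v h
    have hR : Relation.EqvGen R u v := Quotient.exact h
    clear h
    induction hR with
    | rel x y h =>
      obtain ⟨e, he, hx, hy, hxe, hye⟩ := h
      exact hφ.2 e he x hx y hy hxe hye
    | refl x => rfl
    | symm x y _ ih => exact ih.symm
    | trans x y z _ _ ih ih' => exact ih.trans ih'
  have hrank : Module.finrank ℚ (gluedFunctions G P.core r F) ≤ Fintype.card Cl := by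
    rw [← Module.finrank_fintype_fun_eq_card ℚ (η := Cl)]
    refine LinearMap.finrank_le_finrank_of_injective
      (f := (LinearMap.funLeft ℚ ℚ rep) ∘ₗ (gluedFunctions G P.core r F).subtype) ?_
    rw [← LinearMap.ker_eq_bot, LinearMap.ker_eq_bot']
    rintro ⟨φ, hφ⟩ h0
    ext v
    change φ v = 0
    by_cases hv : v ∈ P.core
    · by_cases hvr : cl v = cl r
      · rw [hconst φ hφ v r hvr, hφ.1 r hrC]
      · rw [hconst φ hφ v _ (hrep ⟨cl v, hvr, v, hv, rfl⟩).symm]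
        exact congrFun h0 ⟨cl v, hvr, v, hv, rfl⟩
    · exact hφ.1 v hv
  have hentry : ∀ (q : Cl) (j : J), rep q ∈ (P.path j).support →
      ∃ m, 2 * m + 2 ≤ (P.path j).length ∧ cl ((P.path j).getVert (2 * m + 2)) = q.1 ∧
        (P.path j).getVert (2 * m + 1) ∈ E \ F := by
    classical
    intro q j hj
    have hex : ∃ m, 2 * m ≤ (P.path j).length ∧ cl ((P.path j).getVert (2 * m)) = q.1 := by
      obtain ⟨m, hm, h⟩ := P.exists_getVert_even hj (hrepA q).1
      exact ⟨m, hm, h ▸ hrep q⟩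
    obtain ⟨m, ⟨hm, hq⟩, hmin⟩ : ∃ m, (2 * m ≤ (P.path j).length ∧
        cl ((P.path j).getVert (2 * m)) = q.1) ∧ ∀ m' < m, ¬(2 * m' ≤ (P.path j).length ∧
        cl ((P.path j).getVert (2 * m')) = q.1) :=
      ⟨Nat.find hex, Nat.find_spec hex, fun _ => Nat.find_min hex⟩
    obtain _ | m := m
    · rw [mul_zero, Walk.getVert_zero] at hq
      exact absurd hq.symm q.2.1
    refine ⟨m, hm, hq, Finset.mem_sdiff.2 ⟨hE _ j (P.color_odd j m (by omega)) fun h => ?_,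
      fun hF => hmin m (by omega) ⟨by omega, ?_⟩⟩⟩
    · have := (P.isPath j).getVert_injOn (x₁ := 2 * m + 1) (x₂ := (P.path j).length)
        (by rw [Set.mem_ofPred]; omega) (le_refl (P.path j).length)
        (h.trans (Walk.getVert_length _).symm)
      omega
    · rw [← hq]
      exact hcl ⟨_, hF, P.getVert_even_mem (by omega), P.getVert_even_mem hm,
        (P.path j).adj_getVert_succ (by omega),
        ((P.path j).adj_getVert_succ (i := 2 * m + 1) (by omega)).symm⟩
  have hpick : ∀ (q : Cl), ∃ f : Bool → J, f false ≠ f true ∧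
      ∀ t, rep q ∈ (P.path (f t)).support := fun q => by
    obtain ⟨j, j', hne, hj, hj'⟩ := htwo _ (hrepA q)
    exact ⟨fun t => if t then j' else j, by simpa using hne, by simp [hj, hj']⟩
  choose f hf hmem using hpick
  choose m hm hq hEF using fun (x : Cl × Bool) => hentry x.1 (f x.1 x.2) (hmem x.1 x.2)
  have hcard : Fintype.card (Cl × Bool) ≤ (E \ F).card := by
    rw [← Fintype.card_coe]
    refine Fintype.card_le_of_injective
      (fun x => ⟨(P.path (f x.1 x.2)).getVert (2 * m x + 1), hEF x⟩) fun x y hxy => ?_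
    obtain ⟨hj, hmm⟩ := P.getVert_odd_inj (by have := hm x; omega) (by have := hm y; omega)
      (Subtype.mk.inj hxy)
    have hqq : x.1 = y.1 := Subtype.ext (by rw [← hq x, ← hq y, hj, hmm])
    obtain ⟨q, t⟩ := x
    obtain ⟨q', t'⟩ := y
    obtain rfl : q = q' := hqq
    have h := hf q
    cases t <;> cases t' <;> simp_all
  rw [Fintype.card_prod, Fintype.card_bool] at hcard
  omega

end AlternatingPaths

section Irreducible

variable {β J : Type} {G : SimpleGraph β} {a : Fin 2 → β} {b : J → β} {c : β → Fin 2 ⊕ J}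

theorem ColoredScheme.nonempty_alternatingPaths (hc : ColoredScheme G a b c)
    (hproper : ∀ x y, G.Adj x y → c x ≠ c y) (i : Fin 2) :
    Nonempty (AlternatingPaths G c i (a i) b) := by
  classical
  have hpath : ∀ j, ∃ p : G.Walk (a i) (b j), p.IsPath ∧
      ∀ w ∈ p.support, c w = inl i ∨ c w = inr j := fun j => by
    obtain ⟨p, hp⟩ := hc.reach i j
    exact ⟨p.bypass, p.bypass_isPath, fun w hw => hp w (p.support_bypass_subset_support hw)⟩
  choose p hp hcol using hpath
  have hodd : ∀ j m, 2 * m + 1 ≤ (p j).length → c ((p j).getVert (2 * m)) = inl i →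
      c ((p j).getVert (2 * m + 1)) = inr j := fun j m hm h =>
    (hcol j _ (Walk.getVert_mem_support _ _)).resolve_left fun h' =>
      hproper _ _ ((p j).adj_getVert_succ (by omega)) (h.trans h'.symm)
  have heven : ∀ j m, 2 * m ≤ (p j).length → c ((p j).getVert (2 * m)) = inl i := by
    intro j m
    induction m with
    | zero => exact fun _ => by rw [mul_zero, Walk.getVert_zero, hc.color_a]
    | succ m ih =>
      exact fun hm => (hcol j _ (Walk.getVert_mem_support _ _)).resolve_right fun h' =>
        hproper _ _ ((p j).adj_getVert_succ (i := 2 * m + 1) (by omega))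
          ((hodd j m (by omega) (ih (by omega))).trans h'.symm)
  exact ⟨⟨p, hp, heven, fun j m hm => hodd j m hm (heven j m (by omega))⟩⟩

theorem AlternatingPaths.exists_getVert_lt {i : Fin 2} (P : AlternatingPaths G c i (a i) b)
    (hb : ∀ j, c (b j) = inr j) {j : J} {v : β} (hv : v ∈ (P.path j).support)
    (hcv : c v = inl i) :
    ∃ m, 2 * m < (P.path j).length ∧ (P.path j).getVert (2 * m) = v := by
  obtain ⟨m, hm, h⟩ := P.exists_getVert_even hv hcv
  refine ⟨m, lt_of_le_of_ne hm fun h' => ?_, h⟩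
  rw [h', Walk.getVert_length] at h
  rw [← h, hb] at hcv
  cases hcv

/-- A proper colouring in which no vertex can be recoloured with the colour of a neighbour
yields a minor. -/
theorem exists_bipMinor_of_irreducible [Finite β] (hc : ColoredScheme G a b c)
    (hproper : ∀ x y, G.Adj x y → c x ≠ c y)
    (hirr : ∀ i s, s ≠ a i → c s = inl i → ∀ j₀ w, G.Adj s w → c w = inr j₀ →
      ∃ j ≠ j₀, ¬ReachIn G ({v | c v = inl i ∨ c v = inr j} \ {s}) (a i) (b j)) :
    ∃ A B, BipMinor G a b A B := by
  classical
  have := Fintype.ofFinite β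
  have P := fun i => (hc.nonempty_alternatingPaths hproper i).some
  have hsupp : ∀ i j, ∀ v ∈ ((P i).path j).support, c v = inl i ∨ c v = inr j := by
    intro i j v hv
    obtain ⟨n, rfl, hle⟩ := Walk.mem_support_iff_exists_getVert.1 hv
    obtain ⟨m, rfl | rfl⟩ := Nat.even_or_odd' n
    · exact .inl ((P i).color_even j m hle)
    · exact .inr ((P i).color_odd j m hle)
  have htwo : ∀ i, ∀ v ∈ (P i).core, ∃ j j', j ≠ j' ∧ v ∈ ((P i).path j).support ∧
      v ∈ ((P i).path j').support := by
    rintro i v ⟨hcv, hva, j, hj⟩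
    obtain ⟨m, hm, rfl⟩ := (P i).exists_getVert_lt hc.color_b hj hcv
    obtain ⟨j', hne, hj'⟩ := hirr i _ hva hcv j _ (((P i).path j).adj_getVert_succ hm)
      ((P i).color_odd j m hm)
    refine ⟨j, j', hne.symm, hj, ?_⟩
    by_contra hnot
    exact hj' ⟨(P i).path j', fun w hw => ⟨hsupp i j' w hw, fun h => hnot (h ▸ hw)⟩⟩
  set E : Finset β := Finset.univ.filter fun e => ∃ j, c e = inr j ∧ e ≠ b j with hEdef
  have hE : ∀ e j, c e = inr j → e ≠ b j → e ∈ E := fun e j h h' => by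
    simpa [hEdef] using ⟨j, h, h'⟩
  have hrank : ∀ i F, 2 * Module.finrank ℚ (gluedFunctions G (P i).core (a i) F) ≤ (E \ F).card :=
    fun i F => (P i).two_mul_finrank_le (htwo i) hE F
  obtain ⟨S₀, S₁, hS₀, hS₁, hdisj, hz₀, hz₁⟩ := exists_disjoint_of_supermodular E _ _
    (finrank_gluedFunctions_supermodular G (P 0).core (a 0))
    (finrank_gluedFunctions_supermodular G (P 1).core (a 1))
    (fun F _ => by have := hrank 0 F; have := hrank 1 F; omega)
  obtain ⟨S, hSE, hSd, hz⟩ : ∃ S : Fin 2 → Finset β, (∀ i, S i ⊆ E) ∧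
      (∀ i i', i ≠ i' → Disjoint (S i) (S i')) ∧
      ∀ i, gluedFunctions G (P i).core (a i) (S i) = ⊥ := by
    refine ⟨![S₀, S₁], ?_, ?_, ?_⟩
    · simp [Fin.forall_fin_two, hS₀, hS₁]
    · simp [Fin.forall_fin_two, hdisj, hdisj.symm]
    · simpa [Fin.forall_fin_two] using
        ⟨Submodule.finrank_eq_zero.1 hz₀, Submodule.finrank_eq_zero.1 hz₁⟩
  have hmem : ∀ i v, ReachIn G (insert (a i) (P i).core ∪ S i) (a i) v →
      c v = inl i ∨ v ∈ S i := fun i v h => by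
    rcases h.right_mem with (rfl | h) | h
    · exact .inl (hc.color_a i)
    · exact .inl h.1
    · exact .inr h
  have hEr : ∀ v ∈ E, ∃ j, c v = inr j ∧ v ≠ b j := fun v hv => by simpa [hEdef] using hv
  have hSr : ∀ i, ∀ v ∈ S i, ∀ i', c v ≠ inl i' := fun i v hv i' h => by
    obtain ⟨j, hj, _⟩ := hEr v (hSE i hv)
    rw [h] at hj
    cases hj
  refine ⟨fun i => {v | ReachIn G (insert (a i) (P i).core ∪ S i) (a i) v}, fun j => {b j},
    fun i => .refl (by simp), fun j => rfl, fun i => .component G _ _, fun j => .singleton G _,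
    fun i i' hi => Set.disjoint_left.2 fun v hv hv' => ?_,
    fun i j => Set.disjoint_singleton_right.2 fun h => ?_,
    fun j j' hj => Set.disjoint_singleton.2 fun h => hj ?_, fun i j => ?_⟩
  · rcases hmem i v hv with h | h
    · rcases hmem i' v hv' with h' | h'
      · exact hi (Sum.inl.inj (h.symm.trans h'))
      · exact hSr i' v h' i h
    · rcases hmem i' v hv' with h' | h'
      · exact hSr i v h i' h'
      · exact Finset.disjoint_left.1 (hSd i i' hi) h h'
  · rcases hmem i _ h with h | h
    · rw [hc.color_b] at h
      cases h
    · obtain ⟨j', h1, h2⟩ := hEr _ (hSE i h)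
      rw [hc.color_b] at h1
      exact h2 (congrArg b (Sum.inr.inj h1))
  · exact Sum.inr.inj ((hc.color_b j).symm.trans ((congrArg c h).trans (hc.color_b j')))
  · obtain ⟨m, hm | hm⟩ := Nat.even_or_odd' ((P i).path j).length
    · have := (P i).color_even j m hm.ge
      rw [← hm, Walk.getVert_length, hc.color_b] at this
      cases this
    · have hadj := ((P i).path j).adj_getVert_succ (i := 2 * m) (by omega)
      rw [← hm, Walk.getVert_length] at hadj
      refine ⟨_, ?_, _, rfl, hadj⟩
      rcases (P i).getVert_even_mem (j := j) (m := m) (by omega) with h | h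
      · rw [h]
        exact .refl (by simp)
      · exact reachIn_of_gluedFunctions_eq_bot (hz i) h

end Irreducible

/-- A coloured scheme yields a rooted complete bipartite minor whose branch sets at the `a i`
contain the monochromatic components of the `a i`. -/
theorem ColoredScheme.exists_bipMinor {J : Type} (n : ℕ) :
    ∀ (β : Type) [Finite β], Nat.card β = n → ∀ (G : SimpleGraph β)
      (a : Fin 2 → β) (b : J → β) (c : β → Fin 2 ⊕ J), ColoredScheme G a b c →
      ∃ A B, BipMinor G a b A B ∧ ∀ i v, ReachIn G {w | c w = inl i} (a i) v → v ∈ A i := by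
  classical
  induction n using Nat.strong_induction_on with
  | _ n ih =>
  intro β _ hn G a b c hc
  have IH : ∀ (Q : Type) [Finite Q], Nat.card Q < Nat.card β → ∀ (G : SimpleGraph Q)
      (a : Fin 2 → Q) (b : J → Q) (c : Q → Fin 2 ⊕ J), ColoredScheme G a b c →
      ∃ A B, BipMinor G a b A B ∧ ∀ i v, ReachIn G {w | c w = inl i} (a i) v → v ∈ A i :=
    fun Q _ hQ => ih _ (hn ▸ hQ) Q rfl
  by_cases hproper : ∀ x y, G.Adj x y → c x ≠ c y
  swap
  · push Not at hproper
    obtain ⟨x, y, hxy, hcxy⟩ := hproper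
    exact exists_bipMinor_of_contract hc IH hxy hcxy
  suffices ∃ A B, BipMinor G a b A B by
    obtain ⟨A, B, h⟩ := this
    refine ⟨A, B, h, fun i v hv => ?_⟩
    by_contra hvA
    obtain ⟨x, y, hxy, hx, hy, -⟩ := hv.exists_boundary (h.mem_a i) hvA
    exact hproper x y hxy (Eq.trans hx (Eq.symm hy))
  by_cases hirr : ∀ i s, s ≠ a i → c s = inl i → ∀ j₀ w, G.Adj s w → c w = inr j₀ →
      ∃ j ≠ j₀, ¬ReachIn G ({v | c v = inl i ∨ c v = inr j} \ {s}) (a i) (b j)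
  · exact exists_bipMinor_of_irreducible hc hproper hirr
  push Not at hirr
  obtain ⟨i, s, hsa, hcs, j₀, w, hsw, hcw, hreach⟩ := hirr
  have hupd : ∀ v, v ≠ s → Function.update c s (inr j₀) v = c v :=
    fun v hv => Function.update_of_ne hv _ _
  have hc' : ColoredScheme G a b (Function.update c s (inr j₀)) := by
    refine ⟨fun i' => ?_, fun j => ?_, fun i' j => ?_⟩
    · rw [hupd _ fun h => ?_, hc.color_a]
      have := hc.color_a i'
      rw [h, hcs] at this
      exact hsa (by rw [← h, Sum.inl.inj this])
    · rw [hupd _ fun h => ?_, hc.color_b]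
      have := hc.color_b j
      rw [h, hcs] at this
      cases this
    · by_cases hj : j = j₀
      · refine (hc.reach i' j).mono fun v hv => ?_
        by_cases hvs : v = s
        · exact .inr (by rw [hvs, Function.update_self, hj])
        · simpa only [Set.mem_ofPred_eq, hupd v hvs] using hv
      · by_cases hi : i' = i
        · subst hi
          refine (hreach j hj).mono fun v hv => ?_
          simpa only [Set.mem_ofPred_eq, hupd v hv.2] using hv.1
        · refine (hc.reach i' j).mono fun v hv => ?_
          have hvs : v ≠ s := by
            rintro rfl
            rcases hv with h | h
            · exact hi (Sum.inl.inj (h.symm.trans hcs))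
            · cases hcs.symm.trans h
          simpa only [Set.mem_ofPred_eq, hupd v hvs] using hv
  obtain ⟨A, B, h, -⟩ := exists_bipMinor_of_contract hc' IH hsw
    (by rw [Function.update_self, hupd w hsw.ne.symm, hcw])
  exact ⟨A, B, h⟩

section Maximal

variable {β J : Type} {G : SimpleGraph β} {a : Fin 2 → β} {b : J → β} {A : Fin 2 → Set β}
  {B : J → Set β}

open Classical in
/-- Enlarging one branch set `A i` of a minor while shrinking the branch sets `B j`. -/
theorem BipMinor.enlarge (h : BipMinor G a b A B) (i : Fin 2) (X : Set β) {B' : J → Set β}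
    (hconn : ConnIn G (A i ∪ X)) (hXA : ∀ i', i' ≠ i → Disjoint X (A i'))
    (hXB : ∀ j, Disjoint X (B' j)) (hsub : ∀ j, B' j ⊆ B j) (hb : ∀ j, b j ∈ B' j)
    (hconnB : ∀ j, ConnIn G (B' j))
    (hadj : ∀ i' j, ∃ x ∈ Function.update A i (A i ∪ X) i', ∃ y ∈ B' j, G.Adj x y) :
    BipMinor G a b (Function.update A i (A i ∪ X)) B' where
  mem_a i' := by
    obtain rfl | hi := eq_or_ne i' i
    · simp [h.mem_a]
    · simp [hi, h.mem_a]
  mem_b := hb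
  conn_a i' := by
    obtain rfl | hi := eq_or_ne i' i
    · simpa using hconn
    · simpa [hi] using h.conn_a i'
  conn_b := hconnB
  disj_aa i₁ i₂ hne := by
    obtain rfl | h₁ := eq_or_ne i₁ i
    · simpa [hne.symm] using ⟨h.disj_aa _ _ hne, hXA _ hne.symm⟩
    · obtain rfl | h₂ := eq_or_ne i₂ i
      · simpa [hne] using ⟨h.disj_aa _ _ hne, (hXA _ hne).symm⟩
      · simpa [h₁, h₂] using h.disj_aa _ _ hne
  disj_ab i' j := by
    obtain rfl | hi := eq_or_ne i' i
    · simpa using ⟨(h.disj_ab _ j).mono_right (hsub j), hXB j⟩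
    · simpa [hi] using (h.disj_ab i' j).mono_right (hsub j)
  disj_bb j j' hj := (h.disj_bb j j' hj).mono (hsub j) (hsub j')
  adj := hadj

open Classical in
theorem sum_ncard_lt_update [Finite β] (A : Fin 2 → Set β) (i : Fin 2) {X : Set β} {v : β}
    (hv : v ∈ X) (hvA : v ∉ A i) :
    ∑ i', (A i').ncard < ∑ i', (Function.update A i (A i ∪ X) i').ncard := by
  refine Finset.sum_lt_sum (fun i' _ => Set.ncard_le_ncard ?_ (Set.toFinite _))
    ⟨i, Finset.mem_univ i, Set.ncard_lt_ncard ?_ (Set.toFinite _)⟩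
  · obtain rfl | hi := eq_or_ne i' i
    · simp
    · simp [hi]
  · rw [Function.update_self]
    exact ⟨Set.subset_union_left, fun h => hvA (h (.inr hv))⟩

/-- Moving a part `X` of a branch set `B k` to `A i` enlarges the sets `A`. -/
theorem BipMinor.exists_lt_of_split [Finite β] (h : BipMinor G a b A B) {i i' : Fin 2}
    (hi : i ≠ i') {k : J} {X Y : Set β} (hXY : X ∪ Y = B k) (hdisj : Disjoint X Y)
    (hX : ConnIn G X) (hY : ConnIn G Y) (hb : b k ∈ Y) (hadj : ∃ u ∈ X, ∃ w ∈ Y, G.Adj u w)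
    (hiX : ∃ x ∈ A i, ∃ y ∈ X, G.Adj x y) (hiY : ∃ x ∈ A i', ∃ y ∈ Y, G.Adj x y) :
    ∃ A' B', BipMinor G a b A' B' ∧ ∑ i, (A i).ncard < ∑ i, (A' i).ncard := by
  classical
  have hXk : X ⊆ B k := hXY ▸ Set.subset_union_left
  have hYk : Y ⊆ B k := hXY ▸ Set.subset_union_right
  obtain ⟨u, hu, w, hw, huw⟩ := hadj
  refine ⟨_, Function.update B k Y, h.enlarge i X ((h.conn_a i).union hX hiX)
    (fun i' _ => ((h.disj_ab i' k).mono_right hXk).symm) (fun j => ?_) (fun j => ?_) (fun j => ?_)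
    (fun j => ?_) (fun i₁ j => ?_),
    sum_ncard_lt_update A i hu fun h' => Set.disjoint_left.1 (h.disj_ab i k) h' (hXk hu)⟩
  · obtain rfl | hj := eq_or_ne j k
    · simpa using hdisj
    · simpa [hj] using (h.disj_bb k j hj.symm).mono_left hXk
  · obtain rfl | hj := eq_or_ne j k
    · simpa using hYk
    · simp [hj]
  · obtain rfl | hj := eq_or_ne j k
    · simpa using hb
    · simp [hj, h.mem_b]
  · obtain rfl | hj := eq_or_ne j k
    · simpa using hY
    · simpa [hj] using h.conn_b j
  · obtain rfl | hj := eq_or_ne j k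
    · rw [Function.update_self]
      obtain rfl | h₁ := eq_or_ne i₁ i
      · exact ⟨u, by simp [hu], w, hw, huw⟩
      · obtain rfl : i₁ = i' := by omega
        rwa [Function.update_of_ne h₁]
    · rw [Function.update_of_ne hj]
      obtain ⟨x, hx, y, hy, hxy⟩ := h.adj i₁ j
      refine ⟨x, ?_, y, hy, hxy⟩
      obtain rfl | h₁ := eq_or_ne i₁ i
      · simp [hx]
      · simpa [h₁] using hx

/-- In a minor with `A 0` and `A 1` of largest total size, a vertex outside of them adjacent to
one of them is adjacent to both. -/
theorem BipMinor.adj_of_maximal [Finite β] (h : BipMinor G a b A B)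
    (hmax : ∀ A' B', BipMinor G a b A' B' → ∑ i, (A' i).ncard ≤ ∑ i, (A i).ncard)
    {v : β} (hv : ∀ i, v ∉ A i) {i : Fin 2} (hvi : ∃ x ∈ A i, G.Adj x v) (i' : Fin 2) :
    ∃ x ∈ A i', G.Adj x v := by
  classical
  obtain rfl | hi := eq_or_ne i i'
  · exact hvi
  obtain ⟨x, hx, hxv⟩ := hvi
  by_cases hB : ∃ k, v ∈ B k
  · obtain ⟨k, hk⟩ := hB
    obtain ⟨y, hy, n, hn, hyn⟩ := h.adj i' k
    obtain rfl | hvn := eq_or_ne v n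
    · exact ⟨y, hy, hyn⟩
    exfalso
    obtain ⟨X, Y, hXY, hdisj, hvX, hnY, hX, hY, u, hu, w, hw, huw⟩ :=
      (h.conn_b k).exists_split hk hn hvn
    have hb : b k ∈ X ∪ Y := hXY ▸ h.mem_b k
    obtain ⟨A', B', h', hlt⟩ : ∃ A' B', BipMinor G a b A' B' ∧
        ∑ i, (A i).ncard < ∑ i, (A' i).ncard := by
      rcases hb with hb | hb
      · exact h.exists_lt_of_split hi.symm (by rwa [Set.union_comm]) hdisj.symm hY hX hb
          ⟨w, hw, u, hu, huw.symm⟩ ⟨y, hy, n, hnY, hyn⟩ ⟨x, hx, v, hvX, hxv⟩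
      · exact h.exists_lt_of_split hi hXY hdisj hX hY hb
          ⟨u, hu, w, hw, huw⟩ ⟨x, hx, v, hvX, hxv⟩ ⟨y, hy, n, hnY, hyn⟩
    exact absurd (hmax A' B' h') (not_le.2 hlt)
  · exfalso
    push Not at hB
    refine absurd (hmax _ B (h.enlarge i {v}
      ((h.conn_a i).union (.singleton G v) ⟨x, hx, v, rfl, hxv⟩)
      (fun i' _ => Set.disjoint_singleton_left.2 (hv i'))
      (fun j => Set.disjoint_singleton_left.2 (hB j)) (fun _ => subset_rfl) h.mem_b h.conn_b
      fun i₁ j => ?_)) (not_le.2 (sum_ncard_lt_update A i (Set.mem_singleton v) (hv i)))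
    obtain ⟨y, hy, z, hz, hyz⟩ := h.adj i₁ j
    refine ⟨y, ?_, z, hz, hyz⟩
    obtain rfl | h₁ := eq_or_ne i₁ i
    · simp [hy]
    · simpa [h₁] using hy

/-- If moreover `a 0` and `a 1` are joined by a walk in their two colours, then the branch sets
at `a 0` and `a 1` can be made adjacent. -/
theorem ColoredScheme.exists_bipMinor_adj [Finite β] {c : β → Fin 2 ⊕ J}
    (hc : ColoredScheme G a b c)
    (hreach : ReachIn G {v | c v = inl 0 ∨ c v = inl 1} (a 0) (a 1)) :
    ∃ A B, BipMinor G a b A B ∧ ∃ x ∈ A 0, ∃ y ∈ A 1, G.Adj x y := by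
  classical
  obtain ⟨A₀, B₀, h₀, -⟩ := ColoredScheme.exists_bipMinor _ β rfl G a b c hc
  obtain ⟨A, ⟨B, h⟩, hmax⟩ := Set.exists_max_image {A | ∃ B, BipMinor G a b A B}
    (fun A => ∑ i, (A i).ncard) (Set.toFinite _) ⟨A₀, B₀, h₀⟩
  have hnbr := fun v hv i hvi i' => h.adj_of_maximal (fun A' B' h' => hmax A' ⟨B', h'⟩)
    (v := v) hv (i := i) hvi i'
  by_cases hadj : ∃ x ∈ A 0, ∃ y ∈ A 1, G.Adj x y
  · exact ⟨A, B, h, hadj⟩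
  obtain ⟨c', hin, hout⟩ : ∃ c' : β → Fin 2 ⊕ J, (∀ i, ∀ v ∈ A i, c' v = inl i) ∧
      ∀ v, (∀ i, v ∉ A i) → c' v = c v := by
    refine ⟨fun v => if hv : ∃ i, v ∈ A i then inl hv.choose else c v, fun i v hv => ?_,
      fun v hv => ?_⟩
    · have hex : ∃ i, v ∈ A i := ⟨i, hv⟩
      refine (dif_pos hex).trans ?_
      by_contra hne
      exact Set.disjoint_left.1 (h.disj_aa _ _ fun h' => hne (congrArg inl h')) hex.choose_spec hv
    · exact dif_neg (not_exists.2 hv)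
  have hc' : ColoredScheme G a b c' := by
    refine ⟨fun i => hin i _ (h.mem_a i), fun j => ?_, fun i j => ?_⟩
    · rw [hout _ fun i hi => Set.disjoint_left.1 (h.disj_ab i j) hi (h.mem_b j), hc.color_b]
    · have key : ∀ u v (p : G.Walk u v), v = b j →
          (∀ w ∈ p.support, c w = inl i ∨ c w = inr j) →
          ReachIn G {v | c' v = inl i ∨ c' v = inr j} (a i) v ∨
            (∀ i, u ∉ A i) ∧ ReachIn G {v | c' v = inl i ∨ c' v = inr j} u v := by
        intro u v p hv
        subst hv
        have hbA : ∀ i, b j ∉ A i := fun i hi =>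
          Set.disjoint_left.1 (h.disj_ab i j) hi (h.mem_b j)
        generalize hz : b j = z at p hbA
        induction p with
        | nil => exact fun hp => .inr ⟨hbA, .refl (by
            rw [Set.mem_ofPred_eq, hout _ hbA]; exact hp _ (by simp))⟩
        | @cons u w v huw p ih =>
          intro hp
          rcases ih hz hbA fun z hz => hp z (by simp [hz]) with hl | ⟨hw, hr⟩
          · exact .inl hl
          by_cases hu : ∀ i, u ∉ A i
          · refine .inr ⟨hu, (ReachIn.of_adj huw ?_ hr.left_mem).trans hr⟩
            rw [Set.mem_ofPred_eq, hout _ hu]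
            exact hp _ (by simp)
          · push Not at hu
            obtain ⟨i₁, hi₁⟩ := hu
            obtain ⟨x, hx, hxw⟩ := hnbr w hw i₁ ⟨u, hi₁, huw⟩ i
            exact .inl ((((h.conn_a i _ (h.mem_a i) x hx).mono fun v hv => .inl (hin i v hv)).trans
              (.of_adj hxw (.inl (hin i x hx)) hr.left_mem)).trans hr)
      obtain ⟨p, hp⟩ := hc.reach i j
      rcases key _ _ p rfl hp with h' | h'
      · exact h'
      · exact absurd (h.mem_a i) (h'.1 i)
  obtain ⟨A', B', h', hmono⟩ := ColoredScheme.exists_bipMinor _ β rfl G a b c' hc'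
  have hsub : ∀ i, ∀ v ∈ A i, ReachIn G {w | c' w = inl i} (a i) v := fun i v hv =>
    (h.conn_a i _ (h.mem_a i) v hv).mono (hin i)
  have ha₁ : a 1 ∉ A 0 := fun h₀ =>
    Set.disjoint_left.1 (h.disj_aa 0 1 (by decide)) h₀ (h.mem_a 1)
  obtain ⟨x, q, hxq, -, hcq, hx, hq⟩ := hreach.exists_boundary (h.mem_a 0) ha₁
  have hqA : ∀ i, q ∉ A i := by
    rw [Fin.forall_fin_two]
    exact ⟨hq, fun hq₁ => hadj ⟨x, hx, q, hq₁, hxq⟩⟩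
  obtain ⟨y, hy, hyq⟩ := hnbr q hqA 0 ⟨x, hx, hxq⟩ 1
  refine ⟨A', B', h', ?_⟩
  rcases hcq with hcq | hcq
  · refine ⟨q, hmono 0 q ((hsub 0 x hx).trans (.of_adj hxq (hin 0 x hx) ?_)), y,
      hmono 1 y (hsub 1 y hy), hyq.symm⟩
    exact (hout q hqA).trans hcq
  · refine ⟨x, hmono 0 x (hsub 0 x hx), q,
      hmono 1 q ((hsub 1 y hy).trans (.of_adj hyq (hin 1 y hy) ?_)), hxq⟩
    exact (hout q hqA).trans hcq

end Maximal

/-- A scheme induces a colouring by the vertices of `H`. -/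
theorem HScheme.exists_coloring {α β : Type} [Nonempty α] {H : SimpleGraph α}
    {G : SimpleGraph β} {f : α ↪ β} (s : HScheme H G f) :
    ∃ c : β → α, (∀ u, c (f u) = u) ∧
      ∀ u v, H.Adj u v → ReachIn G {x | c x = u ∨ c x = v} (f u) (f v) := by
  classical
  have hex : ∀ x : β, ∃ z : α, (∀ u, f u = x → z = u) ∧
      ∀ u v (h : H.Adj u v), x ∈ (s.path u v h).support → z = u ∨ z = v := by
    intro x
    by_cases hx : ∃ u, f u = x
    · obtain ⟨u, rfl⟩ := hx
      exact ⟨u, fun v hv => (f.injective hv).symm, fun v w h hu => s.root_mem v w h u hu⟩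
    · by_cases hp : ∃ u v, ∃ h : H.Adj u v, x ∈ (s.path u v h).support
      · obtain ⟨z, hz⟩ := s.common_endpoint x hp
        exact ⟨z, fun u hu => absurd ⟨u, hu⟩ hx, hz⟩
      · exact ⟨Classical.arbitrary α, fun u hu => absurd ⟨u, hu⟩ hx,
          fun u v h hu => absurd ⟨u, v, h, hu⟩ hp⟩
  choose c hc hcp using hex
  exact ⟨c, fun u => hc _ u rfl, fun u v h =>
    ⟨s.path u v h, fun x hx => (hcp x u v h hx).imp id id⟩⟩

/-- A graph obtained from a complete bipartite graph with two vertices on one side by possibly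
joining these two vertices is rooted-contractible. -/
theorem isRootedContractible_of_equiv {α J : Type} {H : SimpleGraph α} (e : Fin 2 ⊕ J ≃ α)
    (h_adj : ∀ i j, H.Adj (e (inl i)) (e (inr j)))
    (h_ind : ∀ j j', ¬H.Adj (e (inr j)) (e (inr j'))) : IsRootedContractible H := by
  rintro β _ G f ⟨s⟩
  have : Nonempty α := ⟨e (inl 0)⟩
  obtain ⟨c, hcf, hreach⟩ := s.exists_coloring
  have hcol : ∀ x k, e.symm (c x) = k ↔ c x = e k := fun x k => e.symm_apply_eq
  have hc : ColoredScheme G (fun i => f (e (inl i))) (fun j => f (e (inr j)))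
      (fun x => e.symm (c x)) :=
    { color_a := fun i => by simp [hcf]
      color_b := fun j => by simp [hcf]
      reach := fun i j => by simpa only [hcol] using hreach _ _ (h_adj i j) }
  obtain ⟨A, B, h, hA⟩ : ∃ A B, BipMinor G (fun i => f (e (inl i))) (fun j => f (e (inr j))) A B ∧
      (H.Adj (e (inl 0)) (e (inl 1)) → ∃ x ∈ A 0, ∃ y ∈ A 1, G.Adj x y) := by
    by_cases h01 : H.Adj (e (inl 0)) (e (inl 1))
    · obtain ⟨A, B, h, hA⟩ := hc.exists_bipMinor_adj
        (by simpa only [hcol] using hreach _ _ h01)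
      exact ⟨A, B, h, fun _ => hA⟩
    · obtain ⟨A, B, h, -⟩ := ColoredScheme.exists_bipMinor _ β rfl _ _ _ _ hc
      exact ⟨A, B, h, fun h' => absurd h' h01⟩
  refine ⟨fun v => Sum.elim A B (e.symm v), ?_, ?_, ?_, ?_⟩
  · refine e.forall_congr_right.1 ?_
    rintro (i | j)
    · simpa using h.mem_a i
    · simpa using h.mem_b j
  · have hconn : ∀ k, (G.induce (Sum.elim A B k)).Connected := by
      rintro (i | j)
      · exact (h.conn_a i).induce_connected ⟨_, h.mem_a i⟩
      · exact (h.conn_b j).induce_connected ⟨_, h.mem_b j⟩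
    exact fun v => hconn _
  · have hd : ∀ k l, k ≠ l → Disjoint (Sum.elim A B k) (Sum.elim A B l) := by
      rintro (i | j) (i' | j') hne
      · exact h.disj_aa i i' fun h' => hne (congrArg inl h')
      · exact h.disj_ab i j'
      · exact (h.disj_ab i' j).symm
      · exact h.disj_bb j j' fun h' => hne (congrArg inr h')
    exact fun u v huv => hd _ _ fun h' => huv (e.symm.injective h')
  · have hk : ∀ k l, H.Adj (e k) (e l) →
        ∃ x ∈ Sum.elim A B k, ∃ y ∈ Sum.elim A B l, G.Adj x y := by
      rintro (i | j) (i' | j') hkl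
      · fin_cases i <;> fin_cases i'
        · exact absurd hkl (H.loopless.irrefl _)
        · exact hA hkl
        · obtain ⟨x, hx, y, hy, hxy⟩ := hA hkl.symm
          exact ⟨y, hy, x, hx, hxy.symm⟩
        · exact absurd hkl (H.loopless.irrefl _)
      · exact h.adj i j'
      · obtain ⟨x, hx, y, hy, hxy⟩ := h.adj i' j
        exact ⟨y, hy, x, hx, hxy.symm⟩
      · exact absurd hkl (h_ind j j')
    intro u v huv
    exact hk _ _ (by simpa using huv)

/-- The two singleton parts of `K_{1,1,3}`, followed by the vertices of the third part. -/
def completeMultipartiteEquiv : Fin 2 ⊕ Fin 3 ≃ Σ i : Fin 3, ![Fin 1, Fin 1, Fin 3] i where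
  toFun := Sum.elim ![⟨0, (0 : Fin 1)⟩, ⟨1, (0 : Fin 1)⟩] fun j => ⟨2, j⟩
  invFun
    | ⟨0, _⟩ => inl 0
    | ⟨1, _⟩ => inl 1
    | ⟨2, j⟩ => inr j
  left_inv := by
    rintro (i | j)
    · fin_cases i <;> rfl
    · rfl
  right_inv := by
    rintro ⟨i, x⟩
    fin_cases i
    · obtain rfl : x = (0 : Fin 1) := Subsingleton.elim (α := Fin 1) _ _
      rfl
    · obtain rfl : x = (0 : Fin 1) := Subsingleton.elim (α := Fin 1) _ _
      rfl
    · rfl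

end

/-- `K_{2,3}` and `K_{1,1,3}` are rooted-contractible. -/
theorem K23_and_K113_rooted_contractible :
    IsRootedContractible (completeBipartiteGraph (Fin 2) (Fin 3)) ∧
    IsRootedContractible (completeMultipartiteGraph ![Fin 1, Fin 1, Fin 3]) := by
  refine ⟨isRootedContractible_of_equiv (Equiv.refl _) (by simp) (by simp),
    isRootedContractible_of_equiv completeMultipartiteEquiv (fun i j => ?_) fun j j' h => h rfl⟩
  fin_cases i <;> exact fun h => absurd (congrArg Fin.val h) (by revert j; decide)
end
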